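/- There exists a universal constant C ≥ 1 with the following property. For every ε > 0 there is n₀ ∈ ℕ such that for every n ≥ n₀ and every p satisfying C·ln n ≤ p·n and p ≤ C⁻¹, the n×n Bernoulli(p) random matrix M_n satisfies |P{M_n is singular} − 2n(1−p)ⁿ| ≤ ε·n(1−p)ⁿ, and moreover for every t > 0, P{s_min(M_n) ≤ t·exp(−3·ln²(2n))} ≤ t + (2+ε)·n(1−p)ⁿ, where s_min denotes the smallest singular value. -/

import Mathlib

open MeasureTheory

/-- Euclidean norm of a vector in `ℝⁿ`. -/
noncomputable def eNorm {n : ℕ} (x : Fin n → ℝ) : ℝ := Real.sqrt (∑ i, (x i) ^ 2)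

/-- Smallest singular value of an `n × n` real matrix:
`s_min(A) = inf { ‖Ax‖ : ‖x‖ = 1 }`. -/
noncomputable def sMin {n : ℕ} (A : Matrix (Fin n) (Fin n) ℝ) : ℝ :=
  sInf {r | ∃ x : Fin n → ℝ, eNorm x = 1 ∧ r = eNorm (A.mulVec x)}

/-- `M` is a random `n × n` matrix with i.i.d. Bernoulli(p) entries: the entries take values
in `{0,1}` and the probability of any given `0/1` pattern `A` equals
`p ^ (#ones of A) * (1-p) ^ (#zeros of A)`. -/
def IsBernoulliMatrix {Ω : Type*} [MeasurableSpace Ω] (μ : Measure Ω) {n : ℕ}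
    (M : Ω → Matrix (Fin n) (Fin n) ℝ) (p : ℝ) : Prop :=
  (∀ ω i j, M ω i j = 0 ∨ M ω i j = 1) ∧
  ∀ A : Matrix (Fin n) (Fin n) ℝ, (∀ i j, A i j = 0 ∨ A i j = 1) →
    μ {ω | M ω = A} =
      ENNReal.ofReal
        (p ^ (Finset.univ.filter (fun ij : Fin n × Fin n => A ij.1 ij.2 = 1)).card *
          (1 - p) ^ (Finset.univ.filter (fun ij : Fin n × Fin n => A ij.1 ij.2 = 0)).card)

set_option linter.all false

namespace SB
open Finset

/-- Indicator of a proposition, as a real number. -/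
noncomputable def ind (S : Prop) : ℝ := by
  classical exact if S then 1 else 0

lemma ind_true {S : Prop} (h : S) : ind S = 1 := by simp [ind, h]
lemma ind_false {S : Prop} (h : ¬ S) : ind S = 0 := by simp [ind, h]
lemma ind_nonneg (S : Prop) : 0 ≤ ind S := by
  by_cases h : S <;> simp [ind, h]
lemma ind_le_one (S : Prop) : ind S ≤ 1 := by
  by_cases h : S <;> simp [ind, h]
lemma ind_mono {S T : Prop} (h : S → T) : ind S ≤ ind T := by
  by_cases hS : S
  · rw [ind_true hS, ind_true (h hS)]
  · rw [ind_false hS]; exact ind_nonneg T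
lemma ind_and (S T : Prop) : ind (S ∧ T) = ind S * ind T := by
  by_cases hS : S <;> by_cases hT : T <;> simp [ind, hS, hT]
lemma ind_not (S : Prop) : ind (¬ S) = 1 - ind S := by
  by_cases hS : S <;> simp [ind, hS]

/-- Finite expectation with weights `w`. -/
noncomputable def Ex {α : Type*} [Fintype α] (w : α → ℝ) (f : α → ℝ) : ℝ := ∑ a, w a * f a

/-- Finite probability with weights `w`. -/
noncomputable def Pr {α : Type*} [Fintype α] (w : α → ℝ) (S : α → Prop) : ℝ :=
  ∑ a, w a * ind (S a)

section basic
variable {α : Type*} [Fintype α] {w : α → ℝ}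

lemma Ex_mono (hw : ∀ a, 0 ≤ w a) {f g : α → ℝ} (h : ∀ a, f a ≤ g a) : Ex w f ≤ Ex w g :=
  Finset.sum_le_sum fun a _ => mul_le_mul_of_nonneg_left (h a) (hw a)

lemma Ex_nonneg (hw : ∀ a, 0 ≤ w a) {f : α → ℝ} (h : ∀ a, 0 ≤ f a) : 0 ≤ Ex w f :=
  Finset.sum_nonneg fun a _ => mul_nonneg (hw a) (h a)

lemma Ex_add (f g : α → ℝ) : Ex w (fun a => f a + g a) = Ex w f + Ex w g := by
  simp [Ex, mul_add, Finset.sum_add_distrib]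

lemma Ex_smul (c : ℝ) (f : α → ℝ) : Ex w (fun a => c * f a) = c * Ex w f := by
  simp only [Ex, Finset.mul_sum]
  exact Finset.sum_congr rfl fun a _ => by ring

lemma Ex_sum {β : Type*} (s : Finset β) (f : β → α → ℝ) :
    Ex w (fun a => ∑ b ∈ s, f b a) = ∑ b ∈ s, Ex w (f b) := by
  simp only [Ex, Finset.mul_sum]
  exact Finset.sum_comm

lemma Ex_const (h1 : ∑ a, w a = 1) (c : ℝ) : Ex w (fun _ => c) = c := by
  simp [Ex, ← Finset.sum_mul, h1]

lemma Pr_eq_Ex (S : α → Prop) : Pr w S = Ex w (fun a => ind (S a)) := rfl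

lemma Pr_nonneg (hw : ∀ a, 0 ≤ w a) (S : α → Prop) : 0 ≤ Pr w S :=
  Ex_nonneg hw fun _ => ind_nonneg _

lemma Pr_mono (hw : ∀ a, 0 ≤ w a) {S T : α → Prop} (h : ∀ a, S a → T a) : Pr w S ≤ Pr w T :=
  Ex_mono hw fun a => ind_mono (h a)

lemma Pr_le_Ex (hw : ∀ a, 0 ≤ w a) {S : α → Prop} {f : α → ℝ} (h0 : ∀ a, 0 ≤ f a)
    (h : ∀ a, S a → 1 ≤ f a) : Pr w S ≤ Ex w f := by
  refine Ex_mono hw fun a => ?_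
  by_cases hS : S a
  · rw [ind_true hS]; exact h a hS
  · rw [ind_false hS]; exact h0 a

lemma Pr_le_one (hw : ∀ a, 0 ≤ w a) (h1 : ∑ a, w a = 1) (S : α → Prop) : Pr w S ≤ 1 := by
  calc Pr w S ≤ Ex w (fun _ => 1) := Ex_mono hw fun _ => ind_le_one _
    _ = 1 := Ex_const h1 1

lemma Pr_not (h1 : ∑ a, w a = 1) (S : α → Prop) : Pr w (fun a => ¬ S a) = 1 - Pr w S := by
  simp only [Pr, ind_not, mul_sub, Finset.sum_sub_distrib, mul_one, h1]

lemma Pr_or_le (hw : ∀ a, 0 ≤ w a) (S T : α → Prop) :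
    Pr w (fun a => S a ∨ T a) ≤ Pr w S + Pr w T := by
  rw [Pr_eq_Ex, Pr_eq_Ex, Pr_eq_Ex, ← Ex_add]
  refine Ex_mono hw fun a => ?_
  by_cases hS : S a <;> by_cases hT : T a <;> simp [ind, hS, hT]

lemma Pr_exists_le (hw : ∀ a, 0 ≤ w a) {β : Type*} (s : Finset β) (S : β → α → Prop) :
    Pr w (fun a => ∃ b ∈ s, S b a) ≤ ∑ b ∈ s, Pr w (S b) := by
  have : ∑ b ∈ s, Pr w (S b) = Ex w (fun a => ∑ b ∈ s, ind (S b a)) := (Ex_sum s _).symm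
  rw [this]
  refine Pr_le_Ex hw (fun a => Finset.sum_nonneg fun b _ => ind_nonneg _) ?_
  rintro a ⟨b, hb, hS⟩
  calc (1 : ℝ) = ind (S b a) := (ind_true hS).symm
    _ ≤ _ := Finset.single_le_sum (f := fun b => ind (S b a)) (fun b _ => ind_nonneg _) hb

lemma Pr_exists_le_card (hw : ∀ a, 0 ≤ w a) {β : Type*} (s : Finset β) (S : β → α → Prop)
    (c : ℝ) (hc : ∀ b ∈ s, Pr w (S b) ≤ c) :
    Pr w (fun a => ∃ b ∈ s, S b a) ≤ s.card * c := by
  refine (Pr_exists_le hw s S).trans ?_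
  simpa using Finset.sum_le_card_nsmul s _ c hc

lemma Pr_markov (hw : ∀ a, 0 ≤ w a) {f : α → ℝ} (hf : ∀ a, 0 ≤ f a) {c : ℝ} (hc : 0 < c) :
    Pr w (fun a => c ≤ f a) ≤ Ex w f / c := by
  have : Ex w f / c = Ex w (fun a => c⁻¹ * f a) := by rw [Ex_smul]; field_simp
  rw [this]
  refine Pr_le_Ex hw (fun a => mul_nonneg (inv_nonneg.2 hc.le) (hf a)) fun a ha => ?_
  rw [inv_mul_eq_div, le_div_iff₀ hc]; simpa using ha

lemma exists_of_Ex (hw : ∀ a, 0 ≤ w a) (h1 : ∑ a, w a = 1) {S : α → Prop} (h : 0 < Pr w S) :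
    ∃ a, S a := by
  by_contra hcon
  push Not at hcon
  have : Pr w S = 0 := by
    simp [Pr, ind_false (hcon _)]
  linarith

lemma exists_ge_of_Ex (hw : ∀ a, 0 ≤ w a) (h1 : ∑ a, w a = 1) {f : α → ℝ} {c : ℝ}
    (h : c ≤ Ex w f) : ∃ a, c ≤ f a := by
  by_contra hcon
  push Not at hcon
  have h2 : Ex w f < c := by
    rw [← Ex_const h1 c]
    obtain ⟨a, -, ha⟩ : ∃ a ∈ (Finset.univ : Finset α), 0 < w a := by
      by_contra hh
      push Not at hh
      have : ∑ a, w a ≤ 0 := Finset.sum_nonpos hh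
      linarith
    exact Finset.sum_lt_sum (fun a _ => mul_le_mul_of_nonneg_left (hcon a).le (hw a))
      ⟨a, Finset.mem_univ a, mul_lt_mul_of_pos_left (hcon a) ha⟩
  linarith

end basic

/-- Product weights. -/
noncomputable def pw {ι α : Type*} [Fintype ι] (w : ι → α → ℝ) (a : ι → α) : ℝ := ∏ i, w i (a i)

section product
variable {ι α : Type*} [Fintype ι] [DecidableEq ι] [Fintype α] {w : ι → α → ℝ}

lemma pw_nonneg (hw : ∀ i a, 0 ≤ w i a) (a : ι → α) : 0 ≤ pw w a :=
  Finset.prod_nonneg fun i _ => hw i _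

lemma Ex_pw_prod (f : ι → α → ℝ) :
    Ex (pw w) (fun a => ∏ i, f i (a i)) = ∏ i, Ex (w i) (f i) := by
  simp only [Ex, pw, ← Finset.prod_mul_distrib]
  rw [Finset.prod_univ_sum]
  simp

lemma pw_sum (h1 : ∀ i, ∑ a, w i a = 1) : ∑ a, pw w a = 1 := by
  have := Ex_pw_prod (w := w) (fun _ _ => 1)
  simp only [Finset.prod_const_one, Ex, mul_one, h1] at this
  exact this

lemma Ex_pw_one (h1 : ∀ i, ∑ a, w i a = 1) (i : ι) (f : α → ℝ) :
    Ex (pw w) (fun a => f (a i)) = Ex (w i) f := by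
  have := Ex_pw_prod (w := w) (fun j x => if j = i then f x else 1)
  simp only [Finset.prod_ite_eq', Finset.mem_univ, if_true] at this
  rw [this, Finset.prod_eq_single i]
  · simp
  · intro j _ hj; simp [hj, Ex, h1]
  · simp

lemma Ex_pw_two (h1 : ∀ i, ∑ a, w i a = 1) {i j : ι} (hij : i ≠ j) (f g : α → ℝ) :
    Ex (pw w) (fun a => f (a i) * g (a j)) = Ex (w i) f * Ex (w j) g := by
  have := Ex_pw_prod (w := w) (fun k x => (if k = i then f x else 1) * (if k = j then g x else 1))
  simp only [Finset.prod_mul_distrib, Finset.prod_ite_eq', Finset.mem_univ, if_true] at this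
  rw [this]
  rw [← Finset.prod_subset (Finset.subset_univ {i, j})]
  · rw [Finset.prod_pair hij]
    simp [hij, hij.symm]
  · intro k _ hk
    simp only [Finset.mem_insert, Finset.mem_singleton, not_or] at hk
    simp [hk.1, hk.2, Ex, h1]

lemma Pr_pw_one (h1 : ∀ i, ∑ a, w i a = 1) (i : ι) (S : α → Prop) :
    Pr (pw w) (fun a => S (a i)) = Pr (w i) S :=
  Ex_pw_one h1 i (fun x => ind (S x))

lemma Pr_pw_two (h1 : ∀ i, ∑ a, w i a = 1) {i j : ι} (hij : i ≠ j) (S T : α → Prop) :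
    Pr (pw w) (fun a => S (a i) ∧ T (a j)) = Pr (w i) S * Pr (w j) T := by
  simp only [Pr_eq_Ex, ind_and]
  exact Ex_pw_two h1 hij (fun x => ind (S x)) (fun x => ind (T x))

lemma ind_forall (S : ι → Prop) : ind (∀ i, S i) = ∏ i, ind (S i) := by
  by_cases h : ∀ i, S i
  · rw [ind_true h]; symm; exact Finset.prod_eq_one fun i _ => ind_true (h i)
  · rw [ind_false h]
    push Not at h
    obtain ⟨i, hi⟩ := h
    exact (Finset.prod_eq_zero (Finset.mem_univ i) (ind_false hi)).symm

lemma Pr_pw_forall (S : ι → α → Prop) :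
    Pr (pw w) (fun a => ∀ i, S i (a i)) = ∏ i, Pr (w i) (S i) := by
  simp only [Pr_eq_Ex, ind_forall]
  exact Ex_pw_prod (fun i x => ind (S i x))

/-- Splitting off one coordinate. -/
lemma Pr_pw_split (w0 : α → ℝ) (i : ι) (S : α → ({j // j ≠ i} → α) → Prop) :
    Pr (pw (fun _ : ι => w0)) (fun a => S (a i) (fun j => a j)) =
      ∑ q : {j // j ≠ i} → α, pw (fun _ => w0) q * Pr w0 (fun x => S x q) := by
  simp only [Pr]
  rw [← (Equiv.funSplitAt i α).symm.sum_comp, Fintype.sum_prod_type, Finset.sum_comm]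
  refine Finset.sum_congr rfl fun q _ => ?_
  rw [Finset.mul_sum]
  refine Finset.sum_congr rfl fun x _ => ?_
  have h1 : pw (fun _ : ι => w0) ((Equiv.funSplitAt i α).symm (x, q)) =
      pw (fun _ => w0) q * w0 x := by
    unfold pw
    rw [← Finset.mul_prod_erase _ _ (Finset.mem_univ i), mul_comm]
    congr 1
    · rw [Finset.prod_subtype (Finset.univ.erase i) (p := fun j => j ≠ i) (by simp)
        (f := fun j => w0 ((Equiv.funSplitAt i α).symm (x, q) j))]
      refine Finset.prod_congr rfl fun j _ => ?_
      simp [Equiv.funSplitAt, Equiv.piSplitAt, j.2]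
    · simp [Equiv.funSplitAt, Equiv.piSplitAt]
  rw [h1]
  have h2 : (Equiv.funSplitAt i α).symm (x, q) i = x := by
    simp [Equiv.funSplitAt, Equiv.piSplitAt]
  have h3 : (fun j : {j // j ≠ i} => (Equiv.funSplitAt i α).symm (x, q) j) = q := by
    ext j; simp [Equiv.funSplitAt, Equiv.piSplitAt, j.2]
  rw [h2, h3]; ring

end product

end SB

set_option linter.all false
namespace SB
open Finset

/-- Bernoulli weight. -/
noncomputable def bw (p : ℝ) (b : Bool) : ℝ := if b then p else 1 - p

/-- Weight of a row with iid Bernoulli entries. -/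
noncomputable def rowW (p : ℝ) {n : ℕ} : (Fin n → Bool) → ℝ := pw (fun _ => bw p)

/-- Weight of a matrix (family of rows). -/
noncomputable def matW (p : ℝ) {ι : Type} [Fintype ι] {n : ℕ} : (ι → Fin n → Bool) → ℝ :=
  pw (fun _ => rowW p)

noncomputable def dot {n : ℕ} (X : Fin n → Bool) (u : Fin n → ℝ) : ℝ := ∑ j, if X j then u j else 0

def cnt {n : ℕ} (X : Fin n → Bool) : ℕ := (univ.filter fun j => X j = true).card

def Reg {n : ℕ} (d : ℝ) (X : Fin n → Bool) : Prop := d / 100 ≤ cnt X ∧ (cnt X : ℝ) ≤ 10 * d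

section
variable {p : ℝ} {n : ℕ}

lemma bw_nonneg (h0 : 0 ≤ p) (h1 : p ≤ 1) (b : Bool) : 0 ≤ bw p b := by
  cases b <;> simp [bw, h0, h1]
lemma bw_sum : ∑ b, bw p b = 1 := by simp [bw]
lemma rowW_nonneg (h0 : 0 ≤ p) (h1 : p ≤ 1) (X : Fin n → Bool) : 0 ≤ rowW p X :=
  pw_nonneg (fun _ => bw_nonneg h0 h1) X
lemma rowW_sum : ∑ X : Fin n → Bool, rowW p X = 1 := pw_sum fun _ => bw_sum
lemma matW_nonneg {ι : Type} [Fintype ι] [DecidableEq ι] (h0 : 0 ≤ p) (h1 : p ≤ 1) (Q : ι → Fin n → Bool) :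
    0 ≤ matW p Q := pw_nonneg (fun _ => rowW_nonneg h0 h1) Q
lemma matW_sum {ι : Type} [Fintype ι] [DecidableEq ι] : ∑ Q : ι → Fin n → Bool, matW p Q = 1 := by
  exact pw_sum fun _ => rowW_sum

lemma Ex_row_prod (f : Fin n → Bool → ℝ) :
    Ex (rowW p) (fun X : Fin n → Bool => ∏ j, f j (X j)) = ∏ j, (p * f j true + (1 - p) * f j false) := by
  unfold rowW
  rw [Ex_pw_prod]
  refine Finset.prod_congr rfl fun j _ => ?_
  simp [Ex, bw]

lemma pow_cnt (a : ℝ) (X : Fin n → Bool) : a ^ cnt X = ∏ j, (if X j then a else 1) := by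
  rw [Finset.prod_ite]; simp [cnt]

lemma Ex_pow_cnt_le (h0 : 0 ≤ p) (h1 : p ≤ 1) {a : ℝ} (ha : 0 ≤ a) :
    Ex (rowW p) (fun X : Fin n → Bool => a ^ cnt X) ≤ Real.exp (p * n * (a - 1)) := by
  simp only [pow_cnt]
  rw [Ex_row_prod (fun _ b => if b then a else 1)]
  simp only [if_true, Bool.false_eq_true, if_false, mul_one, prod_const, card_univ, Fintype.card_fin]
  have h : p * a + (1 - p) ≤ Real.exp (p * (a - 1)) := by
    have := Real.add_one_le_exp (p * (a - 1)); linarith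
  calc (p * a + (1 - p)) ^ n ≤ (Real.exp (p * (a - 1))) ^ n := by
        apply pow_le_pow_left₀ _ h
        have := mul_nonneg h0 ha; linarith
    _ = Real.exp (p * n * (a - 1)) := by
        rw [← Real.exp_nat_mul]; ring_nf

lemma irreg_le (h0 : 0 ≤ p) (h1 : p ≤ 1) :
    Pr (rowW p) (fun X : Fin n → Bool => ¬ Reg (p * n) X) ≤ 2 * Real.exp (-(0.9 * (p * n))) := by
  set d := p * n with hd
  have hd0 : 0 ≤ d := by positivity
  have hw := rowW_nonneg (n := n) h0 h1
  have A : Pr (rowW p) (fun X : Fin n → Bool => (cnt X : ℝ) ≤ d / 100) ≤ Real.exp (-(0.9 * d)) := by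
    have e1 : Pr (rowW p) (fun X : Fin n → Bool => (cnt X : ℝ) ≤ d / 100) ≤
        Ex (rowW p) (fun X : Fin n → Bool => Real.exp (3 * (d / 100)) * (Real.exp (-3)) ^ cnt X) := by
      refine Pr_le_Ex hw (fun _ => by positivity) fun X hX => ?_
      rw [← Real.exp_nat_mul, ← Real.exp_add]
      apply Real.one_le_exp; linarith
    rw [Ex_smul] at e1
    refine e1.trans ?_
    refine (mul_le_mul_of_nonneg_left (Ex_pow_cnt_le h0 h1 (Real.exp_pos _).le)
      (Real.exp_pos _).le).trans ?_
    rw [← hd, ← Real.exp_add]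
    apply Real.exp_le_exp.2
    have h3 : Real.exp (-3) ≤ 0.06 := by
      rw [Real.exp_neg]
      have : (2.7 : ℝ) ≤ Real.exp 1 := by have := Real.exp_one_gt_d9; linarith
      have h2 : (2.7 : ℝ) ^ 3 ≤ Real.exp 3 := by
        calc (2.7 : ℝ) ^ 3 ≤ (Real.exp 1) ^ 3 := by gcongr
          _ = Real.exp 3 := by rw [← Real.exp_nat_mul]; norm_num
      rw [inv_le_comm₀ (Real.exp_pos _) (by norm_num)]
      norm_num at h2 ⊢; linarith
    nlinarith
  have B : Pr (rowW p) (fun X : Fin n → Bool => 10 * d ≤ (cnt X : ℝ)) ≤ Real.exp (-(0.9 * d)) := by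
    have e1 : Pr (rowW p) (fun X : Fin n → Bool => 10 * d ≤ (cnt X : ℝ)) ≤
        Ex (rowW p) (fun X : Fin n → Bool => Real.exp (-(10 * d)) * (Real.exp 1) ^ cnt X) := by
      refine Pr_le_Ex hw (fun _ => by positivity) fun X hX => ?_
      rw [← Real.exp_nat_mul, ← Real.exp_add]
      apply Real.one_le_exp; linarith
    rw [Ex_smul] at e1
    refine e1.trans ?_
    refine (mul_le_mul_of_nonneg_left (Ex_pow_cnt_le h0 h1 (Real.exp_pos _).le)
      (Real.exp_pos _).le).trans ?_
    rw [← hd, ← Real.exp_add]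
    apply Real.exp_le_exp.2
    have := Real.exp_one_lt_d9
    nlinarith
  calc Pr (rowW p) (fun X : Fin n → Bool => ¬ Reg d X)
      ≤ Pr (rowW p) (fun X : Fin n → Bool => (cnt X : ℝ) ≤ d / 100 ∨ 10 * d ≤ (cnt X : ℝ)) := by
        refine Pr_mono hw fun X hX => ?_
        unfold Reg at hX
        by_contra hc
        push Not at hc
        exact hX ⟨hc.1.le, hc.2.le⟩
    _ ≤ _ := Pr_or_le hw _ _
    _ ≤ _ := by linarith

/-- at least two irregular rows. -/
def TwoIrr {ι : Type} (d : ℝ) {n : ℕ} (Q : ι → Fin n → Bool) : Prop :=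
  ∃ i j, i ≠ j ∧ ¬ Reg d (Q i) ∧ ¬ Reg d (Q j)

lemma twoIrr_le {ι : Type} [Fintype ι] [DecidableEq ι] (h0 : 0 ≤ p) (h1 : p ≤ 1) :
    Pr (matW p) (fun Q : ι → Fin n → Bool => TwoIrr (p * n) Q) ≤
      (Fintype.card ι : ℝ) ^ 2 * (4 * Real.exp (-(1.8 * (p * n)))) := by
  have hw := matW_nonneg (ι := ι) (n := n) h0 h1
  have h := Pr_exists_le_card hw ((univ : Finset (ι × ι)).filter fun x => x.1 ≠ x.2)
    (fun x (Q : ι → Fin n → Bool) => ¬ Reg (p * n) (Q x.1) ∧ ¬ Reg (p * n) (Q x.2))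
    (4 * Real.exp (-(1.8 * (p * n)))) (by
      intro x hx
      simp only [mem_filter, mem_univ, true_and] at hx
      unfold matW
      rw [Pr_pw_two (fun _ => rowW_sum) hx (fun X => ¬ Reg (p * n) X) (fun X => ¬ Reg (p * n) X)]
      have h2 := irreg_le (n := n) h0 h1
      have h3 := Pr_nonneg (rowW_nonneg (n := n) h0 h1) (fun X : Fin n → Bool => ¬ Reg (p * n) X)
      calc _ ≤ (2 * Real.exp (-(0.9 * (p * n)))) * (2 * Real.exp (-(0.9 * (p * n)))) := by
            gcongr
        _ = 4 * (Real.exp (-(0.9 * (p * n))) * Real.exp (-(0.9 * (p * n)))) := by ring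
        _ = _ := by rw [← Real.exp_add]; ring_nf)
  refine le_trans (Pr_mono hw ?_) (h.trans ?_)
  · rintro Q ⟨i, j, hij, hi, hj⟩
    exact ⟨(i, j), by simpa using hij, hi, hj⟩
  · apply mul_le_mul_of_nonneg_right _ (by positivity)
    have : ((univ : Finset (ι × ι)).filter fun x => x.1 ≠ x.2).card ≤ Fintype.card ι ^ 2 := by
      refine (card_filter_le _ _).trans ?_
      simp [sq]
    exact_mod_cast this

/-- The probability that a row vanishes. -/
lemma zero_row_prob : Pr (rowW p) (fun X : Fin n → Bool => ∀ j, X j = false) = (1 - p) ^ n := by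
  unfold rowW
  rw [Pr_pw_forall (fun _ b => b = false)]
  simp [Pr, bw, ind]

end
end SB

set_option linter.all false
namespace SB
open Finset

/-- The matrix whose `j`-th column is the `0/1` vector `B j`. -/
def mat {n : ℕ} (B : Fin n → Fin n → Bool) : Matrix (Fin n) (Fin n) ℝ :=
  fun i j => if B j i then 1 else 0

lemma matW_eq {n : ℕ} (p : ℝ) (B : Fin n → Fin n → Bool) :
    p ^ (Finset.univ.filter (fun ij : Fin n × Fin n => mat B ij.1 ij.2 = 1)).card *
          (1 - p) ^ (Finset.univ.filter (fun ij : Fin n × Fin n => mat B ij.1 ij.2 = 0)).card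
      = matW p B := by
  have e : matW p B = ∏ ij : Fin n × Fin n, (if B ij.2 ij.1 = true then p else 1 - p) := by
    rw [Fintype.prod_prod_type_right]
    simp only [matW, rowW, pw, bw]
  rw [e, Finset.prod_ite]
  simp [mat]

lemma transfer_le {Ω : Type} [MeasurableSpace Ω] {μ : Measure Ω} [IsProbabilityMeasure μ]
    {n : ℕ} {p : ℝ} (h0 : 0 ≤ p) (h1 : p ≤ 1) {M : Ω → Matrix (Fin n) (Fin n) ℝ}
    (hM : IsBernoulliMatrix μ M p) (S : Matrix (Fin n) (Fin n) ℝ → Prop) :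
    (μ {ω | S (M ω)}).toReal ≤ Pr (matW p) (fun B => S (mat B)) := by
  classical
  have hsub : {ω | S (M ω)} ⊆ ⋃ B ∈ (univ.filter fun B : Fin n → Fin n → Bool => S (mat B)),
      {ω | M ω = mat B} := by
    intro ω hω
    have : M ω = mat (fun j i => decide (M ω i j = 1)) := by
      ext i j
      simp only [mat]
      rcases hM.1 ω i j with h | h <;> simp [h]
    simp only [Set.mem_iUnion, mem_filter, mem_univ, true_and, Set.mem_setOf_eq, exists_prop]
    exact ⟨_, this ▸ hω, this⟩
  have h2 : μ {ω | S (M ω)} ≤ ENNReal.ofReal (Pr (matW p) (fun B => S (mat B))) := by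
    refine (measure_mono hsub).trans ((measure_biUnion_finset_le _ _).trans ?_)
    rw [Pr, ENNReal.ofReal_sum_of_nonneg
      (fun B _ => mul_nonneg (matW_nonneg h0 h1 B) (ind_nonneg _)), Finset.sum_filter]
    refine Finset.sum_le_sum fun B _ => ?_
    by_cases hB : S (mat B)
    · rw [if_pos hB, ind_true hB, mul_one, hM.2 _ (fun i j => by simp only [mat]; split_ifs <;> simp), matW_eq]
    · simp [hB]
  exact ENNReal.toReal_le_of_le_ofReal (Pr_nonneg (matW_nonneg h0 h1) _) h2

lemma transfer {Ω : Type} [MeasurableSpace Ω] {μ : Measure Ω} [IsProbabilityMeasure μ]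
    {n : ℕ} {p : ℝ} (h0 : 0 ≤ p) (h1 : p ≤ 1) {M : Ω → Matrix (Fin n) (Fin n) ℝ}
    (hM : IsBernoulliMatrix μ M p) (S : Matrix (Fin n) (Fin n) ℝ → Prop) :
    (μ {ω | S (M ω)}).toReal = Pr (matW p) (fun B => S (mat B)) := by
  refine le_antisymm (transfer_le h0 h1 hM S) ?_
  have h2 := transfer_le h0 h1 hM (fun A => ¬ S A)
  rw [Pr_not matW_sum] at h2
  have h3 : μ Set.univ ≤ μ {ω | S (M ω)} + μ {ω | ¬ S (M ω)} := by
    refine le_trans (measure_mono ?_) (measure_union_le _ _)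
    intro ω _
    by_cases h : S (M ω)
    · exact Or.inl h
    · exact Or.inr h
  rw [measure_univ] at h3
  have h4 := ENNReal.toReal_mono (by simp [measure_ne_top]) h3
  rw [ENNReal.toReal_add (measure_ne_top _ _) (measure_ne_top _ _)] at h4
  simp at h4
  linarith

lemma eNorm_nonneg {n : ℕ} (x : Fin n → ℝ) : 0 ≤ eNorm x := Real.sqrt_nonneg _
lemma eNorm_sq {n : ℕ} (x : Fin n → ℝ) : eNorm x ^ 2 = ∑ i, (x i) ^ 2 :=
  Real.sq_sqrt (Finset.sum_nonneg fun _ _ => sq_nonneg _)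
lemma abs_le_eNorm {n : ℕ} (x : Fin n → ℝ) (i : Fin n) : |x i| ≤ eNorm x := by
  apply Real.abs_le_sqrt
  exact Finset.single_le_sum (f := fun i => x i ^ 2) (fun _ _ => sq_nonneg _) (Finset.mem_univ i)
lemma cs_eNorm {n : ℕ} (x y : Fin n → ℝ) : |∑ i, x i * y i| ≤ eNorm x * eNorm y := by
  have h := Finset.sum_mul_sq_le_sq_mul_sq univ x y
  rw [← eNorm_sq, ← eNorm_sq, ← mul_pow] at h
  exact abs_le_of_sq_le_sq h (mul_nonneg (eNorm_nonneg _) (eNorm_nonneg _))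
lemma eNorm_smul {n : ℕ} (c : ℝ) (x : Fin n → ℝ) : eNorm (fun i => c * x i) = |c| * eNorm x := by
  simp only [eNorm, mul_pow, ← Finset.mul_sum]
  rw [Real.sqrt_mul (sq_nonneg _), Real.sqrt_sq_eq_abs]
lemma eNorm_pos {n : ℕ} {x : Fin n → ℝ} (h : x ≠ 0) : 0 < eNorm x := by
  obtain ⟨i, hi⟩ := Function.ne_iff.1 h
  exact lt_of_lt_of_le (abs_pos.2 hi) (abs_le_eNorm x i)

lemma det_lemma {n : ℕ} (hn : 1 ≤ n) {d s : ℝ} (hs : s ≤ 1 / (2 * n)) (B : Fin n → Fin n → Bool)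
    (x : Fin n → ℝ) (hx : eNorm x = 1) (hBx : eNorm ((mat B).mulVec x) ≤ s)
    (hcol : ∀ j, ∃ i, B j i = true) (hirr : ¬ TwoIrr d B) :
    ∃ i, Reg d (B i) ∧ ∀ u, (∀ j, j ≠ i → dot (B j) u = 0) →
      |dot (B i) u| ≤ 2 * n ^ 2 * s * eNorm u := by
  have hn' : (1 : ℝ) ≤ n := by exact_mod_cast hn
  have : Nonempty (Fin n) := ⟨⟨0, hn⟩⟩
  obtain ⟨a, ha⟩ := Finite.exists_max (fun i => |x i|)
  have hs0 : 0 ≤ s := (eNorm_nonneg _).trans hBx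
  have ha1 : 1 / (n : ℝ) ≤ |x a| := by
    have h1 : (1 : ℝ) ≤ n * |x a| ^ 2 := by
      have h2 := eNorm_sq x
      rw [hx] at h2
      have h3 : ∑ i, (x i) ^ 2 ≤ ∑ _i : Fin n, |x a| ^ 2 :=
        Finset.sum_le_sum fun i _ => by
          rw [← sq_abs]; exact pow_le_pow_left₀ (abs_nonneg _) (ha i) 2
      simp at h3 ⊢; linarith
    rw [div_le_iff₀ (by linarith)]
    by_contra hc
    push Not at hc
    have h0 := abs_nonneg (x a)
    have : |x a| < 1 := by nlinarith
    nlinarith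
  -- second coordinate
  have key : ∃ b, b ≠ a ∧ 1 / (2 * (n : ℝ) ^ 2) ≤ |x b| := by
    by_contra hc
    push Not at hc
    obtain ⟨k, hk⟩ := hcol a
    have h1 : |((mat B).mulVec x) k| ≤ s := (abs_le_eNorm _ k).trans hBx
    have h2 : ((mat B).mulVec x) k = x a + ∑ b ∈ univ.erase a, mat B k b * x b := by
      simp only [Matrix.mulVec, dotProduct]
      rw [← Finset.add_sum_erase _ _ (mem_univ a)]
      simp [mat, hk]
    have h3 : |∑ b ∈ univ.erase a, mat B k b * x b| ≤ (n - 1) * (1 / (2 * (n : ℝ) ^ 2)) := by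
      refine (Finset.abs_sum_le_sum_abs _ _).trans ?_
      have := Finset.sum_le_card_nsmul (univ.erase a) (fun b => |mat B k b * x b|)
        (1 / (2 * (n : ℝ) ^ 2)) (by
          intro b hb
          rw [abs_mul]
          have h5 : |mat B k b| ≤ 1 := by simp only [mat]; split_ifs <;> simp
          have h6 := hc b (Finset.ne_of_mem_erase hb)
          calc _ ≤ 1 * |x b| := by gcongr
            _ ≤ _ := by linarith)
      refine this.trans (le_of_eq ?_)
      rw [nsmul_eq_mul, card_erase_of_mem (mem_univ a)]
      simp only [card_univ, Fintype.card_fin]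
      rw [Nat.cast_sub hn]; simp
    have h4 : |x a| ≤ s + (n - 1) * (1 / (2 * (n : ℝ) ^ 2)) := by
      have : x a = ((mat B).mulVec x) k - ∑ b ∈ univ.erase a, mat B k b * x b := by rw [h2]; ring
      rw [this]
      exact (abs_sub _ _).trans (add_le_add h1 h3)
    have h5 : (n - 1) * (1 / (2 * (n : ℝ) ^ 2)) < 1 / (2 * n) := by
      rw [mul_one_div, div_lt_div_iff₀ (by positivity) (by positivity)]
      nlinarith
    have h6 : 1 / (n : ℝ) = 1 / (2 * n) + 1 / (2 * n) := by field_simp; norm_num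
    linarith
  obtain ⟨b, hba, hb⟩ := key
  have hgood : ∃ i, Reg d (B i) ∧ 1 / (2 * (n : ℝ) ^ 2) ≤ |x i| := by
    by_cases hra : Reg d (B a)
    · refine ⟨a, hra, le_trans ?_ ha1⟩
      rw [div_le_div_iff₀ (by positivity) (by positivity)]; nlinarith
    · refine ⟨b, ?_, hb⟩
      by_contra hrb
      exact hirr ⟨a, b, hba.symm, hra, hrb⟩
  obtain ⟨i, hi, hxi⟩ := hgood
  refine ⟨i, hi, fun u hu => ?_⟩
  have h1 : ∑ k, u k * ((mat B).mulVec x) k = x i * dot (B i) u := by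
    have : ∀ k, u k * ((mat B).mulVec x) k = ∑ j, x j * (if B j k then u k else 0) := by
      intro k
      simp only [Matrix.mulVec, dotProduct, Finset.mul_sum, mat]
      refine Finset.sum_congr rfl fun j _ => ?_
      split_ifs <;> ring
    simp only [this]
    rw [Finset.sum_comm]
    simp only [← Finset.mul_sum]
    rw [Finset.sum_eq_single i]
    · rfl
    · intro j _ hj
      have := hu j hj
      unfold dot at this
      rw [this, mul_zero]
    · simp
  have h2 := cs_eNorm u ((mat B).mulVec x)
  rw [h1, abs_mul] at h2
  have h3 : 1 / (2 * (n : ℝ) ^ 2) * |dot (B i) u| ≤ eNorm u * s :=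
    calc _ ≤ |x i| * |dot (B i) u| := by gcongr
      _ ≤ _ := h2
      _ ≤ _ := by gcongr; exact eNorm_nonneg u
  rw [one_div_mul_eq_div, div_le_iff₀ (by positivity)] at h3
  linarith

def KeyConc (C K : ℝ) (n : ℕ) (p : ℝ) : Prop :=
  ∀ (ι : Type) [Fintype ι] [DecidableEq ι], Fintype.card ι + 1 = n →
    ∃ Good : (ι → Fin n → Bool) → Prop,
      Pr (matW p) (fun Q : ι → Fin n → Bool => (∀ j, ∃ i, Q i j = true) ∧ ¬ Good Q)
        ≤ K * n ^ 5 * Real.exp (-(1.3 * (p * n))) ∧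
      ∀ Q : ι → Fin n → Bool, Good Q → (∀ j, ∃ i, Q i j = true) →
        ∃ u : Fin n → ℝ, u ≠ 0 ∧ (∀ i, dot (Q i) u = 0) ∧ ∀ s : ℝ, 0 < s →
          Pr (rowW p) (fun X : Fin n → Bool => Reg (p * n) X ∧ |dot X u| ≤ s * eNorm u) ≤
            Real.exp (2 * (Real.log (2 * n)) ^ 2) * s + K * Real.exp (-(1.3 * (p * n)))

lemma upper_prob {C K : ℝ} {n : ℕ} {p s : ℝ} (hn : 1 ≤ n) (hK : 0 ≤ K) (h0 : 0 ≤ p) (h1 : p ≤ 1)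
    (hkey : KeyConc C K n p) (hs0 : 0 < s) (hs : 2 * n ^ 2 * s < 1) :
    Pr (matW p) (fun B : Fin n → Fin n → Bool =>
        ∃ x : Fin n → ℝ, eNorm x = 1 ∧ eNorm ((mat B).mulVec x) ≤ s) ≤
      2 * n * (1 - p) ^ n + n ^ 2 * (4 * Real.exp (-(1.8 * (p * n)))) +
      n * (K * n ^ 5 * Real.exp (-(1.3 * (p * n))) +
        (Real.exp (2 * (Real.log (2 * n)) ^ 2) * (2 * n ^ 2 * s) + K * Real.exp (-(1.3 * (p * n))))) := by
  have hn' : (1 : ℝ) ≤ n := by exact_mod_cast hn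
  have hw := matW_nonneg (ι := Fin n) (n := n) h0 h1
  set s' := 2 * n ^ 2 * s with hs'
  have hs'0 : 0 < s' := by positivity
  let Z1 : (Fin n → Fin n → Bool) → Prop := fun B => ∃ j ∈ (univ : Finset (Fin n)), ∀ i, B j i = false
  let Z2 : (Fin n → Fin n → Bool) → Prop := fun B => ∃ i ∈ (univ : Finset (Fin n)), ∀ j, B j i = false
  let E : Fin n → (Fin n → Fin n → Bool) → Prop := fun i B =>
    Reg (p * n) (B i) ∧ (∀ k, ∃ j : {j // j ≠ i}, B j k = true) ∧
      ∀ u, (∀ j : {j // j ≠ i}, dot (B j) u = 0) → |dot (B i) u| ≤ s' * eNorm u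
  have hincl : ∀ B : Fin n → Fin n → Bool,
      (∃ x : Fin n → ℝ, eNorm x = 1 ∧ eNorm ((mat B).mulVec x) ≤ s) →
      ((Z1 B ∨ Z2 B) ∨ TwoIrr (p * n) B) ∨ ∃ i ∈ (univ : Finset (Fin n)), E i B := by
    rintro B ⟨x, hx, hBx⟩
    by_contra hc
    push Not at hc
    obtain ⟨⟨⟨hz1, hz2⟩, h2⟩, hE⟩ := hc
    have hz1' : ∀ j, ∃ i, B j i = true := by
      intro j
      by_contra hh
      push Not at hh
      exact hz1 ⟨j, mem_univ j, fun i => by simpa using hh i⟩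
    have hz2' : ∀ i, ∃ j, B j i = true := by
      intro j
      by_contra hh
      push Not at hh
      exact hz2 ⟨j, mem_univ j, fun i => by simpa using hh i⟩
    have hsn : s ≤ 1 / (2 * n) := by
      rw [le_div_iff₀ (by positivity)]
      have : 2 * (n:ℝ) ^ 2 * s ≥ 2 * n * s := by
        have : (n : ℝ) ≤ n ^ 2 := by nlinarith
        gcongr
      linarith
    obtain ⟨i, hi, hu⟩ := det_lemma hn hsn B x hx hBx hz1' h2
    refine hE i (mem_univ i) ⟨hi, ?_, fun u hu' => hu u fun j hj => hu' ⟨j, hj⟩⟩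
    intro k
    by_contra hh
    push Not at hh
    have hd : ∀ j, dot (B j) (Pi.single k 1) = if B j k then 1 else 0 := by
      intro j
      unfold dot
      rw [Finset.sum_eq_single k]
      · simp
      · intro l _ hl; simp [Pi.single_eq_of_ne hl]
      · simp
    have h3 := hu (Pi.single k 1) (fun j hj => by
      rw [hd]; have := hh ⟨j, hj⟩; simp at this; simp [this])
    obtain ⟨j, hj⟩ := hz2' k
    have hji : j = i := by
      by_contra hne
      exact hh ⟨j, hne⟩ hj
    subst hji
    rw [hd] at h3
    have h4 : eNorm (Pi.single k (1 : ℝ)) = 1 := by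
      unfold eNorm
      rw [Finset.sum_eq_single k]
      · simp
      · intro l _ hl; simp [Pi.single_eq_of_ne hl]
      · simp
    rw [h4] at h3
    simp [hj] at h3
    linarith
  have hZ1 : Pr (matW p) Z1 ≤ n * (1 - p) ^ n := by
    have := Pr_exists_le_card hw (univ : Finset (Fin n)) (fun j (B : Fin n → Fin n → Bool) => ∀ i, B j i = false)
      ((1 - p) ^ n) (by
        intro j _
        unfold matW
        rw [Pr_pw_one (fun _ => rowW_sum) j (fun X => ∀ i, X i = false), zero_row_prob])
    simpa [Z1, Z2] using this
  have hZ2 : Pr (matW p) Z2 ≤ n * (1 - p) ^ n := by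
    have := Pr_exists_le_card hw (univ : Finset (Fin n)) (fun i (B : Fin n → Fin n → Bool) => ∀ j, B j i = false)
      ((1 - p) ^ n) (by
        intro i _
        unfold matW
        rw [Pr_pw_forall (fun (_ : Fin n) (X : Fin n → Bool) => X i = false)]
        unfold rowW
        rw [Pr_pw_one (fun _ => bw_sum) i (fun b => b = false)]
        simp [Pr, bw, ind])
    simpa [Z1, Z2] using this
  have hT := twoIrr_le (ι := Fin n) (n := n) h0 h1
  have hE : ∀ i, Pr (matW p) (E i) ≤ K * n ^ 5 * Real.exp (-(1.3 * (p * n))) +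
        (Real.exp (2 * (Real.log (2 * n)) ^ 2) * s' + K * Real.exp (-(1.3 * (p * n)))) := by
    intro i
    have hcard : Fintype.card {j : Fin n // j ≠ i} + 1 = n := by
      simp; omega
    obtain ⟨Good, hG1, hG2⟩ := hkey {j : Fin n // j ≠ i} hcard
    have := Pr_pw_split (rowW p) i (fun (x : Fin n → Bool) (q : {j // j ≠ i} → Fin n → Bool) =>
      Reg (p * n) x ∧ (∀ k, ∃ j : {j // j ≠ i}, q j k = true) ∧
      ∀ u, (∀ j : {j // j ≠ i}, dot (q j) u = 0) → |dot x u| ≤ s' * eNorm u)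
    unfold matW
    refine this.trans_le ?_
    set b := Real.exp (2 * (Real.log (2 * n)) ^ 2) * s' + K * Real.exp (-(1.3 * (p * n))) with hb
    have hb0 : 0 ≤ b := by positivity
    have hq0 := matW_nonneg (ι := {j : Fin n // j ≠ i}) (n := n) h0 h1
    calc _ ≤ ∑ q : {j // j ≠ i} → Fin n → Bool, (matW p q * ind ((∀ k, ∃ j, q j k = true) ∧ ¬ Good q)
            + matW p q * b) := by
          refine Finset.sum_le_sum fun q _ => ?_
          rw [← mul_add]
          refine mul_le_mul_of_nonneg_left ?_ (hq0 q)
          by_cases hz : ∀ k, ∃ j, q j k = true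
          · by_cases hg : Good q
            · obtain ⟨u, hu0, hu1, hu2⟩ := hG2 q hg hz
              refine le_trans ?_ (le_add_of_nonneg_left (ind_nonneg _))
              refine le_trans (Pr_mono (rowW_nonneg h0 h1) ?_) (hu2 s' hs'0)
              rintro X ⟨hX, -, hX2⟩
              exact ⟨hX, hX2 u hu1⟩
            · rw [ind_true ⟨hz, hg⟩]
              have := Pr_le_one (rowW_nonneg (n := n) h0 h1) rowW_sum (fun x : Fin n → Bool =>
                Reg (p * n) x ∧ (∀ k, ∃ j : {j // j ≠ i}, q j k = true) ∧
                ∀ u, (∀ j : {j // j ≠ i}, dot (q j) u = 0) → |dot x u| ≤ s' * eNorm u)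
              linarith
          · have : Pr (rowW p) (fun x : Fin n → Bool =>
                Reg (p * n) x ∧ (∀ k, ∃ j : {j // j ≠ i}, q j k = true) ∧
                ∀ u, (∀ j : {j // j ≠ i}, dot (q j) u = 0) → |dot x u| ≤ s' * eNorm u) = 0 := by
              refine Finset.sum_eq_zero fun x _ => ?_
              rw [ind_false (fun hh => hz hh.2.1), mul_zero]
            rw [this]
            exact add_nonneg (ind_nonneg _) hb0
      _ = Pr (matW p) (fun q : {j // j ≠ i} → Fin n → Bool => (∀ k, ∃ j, q j k = true) ∧ ¬ Good q) + b := by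
          rw [Finset.sum_add_distrib, ← Finset.sum_mul, matW_sum, one_mul]; rfl
      _ ≤ _ := by linarith
  have hEs := Pr_exists_le_card hw (univ : Finset (Fin n)) E _ (fun i _ => hE i)
  calc _ ≤ Pr (matW p) (fun B => ((Z1 B ∨ Z2 B) ∨ TwoIrr (p * n) B) ∨
        ∃ i ∈ (univ : Finset (Fin n)), E i B) := Pr_mono hw hincl
    _ ≤ ((Pr (matW p) Z1 + Pr (matW p) Z2) + Pr (matW p) (fun B => TwoIrr (p * n) B)) +
        Pr (matW p) (fun B => ∃ i ∈ (univ : Finset (Fin n)), E i B) := by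
      refine (Pr_or_le hw _ _).trans (add_le_add ?_ le_rfl)
      refine (Pr_or_le hw _ _).trans (add_le_add ?_ le_rfl)
      exact Pr_or_le hw _ _
    _ ≤ _ := by
      simp only [card_univ, Fintype.card_fin] at hEs hT
      linarith

end SB

set_option linter.all false
namespace SB
open Finset

lemma bonf {α κ : Type*} [Fintype α] [Fintype κ] [DecidableEq κ] {w : α → ℝ} (hw : ∀ a, 0 ≤ w a)
    (A : κ → α → Prop) (c : ℝ) (hc : ∀ i j, i ≠ j → Pr w (fun a => A i a ∧ A j a) ≤ c) :
    ∑ i, Pr w (A i) - (Fintype.card κ : ℝ) ^ 2 * c ≤ Pr w (fun a => ∃ i, A i a) + 0 * c ∨ c < 0 := by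
  by_cases hc0 : c < 0
  · exact Or.inr hc0
  left
  push Not at hc0
  have h1 : ∑ i, Pr w (A i) - ∑ x ∈ (univ : Finset (κ × κ)).filter (fun x => x.1 ≠ x.2),
      Pr w (fun a => A x.1 a ∧ A x.2 a) ≤ Pr w (fun a => ∃ i, A i a) := by
    have e1 : ∑ i, Pr w (A i) = Ex w (fun a => ∑ i, ind (A i a)) := (Ex_sum univ _).symm
    have e2 : ∑ x ∈ (univ : Finset (κ × κ)).filter (fun x => x.1 ≠ x.2),
      Pr w (fun a => A x.1 a ∧ A x.2 a) =
      Ex w (fun a => ∑ x ∈ (univ : Finset (κ × κ)).filter (fun x => x.1 ≠ x.2), ind (A x.1 a ∧ A x.2 a)) :=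
      (Ex_sum _ _).symm
    rw [e1, e2, sub_le_iff_le_add, Pr_eq_Ex, ← Ex_add]
    refine Ex_mono hw fun a => ?_
    by_cases h : ∃ i, A i a
    · rw [ind_true h]
      obtain ⟨i, hi⟩ := h
      rw [← Finset.add_sum_erase _ _ (mem_univ i), ind_true hi]
      gcongr
      have : ∑ j ∈ univ.erase i, ind (A j a) = ∑ x ∈ (univ.erase i).image (fun j => (i, j)), ind (A x.1 a ∧ A x.2 a) := by
        rw [Finset.sum_image (by intro x _ y _ h; simpa using h)]
        refine Finset.sum_congr rfl fun j _ => ?_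
        rw [ind_and, ind_true hi, one_mul]
      rw [this]
      refine Finset.sum_le_sum_of_subset_of_nonneg ?_ fun _ _ _ => ind_nonneg _
      intro x hx
      simp only [mem_image, mem_erase, mem_univ, and_true] at hx
      obtain ⟨j, hj, rfl⟩ := hx
      simpa using hj.symm
    · rw [ind_false h]
      push Not at h
      simp only [ind_false (h _), Finset.sum_const_zero, zero_add]
      exact Finset.sum_nonneg fun _ _ => ind_nonneg _
  have h2 : ∑ x ∈ (univ : Finset (κ × κ)).filter (fun x => x.1 ≠ x.2),
      Pr w (fun a => A x.1 a ∧ A x.2 a) ≤ (Fintype.card κ : ℝ) ^ 2 * c := by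
    refine (Finset.sum_le_card_nsmul _ _ c (fun x hx => hc _ _ (by simpa using hx))).trans ?_
    rw [nsmul_eq_mul]
    gcongr
    have : ((univ : Finset (κ × κ)).filter (fun x => x.1 ≠ x.2)).card ≤ Fintype.card κ ^ 2 := by
      refine (card_filter_le _ _).trans ?_
      simp [sq]
    exact_mod_cast this
  linarith

lemma Pr_entry {n : ℕ} {p : ℝ} (k : Fin n) : Pr (rowW p) (fun X : Fin n → Bool => X k = false) = 1 - p := by
  unfold rowW
  rw [Pr_pw_one (fun _ => bw_sum) k (fun b => b = false)]
  simp [Pr, bw, ind]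

lemma Pr_entry2 {n : ℕ} {p : ℝ} {k l : Fin n} (h : k ≠ l) :
    Pr (rowW p) (fun X : Fin n → Bool => X k = false ∧ X l = false) = (1 - p) ^ 2 := by
  unfold rowW
  rw [Pr_pw_two (fun _ => bw_sum) h (fun b => b = false) (fun b => b = false)]
  simp [Pr, bw, ind, sq]

lemma lower_prob {n : ℕ} {p : ℝ} (hn : 1 ≤ n) (h0 : 0 ≤ p) (h1 : p ≤ 1) :
    2 * n * (1 - p) ^ n - 4 * n ^ 2 * (1 - p) ^ (2 * n - 1) ≤
      Pr (matW p) (fun B : Fin n → Fin n → Bool => (mat B).det = 0) := by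
  have hw := matW_nonneg (ι := Fin n) (n := n) h0 h1
  let A : Fin n ⊕ Fin n → (Fin n → Fin n → Bool) → Prop := fun x B =>
    Sum.elim (fun j => ∀ i, B j i = false) (fun i => ∀ j, B j i = false) x
  have hq0 : 0 ≤ 1 - p := by linarith
  have hq1 : 1 - p ≤ 1 := by linarith
  have hcol : ∀ j, Pr (matW p) (A (Sum.inl j)) = (1 - p) ^ n := by
    intro j
    have := Pr_pw_one (w := fun _ : Fin n => rowW p) (fun _ => rowW_sum) j (fun X : Fin n → Bool => ∀ i, X i = false)
    rw [zero_row_prob] at this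
    exact this
  have hrow : ∀ j, Pr (matW p) (A (Sum.inr j)) = (1 - p) ^ n := by
    intro i
    have := Pr_pw_forall (w := fun _ : Fin n => rowW p) (fun (_ : Fin n) (X : Fin n → Bool) => X i = false)
    simp only [Pr_entry, prod_const, card_univ, Fintype.card_fin] at this
    exact this
  have hle : (1 - p) ^ (2 * n) ≤ (1 - p) ^ (2 * n - 1) := pow_le_pow_of_le_one hq0 hq1 (by omega)
  have hcr : ∀ j i, Pr (matW p) (fun B => A (Sum.inl j) B ∧ A (Sum.inr i) B) ≤ (1 - p) ^ (2 * n - 1) := by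
    intro j i
    have := Pr_pw_forall (w := fun _ : Fin n => rowW p)
      (fun (l : Fin n) (X : Fin n → Bool) => (l = j → ∀ k, X k = false) ∧ X i = false)
    have h2 : ∀ l, Pr (rowW p) (fun X : Fin n → Bool => (l = j → ∀ k, X k = false) ∧ X i = false) =
        if l = j then (1 - p) ^ n else (1 - p) := by
      intro l
      split_ifs with h
      · rw [← zero_row_prob]
        congr 1; ext X
        exact ⟨fun hh => hh.1 h, fun hh => ⟨fun _ => hh, hh i⟩⟩
      · rw [← Pr_entry i]
        congr 1; ext X
        exact ⟨fun hh => hh.2, fun hh => ⟨fun h' => absurd h' h, hh⟩⟩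
    simp only [h2] at this
    rw [← Finset.mul_prod_erase _ _ (mem_univ j)] at this
    rw [Finset.prod_congr rfl (fun l hl => if_neg (Finset.ne_of_mem_erase hl))] at this
    simp only [if_true, prod_const, card_erase_of_mem (mem_univ j), card_univ, Fintype.card_fin] at this
    rw [← pow_add, show n + (n - 1) = 2 * n - 1 by omega] at this
    rw [← this]
    refine Pr_mono hw ?_
    rintro B ⟨ha, hb⟩ l
    exact ⟨fun h k => h ▸ ha k, hb l⟩
  have hc : ∀ x y, x ≠ y → Pr (matW p) (fun B => A x B ∧ A y B) ≤ (1 - p) ^ (2 * n - 1) := by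
    rintro (j | i) (j' | i') hxy
    · have hjj : j ≠ j' := fun h => hxy (by rw [h])
      have := Pr_pw_two (w := fun _ : Fin n => rowW p) (fun _ => rowW_sum) hjj
        (fun X : Fin n → Bool => ∀ i, X i = false) (fun X : Fin n → Bool => ∀ i, X i = false)
      rw [zero_row_prob, ← pow_add, ← two_mul] at this
      exact this.le.trans hle
    · exact hcr j i'
    · refine le_trans (Pr_mono hw ?_) (hcr j' i)
      rintro B ⟨h, h'⟩; exact ⟨h', h⟩
    · have hii : i ≠ i' := fun h => hxy (by rw [h])
      have := Pr_pw_forall (w := fun _ : Fin n => rowW p)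
        (fun (_ : Fin n) (X : Fin n → Bool) => X i = false ∧ X i' = false)
      simp only [Pr_entry2 hii, prod_const, card_univ, Fintype.card_fin] at this
      rw [← pow_mul] at this
      refine le_trans ?_ hle
      rw [← this]
      refine Pr_mono hw ?_
      rintro B ⟨h, h'⟩ l
      exact ⟨h l, h' l⟩
  rcases bonf hw A _ hc with h | h
  · simp only [Fintype.sum_sum_type, hcol, hrow, sum_const, card_univ, Fintype.card_sum,
      Fintype.card_fin, nsmul_eq_mul, Nat.cast_add] at h
    have h3 : Pr (matW p) (fun B => ∃ i, A i B) ≤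
        Pr (matW p) (fun B : Fin n → Fin n → Bool => (mat B).det = 0) := by
      refine Pr_mono hw ?_
      rintro B ⟨(j | i), hB⟩
      · exact Matrix.det_eq_zero_of_column_eq_zero j fun i => by
          have := hB i; simp [mat, this]
      · exact Matrix.det_eq_zero_of_row_eq_zero i fun j => by
          have := hB j; simp [mat, this]
    nlinarith
  · exact absurd h (not_lt.2 (pow_nonneg hq0 _))

lemma one_sub_pow_ge {n : ℕ} {p : ℝ} (h0 : 0 ≤ p) (h1 : p ≤ 1 / 1000) :
    Real.exp (-(1.1 * (p * n))) ≤ (1 - p) ^ n := by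
  have h : Real.exp (-(1.1 * p)) ≤ 1 - p := by
    rw [← Real.le_log_iff_exp_le (by linarith)]
    refine le_trans ?_ (Real.one_sub_inv_le_log_of_pos (by linarith))
    have : (1 - p)⁻¹ ≤ 1 + 1.1 * p := by
      rw [inv_le_comm₀ (by linarith) (by linarith), inv_le_iff_one_le_mul₀ (by linarith)]
      nlinarith
    linarith
  calc Real.exp (-(1.1 * (p * n))) = Real.exp (-(1.1 * p)) ^ n := by
        rw [← Real.exp_nat_mul]; ring_nf
    _ ≤ _ := by gcongr

set_option maxHeartbeats 1000000 in
theorem final_of_key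
    (hkey : ∃ C K : ℝ, 1 ≤ C ∧ 0 ≤ K ∧ ∃ n1 : ℕ, ∀ n : ℕ, n1 ≤ n → ∀ p : ℝ,
      C * Real.log n ≤ p * n → p ≤ C⁻¹ → KeyConc C K n p) :
    ∃ C : ℝ, 1 ≤ C ∧
      ∀ ε : ℝ, 0 < ε → ∃ n₀ : ℕ, ∀ n : ℕ, n₀ ≤ n →
        ∀ p : ℝ, C * Real.log n ≤ p * n → p ≤ C⁻¹ →
          ∀ (Ω : Type) [MeasurableSpace Ω] (μ : Measure Ω), IsProbabilityMeasure μ →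
            ∀ M : Ω → Matrix (Fin n) (Fin n) ℝ, IsBernoulliMatrix μ M p →
              |(μ {ω | (M ω).det = 0}).toReal - 2 * n * (1 - p) ^ n| ≤ ε * (n * (1 - p) ^ n) ∧
              ∀ t : ℝ, 0 < t →
                (μ {ω | sMin (M ω) ≤ t * Real.exp (-3 * (Real.log (2 * n)) ^ 2)}).toReal
                  ≤ t + (2 + ε) * (n * (1 - p) ^ n) := by
  obtain ⟨C, K, hC, hK, n1, hkey⟩ := hkey
  refine ⟨max C 1000, le_max_of_le_left hC, fun ε hε => ?_⟩
  obtain ⟨n2, hn2⟩ := exists_nat_ge ((8 + 2 * K) / ε)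
  refine ⟨max (max n1 n2) 20, fun n hn p hp1 hp2 Ω _ μ hμ M hM => ?_⟩
  have hnn1 : n1 ≤ n := le_trans (le_trans (le_max_left _ _) (le_max_left _ _)) hn
  have hnn2 : n2 ≤ n := le_trans (le_trans (le_max_right _ _) (le_max_left _ _)) hn
  have hn20 : 20 ≤ n := le_trans (le_max_right _ _) hn
  have hn20' : (20 : ℝ) ≤ n := by exact_mod_cast hn20
  have hn1' : 1 ≤ n := by omega
  have hlog0 : 0 ≤ Real.log n := Real.log_nonneg (by linarith)
  have hC1000 : (1000 : ℝ) ≤ max C 1000 := le_max_right _ _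
  have hd : 1000 * Real.log n ≤ p * n := le_trans (by gcongr) hp1
  have h0 : 0 ≤ p := by
    by_contra hc
    push Not at hc
    nlinarith
  have hp3 : p ≤ 1 / 1000 := hp2.trans (by rw [one_div]; gcongr)
  have h1 : p ≤ 1 := by linarith
  have hkc : KeyConc C K n p := hkey n hnn1 p (le_trans (by gcongr; exact le_max_left _ _) hp1)
    (hp2.trans (by gcongr; exact le_max_left _ _))
  have hw := matW_nonneg (ι := Fin n) (n := n) h0 h1
  set W := (n : ℝ) * (1 - p) ^ n with hW
  set L := Real.log (2 * n) with hL
  have hW0 : 0 ≤ W := by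
    have : 0 ≤ 1 - p := by linarith
    positivity
  have hpow : Real.exp (-(1.1 * (p * n))) ≤ (1 - p) ^ n := one_sub_pow_ge h0 hp3
  have hεn : 8 + 2 * K ≤ ε * n := by
    have : (n2 : ℝ) ≤ n := by exact_mod_cast hnn2
    rw [div_le_iff₀ hε] at hn2
    nlinarith
  have hexp : ∀ c : ℝ, 0 ≤ c → Real.exp (-(c * (p * n))) ≤ Real.exp (-(1000 * c) * Real.log n) := by
    intro c hc
    apply Real.exp_le_exp.2
    nlinarith
  have hsmall : (n : ℝ) ^ 6 * Real.exp (-(0.2 * (p * n))) ≤ 1 := by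
    calc (n : ℝ) ^ 6 * Real.exp (-(0.2 * (p * n))) ≤ (n : ℝ) ^ 6 * Real.exp (-6 * Real.log n) := by
          gcongr
          nlinarith
      _ = 1 := by
          rw [show -6 * Real.log n = -((6 : ℕ) * Real.log n) by push_cast; ring, Real.exp_neg,
            Real.exp_nat_mul, Real.exp_log (by linarith)]
          field_simp
  have herr : n ^ 2 * (4 * Real.exp (-(1.8 * (p * n)))) +
      n * (K * n ^ 5 * Real.exp (-(1.3 * (p * n))) + K * Real.exp (-(1.3 * (p * n)))) ≤ ε * W := by
    have e1 : Real.exp (-(1.8 * (p * n))) ≤ Real.exp (-(1.3 * (p * n))) := by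
      apply Real.exp_le_exp.2; have : 0 ≤ p * n := by positivity
      linarith
    have e2 : Real.exp (-(1.3 * (p * n))) = Real.exp (-(0.2 * (p * n))) * Real.exp (-(1.1 * (p * n))) := by
      rw [← Real.exp_add]; ring_nf
    calc _ ≤ n ^ 6 * (4 * Real.exp (-(1.3 * (p * n)))) +
        n ^ 6 * (K * Real.exp (-(1.3 * (p * n)))) + n ^ 6 * (K * Real.exp (-(1.3 * (p * n)))) := by
          have f1 : (n : ℝ) ^ 2 ≤ n ^ 6 := pow_le_pow_right₀ (by linarith) (by norm_num)
          have f2 : (n : ℝ) ≤ n ^ 6 := le_self_pow₀ (by linarith) (by norm_num)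
          have f3 : 0 ≤ K * Real.exp (-(1.3 * (p * n))) := by positivity
          have f4 : (n:ℝ)^2 * (4 * Real.exp (-(1.8 * (p * n)))) ≤ n ^ 6 * (4 * Real.exp (-(1.3 * (p * n)))) := by gcongr
          nlinarith
      _ = (4 + 2 * K) * ((n : ℝ) ^ 6 * Real.exp (-(0.2 * (p * n)))) * Real.exp (-(1.1 * (p * n))) := by rw [e2]; ring
      _ ≤ (ε * n) * 1 * (1 - p) ^ n := by
          gcongr; linarith
      _ = ε * W := by rw [hW]; ring
  have hL3 : 3 ≤ L := by
    rw [hL, Real.le_log_iff_exp_le (by positivity)]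
    have : Real.exp 3 = Real.exp 1 ^ 3 := by rw [← Real.exp_nat_mul]; norm_num
    rw [this]
    have h3 := Real.exp_one_lt_d9
    calc Real.exp 1 ^ 3 ≤ (2.8 : ℝ) ^ 3 := by gcongr; linarith
      _ ≤ 2 * (n : ℝ) := by norm_num; linarith
  have hL2 : 8 * (n : ℝ) ^ 3 * Real.exp (-(L ^ 2)) ≤ 1 := by
    calc 8 * (n : ℝ) ^ 3 * Real.exp (-(L ^ 2)) ≤ (2 * n) ^ 3 * Real.exp (-((3 : ℕ) * L)) := by
          rw [show (8 : ℝ) * n ^ 3 = (2 * n) ^ 3 by ring]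
          gcongr
          push_cast
          nlinarith
      _ = 1 := by
          rw [Real.exp_neg, Real.exp_nat_mul, hL, Real.exp_log (by positivity)]
          field_simp
  have hmain : ∀ t : ℝ, 0 < t → t < 1 → Pr (matW p) (fun B : Fin n → Fin n → Bool =>
      ∃ x : Fin n → ℝ, eNorm x = 1 ∧ eNorm ((mat B).mulVec x) ≤ 2 * (t * Real.exp (-3 * L ^ 2)))
      ≤ t + (2 + ε) * W := by
    intro t ht ht1
    have hexp3 : Real.exp (-3 * L ^ 2) ≤ Real.exp (-(L ^ 2)) := by
      apply Real.exp_le_exp.2; nlinarith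
    have hs : 2 * (n : ℝ) ^ 2 * (2 * (t * Real.exp (-3 * L ^ 2))) < 1 := by
      have a1 : 4 * (n : ℝ) ^ 2 * Real.exp (-3 * L ^ 2) ≤ 8 * (n : ℝ) ^ 3 * Real.exp (-(L ^ 2)) := by
        gcongr
        · norm_num
        · linarith
        · norm_num
      have a2 : 4 * (n : ℝ) ^ 2 * Real.exp (-3 * L ^ 2) ≤ 1 := a1.trans hL2
      have a3 : 0 < 4 * (n : ℝ) ^ 2 * Real.exp (-3 * L ^ 2) := by positivity
      nlinarith
    have h5 := upper_prob hn1' hK h0 h1 hkc (by positivity) hs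
    have h6 : n * (Real.exp (2 * L ^ 2) * (2 * n ^ 2 * (2 * (t * Real.exp (-3 * L ^ 2))))) ≤ t := by
      have a1 : Real.exp (2 * L ^ 2) * Real.exp (-3 * L ^ 2) = Real.exp (-(L ^ 2)) := by
        rw [← Real.exp_add]; ring_nf
      calc _ = t * (4 * n ^ 3 * (Real.exp (2 * L ^ 2) * Real.exp (-3 * L ^ 2))) := by ring
        _ ≤ t * 1 := by
          rw [a1]; gcongr
          have : 0 < (n : ℝ) ^ 3 * Real.exp (-(L ^ 2)) := by positivity
          linarith
        _ = t := mul_one t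
    rw [← hL] at h5
    refine h5.trans ?_
    have : 2 * (n : ℝ) * (1 - p) ^ n = 2 * W := by rw [hW]; ring
    rw [this]
    have h7 : n * (K * n ^ 5 * Real.exp (-(1.3 * (p * n))) + (Real.exp (2 * L ^ 2) *
        (2 * n ^ 2 * (2 * (t * Real.exp (-3 * L ^ 2)))) + K * Real.exp (-(1.3 * (p * n))))) =
        n * (K * n ^ 5 * Real.exp (-(1.3 * (p * n))) + K * Real.exp (-(1.3 * (p * n)))) +
        n * (Real.exp (2 * L ^ 2) * (2 * n ^ 2 * (2 * (t * Real.exp (-3 * L ^ 2))))) := by ring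
    rw [h7]
    linarith
  constructor
  · rw [transfer h0 h1 hM (fun A => A.det = 0)]
    rw [abs_le]
    constructor
    · have h5 := lower_prob hn1' h0 h1
      have h6 : 4 * (n : ℝ) ^ 2 * (1 - p) ^ (2 * n - 1) ≤ ε * W := by
        have a1 : (1 - p) ^ (2 * n - 1) = (1 - p) ^ n * (1 - p) ^ (n - 1) := by
          rw [← pow_add]; congr 1; omega
        have a2 : (1 - p) ^ (n - 1) ≤ 2 * Real.exp (-(p * n)) := by
          have b1 : (1 - p) ^ n = (1 - p) ^ (n - 1) * (1 - p) := by
            rw [← pow_succ]; congr 1; omega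
          have b2 : (1 - p) ^ n ≤ Real.exp (-(p * n)) := by
            calc (1 - p) ^ n ≤ Real.exp (-p) ^ n := by
                  have b0 := Real.add_one_le_exp (-p)
                  exact pow_le_pow_left₀ (by linarith) (by linarith) n
              _ = _ := by rw [← Real.exp_nat_mul]; ring_nf
          have b3 : 0 ≤ (1 - p) ^ (n - 1) := pow_nonneg (by linarith) _
          nlinarith
        have a3 : (n : ℝ) * (2 * Real.exp (-(p * n))) ≤ 2 / n := by
          have c1 : Real.exp (-(p * n)) ≤ Real.exp (-(0.2 * (p * n))) := by
            apply Real.exp_le_exp.2; have : 0 ≤ p * n := by positivity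
            linarith
          have c2 : (n : ℝ) ^ 2 ≤ n ^ 6 := pow_le_pow_right₀ (by linarith) (by norm_num)
          have c3 : (n : ℝ) ^ 2 * Real.exp (-(p * n)) ≤ 1 := le_trans (by gcongr) hsmall
          rw [le_div_iff₀ (by linarith)]
          nlinarith
        have a5 : (8 : ℝ) / n ≤ ε := by
          rw [div_le_iff₀ (by linarith)]; linarith
        calc 4 * (n : ℝ) ^ 2 * (1 - p) ^ (2 * n - 1) = 4 * (n * (1 - p) ^ (n - 1)) * W := by rw [a1, hW]; ring
          _ ≤ 4 * (n * (2 * Real.exp (-(p * n)))) * W := by gcongr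
          _ ≤ 4 * (2 / n) * W := by gcongr
          _ = (8 / n) * W := by ring
          _ ≤ ε * W := by gcongr
      linarith
    · have h5 : Pr (matW p) (fun B : Fin n → Fin n → Bool => (mat B).det = 0) ≤ (2 + ε) * W := by
        refine le_of_forall_pos_le_add fun t ht => ?_
        have ht' : 0 < min t (1 / 2) := by positivity
        have := hmain (min t (1 / 2)) ht' (lt_of_le_of_lt (min_le_right _ _) (by norm_num))
        have h7 : min t (1 / 2) ≤ t := min_le_left _ _
        refine le_trans (Pr_mono hw ?_) (this.trans (by linarith))
        intro B hB
        obtain ⟨v, hv0, hv⟩ := Matrix.exists_mulVec_eq_zero_iff.2 hB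
        have hvp := eNorm_pos hv0
        refine ⟨fun i => (eNorm v)⁻¹ * v i, ?_, ?_⟩
        · rw [eNorm_smul, abs_of_pos (by positivity)]; field_simp
        · have : (mat B).mulVec (fun i => (eNorm v)⁻¹ * v i) = 0 := by
            have := Matrix.mulVec_smul (mat B) (eNorm v)⁻¹ v
            rw [hv, smul_zero] at this
            exact this
          rw [this]
          have h8 : eNorm (0 : Fin n → ℝ) = 0 := by simp [eNorm]
          rw [h8]; positivity
      have : 2 * (n : ℝ) * (1 - p) ^ n = 2 * W := by rw [hW]; ring
      rw [this]
      linarith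
  · intro t ht
    rw [transfer h0 h1 hM (fun A => sMin A ≤ t * Real.exp (-3 * L ^ 2))]
    by_cases ht1 : t < 1
    · refine le_trans (Pr_mono hw ?_) (hmain t ht ht1)
      intro B hB
      have hpos : 0 < t * Real.exp (-3 * L ^ 2) := by positivity
      have hlt : sMin (mat B) < 2 * (t * Real.exp (-3 * L ^ 2)) := by linarith
      have hne : {r | ∃ x : Fin n → ℝ, eNorm x = 1 ∧ r = eNorm ((mat B).mulVec x)}.Nonempty := by
        refine ⟨_, Pi.single ⟨0, hn1'⟩ 1, ?_, rfl⟩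
        unfold eNorm
        rw [Finset.sum_eq_single ⟨0, hn1'⟩]
        · simp
        · intro l _ hl; simp [Pi.single_eq_of_ne hl]
        · simp
      obtain ⟨r, ⟨x, hx, rfl⟩, hr⟩ := exists_lt_of_csInf_lt hne hlt
      exact ⟨x, hx, hr.le⟩
    · push Not at ht1
      have := Pr_le_one hw matW_sum (fun B : Fin n → Fin n → Bool => sMin (mat B) ≤ t * Real.exp (-3 * L ^ 2))
      have : 0 ≤ (2 + ε) * W := by positivity
      linarith

end SB

set_option linter.all false
namespace SB
open Finset

def Expand {ι : Type} {n : ℕ} (p : ℝ) (Q : ι → Fin n → Bool) : Prop :=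
  ∀ m : ℕ, 2 ≤ m → m * p ≤ 1 → 2 * m ≤ n → ∀ f : Fin (2 * m) → Fin n, Function.Injective f →
    ∃ i, ∃ a : Fin (2 * m), a.val < m ∧ Q i (f a) = true ∧ ∀ b, b ≠ a → Q i (f b) = false

lemma Pr_pattern {n l : ℕ} {p : ℝ} (f : Fin l → Fin n) (hf : Function.Injective f) (g : Fin l → Bool) :
    Pr (rowW p) (fun X : Fin n → Bool => ∀ b, X (f b) = g b) = ∏ b, bw p (g b) := by
  have h := Pr_pw_forall (w := fun _ : Fin n => bw p) (fun (j : Fin n) (b : Bool) => ∀ c, f c = j → b = g c)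
  have e : (fun X : Fin n → Bool => ∀ b, X (f b) = g b) =
      (fun X : Fin n → Bool => ∀ j, ∀ c, f c = j → X j = g c) := by
    ext X
    exact ⟨fun hh j c hc => hc ▸ hh c, fun hh b => hh (f b) b rfl⟩
  rw [e]
  unfold rowW
  rw [h, ← Finset.prod_subset (Finset.subset_univ (univ.image f)), Finset.prod_image (fun _ _ _ _ h => hf h)]
  · refine Finset.prod_congr rfl fun c _ => ?_
    have : (fun b : Bool => ∀ c', f c' = f c → b = g c') = fun b => b = g c := by
      ext b
      exact ⟨fun hh => hh c rfl, fun hh c' hc' => by rw [hf hc']; exact hh⟩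
    rw [this]
    cases hg : g c <;> simp [Pr, ind, bw]
  · intro j _ hj
    have : (fun b : Bool => ∀ c', f c' = j → b = g c') = fun _ => True := by
      ext b
      simp only [iff_true]
      intro c' hc'
      exact absurd (mem_image.2 ⟨c', mem_univ _, hc'⟩) hj
    rw [this]
    simp [Pr, ind, bw]

lemma row_expand {n m : ℕ} {p : ℝ} (h0 : 0 ≤ p) (h1 : p ≤ 1) (hm : 1 ≤ m)
    (f : Fin (2 * m) → Fin n) (hf : Function.Injective f) :
    m * (p * (1 - p) ^ (2 * m - 1)) ≤ Pr (rowW p) (fun X : Fin n → Bool =>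
      ∃ a : Fin (2 * m), a.val < m ∧ X (f a) = true ∧ ∀ b, b ≠ a → X (f b) = false) := by
  have hw := rowW_nonneg (n := n) h0 h1
  have hpat : ∀ a : Fin (2 * m), Pr (rowW p) (fun X : Fin n → Bool => ∀ b, X (f b) = decide (b = a)) =
      p * (1 - p) ^ (2 * m - 1) := by
    intro a
    rw [Pr_pattern f hf (fun b => decide (b = a)), ← Finset.mul_prod_erase _ _ (mem_univ a)]
    congr 1
    · simp [bw]
    · rw [Finset.prod_congr rfl (g := fun _ => 1 - p)]
      · simp [card_erase_of_mem]
      · intro b hb; simp [bw, Finset.ne_of_mem_erase hb]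
  let s : Finset (Fin (2 * m)) := univ.filter fun a => a.val < m
  have hs : s.card = m := by
    have : s = Finset.Iio (⟨m, by omega⟩ : Fin (2 * m)) := by
      ext a; simp [s, Fin.lt_def]
    rw [this, Fin.card_Iio]
  have hsum : (m : ℝ) * (p * (1 - p) ^ (2 * m - 1)) =
      Ex (rowW p) (fun X : Fin n → Bool => ∑ a ∈ s, ind (∀ b, X (f b) = decide (b = a))) := by
    rw [Ex_sum]
    have := Finset.sum_congr (rfl : s = s) (fun a _ => hpat a)
    simp only [Pr_eq_Ex] at this
    rw [this]; simp [hs]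
  rw [hsum]
  refine Ex_mono hw fun X => ?_
  by_cases h : ∃ a ∈ s, ∀ b, X (f b) = decide (b = a)
  · obtain ⟨a, ha, hX⟩ := h
    rw [Finset.sum_eq_single_of_mem a ha]
    · apply ind_mono
      intro hX
      refine ⟨a, (mem_filter.1 ha).2, by simp [hX], fun b hb => by simp [hX, hb]⟩
    · intro a' _ hne
      apply ind_false
      intro hX'
      have := hX' a
      rw [hX a] at this
      simp at this
      exact hne this.symm
  · push Not at h
    rw [Finset.sum_eq_zero]
    · exact ind_nonneg _
    · intro a ha
      apply ind_false
      intro hX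
      obtain ⟨b, hb⟩ := h a ha
      exact hb (hX b)

lemma expand_exponent {n m : ℕ} {p : ℝ} (hn : 2 ≤ n) (h0 : 0 ≤ p) (hp : p ≤ 1 / 10000)
    (hd : 10000 * Real.log n ≤ p * n) (hd1 : 1 ≤ p * n) (hm : 2 ≤ m) (hmp : m * p ≤ 1) :
    2 * m * Real.log n - (n - 1) * (m * (p * (1 - p) ^ (2 * m - 1))) ≤ -(1.5 * (p * n)) := by
  have hm' : (2 : ℝ) ≤ m := by exact_mod_cast hm
  have hn' : (2 : ℝ) ≤ n := by exact_mod_cast hn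
  set d := p * n with hdd
  have e1 : Real.exp (-(1.1 * (p * (2 * m : ℕ)))) ≤ (1 - p) ^ (2 * m) := one_sub_pow_ge h0 (by linarith)
  have e2 : (1 - p) ^ (2 * m) = (1 - p) ^ (2 * m - 1) * (1 - p) := by
    rw [← pow_succ]; congr 1; omega
  have hq : 0 ≤ (1 - p) ^ (2 * m - 1) := pow_nonneg (by linarith) _
  have e3 : d * (m * (1 - p) ^ (2 * m)) ≤ (n - 1) * (m * (p * (1 - p) ^ (2 * m - 1))) := by
    have : (n : ℝ) * (1 - p) ≤ n - 1 := by nlinarith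
    calc d * (m * (1 - p) ^ (2 * m)) = (n * (1 - p)) * (m * (p * (1 - p) ^ (2 * m - 1))) := by
          rw [e2, hdd]; ring
      _ ≤ _ := by gcongr
  have e4 : 2 * m * Real.log n ≤ d * (m * (2 / 10000)) := by
    have := mul_le_mul_of_nonneg_left hd (by positivity : (0:ℝ) ≤ m)
    linarith
  have e5 : 1.5 ≤ m * (1 - p) ^ (2 * m) - m * (2 / 10000) := by
    push_cast at e1
    rcases le_or_gt (m * p) (1 / 40) with h | h
    · have : (0.9 : ℝ) ≤ (1 - p) ^ (2 * m) := by
        refine le_trans ?_ e1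
        refine le_trans ?_ (Real.add_one_le_exp _)
        nlinarith
      nlinarith
    · have hm250 : (250 : ℝ) ≤ m := by nlinarith
      have : (0.04 : ℝ) ≤ (1 - p) ^ (2 * m) := by
        refine le_trans ?_ e1
        have : Real.exp (-2.2) ≤ Real.exp (-(1.1 * (p * (2 * m)))) := by
          apply Real.exp_le_exp.2; nlinarith
        refine le_trans ?_ this
        have h3 : Real.exp (-3) ≤ Real.exp (-2.2) := by apply Real.exp_le_exp.2; norm_num
        refine le_trans ?_ h3
        have h4 : Real.exp (-3) = (Real.exp 1 ^ 3)⁻¹ := by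
          rw [← Real.exp_nat_mul, ← Real.exp_neg]; norm_num
        rw [h4, le_inv_comm₀ (by norm_num) (by positivity)]
        have := Real.exp_one_lt_d9
        calc Real.exp 1 ^ 3 ≤ (2.7182818286 : ℝ) ^ 3 := by gcongr
          _ ≤ (0.04 : ℝ)⁻¹ := by norm_num
      nlinarith
  nlinarith

lemma expand_prob {n : ℕ} {p : ℝ} {ι : Type} [Fintype ι] [DecidableEq ι] (hι : Fintype.card ι + 1 = n)
    (hn : 2 ≤ n) (h0 : 0 ≤ p) (hp : p ≤ 1 / 10000)
    (hd : 10000 * Real.log n ≤ p * n) (hd1 : 1 ≤ p * n) :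
    Pr (matW p) (fun Q : ι → Fin n → Bool => ¬ Expand p Q) ≤ n * Real.exp (-(1.5 * (p * n))) := by
  have h1 : p ≤ 1 := by linarith
  have hw := matW_nonneg (ι := ι) (n := n) h0 h1
  have hwr := rowW_nonneg (n := n) h0 h1
  let G : (m : ℕ) → (Fin (2 * m) → Fin n) → (Fin n → Bool) → Prop := fun m f X =>
    ∃ a : Fin (2 * m), a.val < m ∧ X (f a) = true ∧ ∀ b, b ≠ a → X (f b) = false
  have hn0 : (0 : ℝ) < n := by positivity
  let S : Finset ℕ := (range n).filter fun m => 2 ≤ m ∧ (m : ℝ) * p ≤ 1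
  have key : ∀ m ∈ S, Pr (matW p) (fun Q : ι → Fin n → Bool =>
      ∃ f ∈ (univ : Finset (Fin (2 * m) → Fin n)).filter (fun f => Function.Injective f), ∀ i, ¬ G m f (Q i))
      ≤ Real.exp (-(1.5 * (p * n))) := by
    intro m hm
    simp only [S, mem_filter, mem_range] at hm
    obtain ⟨-, hm2, hmp⟩ := hm
    have := Pr_exists_le_card hw ((univ : Finset (Fin (2 * m) → Fin n)).filter (fun f => Function.Injective f))
      (fun f (Q : ι → Fin n → Bool) => ∀ i, ¬ G m f (Q i))
      (Real.exp (-((n - 1) * (m * (p * (1 - p) ^ (2 * m - 1)))))) (by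
        intro f hf
        simp only [mem_filter, mem_univ, true_and] at hf
        unfold matW
        rw [Pr_pw_forall (fun (_ : ι) X => ¬ G m f X)]
        simp only [prod_const, card_univ]
        rw [Pr_not rowW_sum]
        have h2 := row_expand (n := n) h0 h1 (by omega : 1 ≤ m) f hf
        have h3 := Pr_le_one hwr rowW_sum (G m f)
        have hc : ((Fintype.card ι : ℕ) : ℝ) = n - 1 := by rw [← hι]; push_cast; ring
        calc (1 - Pr (rowW p) (G m f)) ^ Fintype.card ι
            ≤ Real.exp (-(m * (p * (1 - p) ^ (2 * m - 1)))) ^ Fintype.card ι := by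
              refine pow_le_pow_left₀ (by linarith) ?_ _
              have := Real.add_one_le_exp (-(m * (p * (1 - p) ^ (2 * m - 1))))
              have h4 : (m : ℝ) * (p * (1 - p) ^ (2 * m - 1)) ≤ Pr (rowW p) (G m f) := h2
              linarith
          _ = _ := by rw [← Real.exp_nat_mul, hc]; ring_nf)
    refine this.trans ?_
    have hcard : (((univ : Finset (Fin (2 * m) → Fin n)).filter (fun f => Function.Injective f)).card : ℝ)
        ≤ Real.exp (2 * m * Real.log n) := by
      have e : Real.exp (2 * m * Real.log n) = (n : ℝ) ^ (2 * m) := by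
        have : 2 * (m : ℝ) * Real.log n = ((2 * m : ℕ) : ℝ) * Real.log n := by push_cast; ring
        rw [this, Real.exp_nat_mul, Real.exp_log hn0]
      rw [e]
      have : ((univ : Finset (Fin (2 * m) → Fin n)).filter (fun f => Function.Injective f)).card ≤ n ^ (2 * m) := by
        refine (card_filter_le _ _).trans ?_
        simp
      exact_mod_cast this
    calc _ ≤ Real.exp (2 * m * Real.log n) * Real.exp (-((n - 1) * (m * (p * (1 - p) ^ (2 * m - 1))))) := by gcongr
      _ = Real.exp (2 * m * Real.log n - (n - 1) * (m * (p * (1 - p) ^ (2 * m - 1)))) := by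
          rw [← Real.exp_add]; ring_nf
      _ ≤ _ := Real.exp_le_exp.2 (expand_exponent hn h0 hp hd hd1 hm2 hmp)
  have h5 := Pr_exists_le_card hw S _ _ key
  refine le_trans (Pr_mono hw ?_) (h5.trans ?_)
  · intro Q hQ
    unfold Expand at hQ
    push Not at hQ
    obtain ⟨m, hm2, hmp, hmn, f, hf, hff⟩ := hQ
    refine ⟨m, by simp only [S, mem_filter, mem_range]; exact ⟨by omega, hm2, hmp⟩, f, by simpa using hf, ?_⟩
    rintro i ⟨a, ha, hX, hb⟩
    obtain ⟨b, hb1, hb2⟩ := hff i a ha hX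
    exact hb2 (hb b hb1)
  · gcongr
    have : S.card ≤ n := (card_filter_le _ _).trans (by simp)
    exact_mod_cast this

end SB

set_option linter.all false
namespace SB
open Finset

/-- Weights for randomized rounding. -/
noncomputable def rdW {n : ℕ} (v : Fin n → ℝ) : (Fin n → Bool) → ℝ := pw (fun j => bw (Int.fract (v j)))

/-- Randomized rounding. -/
noncomputable def rz {n : ℕ} (v : Fin n → ℝ) (b : Fin n → Bool) : Fin n → ℤ :=
  fun j => ⌊v j⌋ + (if b j then 1 else 0)

lemma rdW_nonneg {n : ℕ} (v : Fin n → ℝ) (b : Fin n → Bool) : 0 ≤ rdW v b :=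
  pw_nonneg (fun j => bw_nonneg (Int.fract_nonneg _) (Int.fract_lt_one _).le) b

lemma rdW_sum {n : ℕ} (v : Fin n → ℝ) : ∑ b, rdW v b = 1 := pw_sum fun _ => bw_sum

lemma rz_sub {n : ℕ} (v : Fin n → ℝ) (b : Fin n → Bool) (j : Fin n) :
    (rz v b j : ℝ) - v j = (if b j then 1 else 0) - Int.fract (v j) := by
  have := Int.floor_add_fract (v j)
  simp only [rz]; push_cast
  by_cases hb : b j = true
  · simp only [hb, if_true]; push_cast; linarith
  · simp only [hb]; push_cast; linarith

lemma rz_close {n : ℕ} (v : Fin n → ℝ) (b : Fin n → Bool) (j : Fin n) :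
    |(rz v b j : ℝ) - v j| ≤ 1 := by
  rw [rz_sub]
  have h1 := Int.fract_nonneg (v j)
  have h2 := Int.fract_lt_one (v j)
  rw [abs_le]
  split_ifs <;> constructor <;> linarith

lemma dot_eq {n : ℕ} (X : Fin n → Bool) (u : Fin n → ℝ) :
    dot X u = ∑ j ∈ univ.filter (fun j => X j = true), u j := by
  unfold dot; rw [Finset.sum_filter]

lemma round_var {n : ℕ} (v : Fin n → ℝ) (X : Fin n → Bool) :
    Ex (rdW v) (fun b => (dot X (fun j => (rz v b j : ℝ) - v j)) ^ 2) ≤ cnt X / 4 := by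
  set S := univ.filter (fun j => X j = true) with hS
  let g : Fin n → Bool → ℝ := fun j b => (if b then 1 else 0) - Int.fract (v j)
  have e : ∀ b : Fin n → Bool, (dot X (fun j => (rz v b j : ℝ) - v j)) ^ 2 =
      ∑ j ∈ S, ∑ k ∈ S, g j (b j) * g k (b k) := by
    intro b
    rw [dot_eq, sq, Finset.sum_mul_sum]
    refine Finset.sum_congr rfl fun j _ => Finset.sum_congr rfl fun k _ => ?_
    rw [rz_sub, rz_sub]
  simp only [e]
  rw [Ex_sum]
  have hmean : ∀ j, Ex (bw (Int.fract (v j))) (g j) = 0 := by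
    intro j; simp [Ex, bw, g]; ring
  have hvar : ∀ j, Ex (rdW v) (fun b => g j (b j) * g j (b j)) ≤ 1 / 4 := by
    intro j
    have := Ex_pw_one (w := fun j => bw (Int.fract (v j))) (fun _ => bw_sum) j (fun b => g j b * g j b)
    unfold rdW
    rw [this]
    simp [Ex, bw, g]
    nlinarith [sq_nonneg (Int.fract (v j) - 1 / 2)]
  calc _ ≤ ∑ j ∈ S, (1 / 4 : ℝ) := by
        refine Finset.sum_le_sum fun j hj => ?_
        rw [Ex_sum, Finset.sum_eq_single_of_mem j hj]
        · exact hvar j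
        · intro k _ hk
          have := Ex_pw_two (w := fun j => bw (Int.fract (v j))) (fun _ => bw_sum) hk.symm (g j) (g k)
          unfold rdW
          rw [this, hmean, zero_mul]
    _ = _ := by simp [hS, cnt]; ring

lemma log_jensen {a b f : ℝ} (ha : 0 < a) (hb : 0 < b) (h0 : 0 ≤ f) (h1 : f ≤ 1) :
    f * Real.log a + (1 - f) * Real.log b ≤ Real.log (f * a + (1 - f) * b) := by
  have := strictConcaveOn_log_Ioi.concaveOn.2 (Set.mem_Ioi.2 ha) (Set.mem_Ioi.2 hb) h0
    (by linarith : 0 ≤ 1 - f) (by ring)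
  simpa using this

lemma round_log {n : ℕ} (v : Fin n → ℝ) {N : ℝ} (hN : 0 < N) (j : Fin n) :
    Ex (rdW v) (fun b => Real.log (1 + |(rz v b j : ℝ)| / N)) ≤ Real.log (1 + |v j| / N) := by
  have := Ex_pw_one (w := fun j => bw (Int.fract (v j))) (fun _ => bw_sum) j
    (fun b => Real.log (1 + |((⌊v j⌋ + (if b then 1 else 0) : ℤ) : ℝ)| / N))
  unfold rdW rz
  rw [this]
  simp only [Ex, bw, Fintype.sum_bool, if_true, Bool.false_eq_true, if_false, add_zero]
  have h0 := Int.fract_nonneg (v j)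
  have h1 := (Int.fract_lt_one (v j)).le
  have h2 := Int.floor_add_fract (v j)
  refine (log_jensen (by positivity) (by positivity) h0 h1).trans (le_of_eq ?_)
  congr 1
  have key : Int.fract (v j) * |((⌊v j⌋ + 1 : ℤ) : ℝ)| + (1 - Int.fract (v j)) * |(⌊v j⌋ : ℝ)| = |v j| := by
    rcases le_or_gt 0 (v j) with h | h
    · have h3 : (0 : ℝ) ≤ ⌊v j⌋ := by exact_mod_cast Int.floor_nonneg.2 h
      push_cast
      rw [abs_of_nonneg h, abs_of_nonneg h3, abs_of_nonneg (by linarith)]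
      nlinarith
    · have h3 : ⌊v j⌋ + 1 ≤ 0 := by
        have : ⌊v j⌋ < 0 := Int.floor_lt_zero.2 h
        omega
      have h3' : (⌊v j⌋ : ℝ) + 1 ≤ 0 := by exact_mod_cast h3
      push_cast
      rw [abs_of_neg h, abs_of_nonpos h3', abs_of_nonpos (by linarith)]
      nlinarith
  rw [← key]
  field_simp
  ring

/-- Integer vectors with bounded logarithmic size. -/
noncomputable def zset (n : ℕ) (N A : ℝ) : Finset (Fin n → ℤ) := by
  classical
  exact (Fintype.piFinset fun _ => Finset.Icc (-⌈N * Real.exp A⌉) ⌈N * Real.exp A⌉).filter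
    (fun z => ∑ j, Real.log (1 + |(z j : ℝ)| / N) ≤ A)

lemma log_term_nonneg (z : ℝ) {N : ℝ} (hN : 0 < N) : 0 ≤ Real.log (1 + |z| / N) :=
  Real.log_nonneg (by have : 0 ≤ |z| / N := by positivity
                      linarith)

lemma mem_zset {n : ℕ} {N A : ℝ} (hN : 0 < N) {z : Fin n → ℤ} :
    z ∈ zset n N A ↔ ∑ j, Real.log (1 + |(z j : ℝ)| / N) ≤ A := by
  unfold zset
  simp only [mem_filter, Fintype.mem_piFinset, and_iff_right_iff_imp]
  intro h j
  have h1 : Real.log (1 + |(z j : ℝ)| / N) ≤ A :=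
    (Finset.single_le_sum (f := fun j => Real.log (1 + |(z j : ℝ)| / N))
      (fun j _ => log_term_nonneg _ hN) (mem_univ j)).trans h
  have h2 : 0 ≤ |(z j : ℝ)| / N := by positivity
  rw [Real.log_le_iff_le_exp (by linarith)] at h1
  have h3 : |(z j : ℝ)| ≤ N * Real.exp A := by
    have : |(z j : ℝ)| / N ≤ Real.exp A := by linarith
    rw [div_le_iff₀ hN] at this; linarith
  have h4 : |z j| ≤ ⌈N * Real.exp A⌉ := by
    have : ((|z j| : ℤ) : ℝ) ≤ (⌈N * Real.exp A⌉ : ℝ) := by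
      push_cast; exact h3.trans (Int.le_ceil _)
    exact_mod_cast this
  rw [mem_Icc]
  exact abs_le.1 h4

lemma zset_sum_le {n : ℕ} {N A : ℝ} (hN : 0 < N) (K : ℕ) (Φ : ℤ → ℝ) (hΦ : ∀ z, 0 ≤ Φ z) :
    ∑ z ∈ zset n N A, ∏ j, Φ (z j) ≤ Real.exp (K * A) *
      (∑ z ∈ Finset.Icc (-⌈N * Real.exp A⌉) ⌈N * Real.exp A⌉, Φ z * ((1 + |(z : ℝ)| / N) ^ K)⁻¹) ^ n := by
  classical
  set I := Finset.Icc (-⌈N * Real.exp A⌉) ⌈N * Real.exp A⌉ with hI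
  have e : (∑ z ∈ I, Φ z * ((1 + |(z : ℝ)| / N) ^ K)⁻¹) ^ n =
      ∑ z ∈ Fintype.piFinset (fun _ : Fin n => I), ∏ j, (Φ (z j) * ((1 + |(z j : ℝ)| / N) ^ K)⁻¹) := by
    have := Finset.prod_univ_sum (fun _ : Fin n => I) (fun _ z => Φ z * ((1 + |(z : ℝ)| / N) ^ K)⁻¹)
    rw [← this]; simp
  rw [e, Finset.mul_sum]
  calc ∑ z ∈ zset n N A, ∏ j, Φ (z j)
      ≤ ∑ z ∈ zset n N A, Real.exp (K * A) * ∏ j, (Φ (z j) * ((1 + |(z j : ℝ)| / N) ^ K)⁻¹) := by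
        refine Finset.sum_le_sum fun z hz => ?_
        rw [mem_zset hN] at hz
        rw [Finset.prod_mul_distrib, mul_left_comm]
        have hp : 0 ≤ ∏ j, Φ (z j) := Finset.prod_nonneg fun j _ => hΦ _
        refine le_mul_of_one_le_right hp ?_
        have h1 : ∏ j, ((1 + |(z j : ℝ)| / N) ^ K)⁻¹ =
            Real.exp (-(K * ∑ j, Real.log (1 + |(z j : ℝ)| / N))) := by
          rw [Finset.mul_sum, ← Finset.sum_neg_distrib, Real.exp_sum]
          refine Finset.prod_congr rfl fun j _ => ?_
          rw [Real.exp_neg, Real.exp_nat_mul, Real.exp_log]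
          have : 0 ≤ |(z j : ℝ)| / N := by positivity
          linarith
        rw [h1, ← Real.exp_add]
        apply Real.one_le_exp
        have : (K : ℝ) * ∑ j, Real.log (1 + |(z j : ℝ)| / N) ≤ K * A := by gcongr
        linarith
    _ ≤ _ := by
        refine Finset.sum_le_sum_of_subset_of_nonneg (by unfold zset; exact filter_subset _ _) ?_
        intro z _ _
        have : 0 ≤ ∏ j, (Φ (z j) * ((1 + |(z j : ℝ)| / N) ^ K)⁻¹) :=
          Finset.prod_nonneg fun j _ => mul_nonneg (hΦ _) (by positivity)
        positivity

/-- number of coordinates exceeding `H * N`. -/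
lemma card_large_le {n : ℕ} {N A H : ℝ} (hN : 0 < N) (hH : 0 < H) {z : Fin n → ℤ}
    (hz : ∑ j, Real.log (1 + |(z j : ℝ)| / N) ≤ A) :
    ((univ.filter fun j => H * N < |(z j : ℝ)|).card : ℝ) * Real.log (1 + H) ≤ A := by
  refine le_trans ?_ hz
  rw [← nsmul_eq_mul]
  calc _ ≤ ∑ j ∈ univ.filter (fun j => H * N < |(z j : ℝ)|), Real.log (1 + |(z j : ℝ)| / N) := by
        refine Finset.card_nsmul_le_sum _ _ _ fun j hj => ?_
        have := (mem_filter.1 hj).2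
        apply Real.log_le_log (by linarith)
        have : H ≤ |(z j : ℝ)| / N := by rw [le_div_iff₀ hN]; exact this.le
        linarith
    _ ≤ _ := Finset.sum_le_sum_of_subset_of_nonneg (filter_subset _ _)
        fun j _ _ => log_term_nonneg _ hN

end SB

set_option linter.all false
namespace SB
open Finset

/-- standard Gaussian measure -/
noncomputable abbrev gam : Measure ℝ := ProbabilityTheory.gaussianReal 0 1

lemma gauss_cexp (t : ℝ) : ∫ g, Complex.exp ((g * t : ℝ) * Complex.I) ∂gam = (Real.exp (-(t ^ 2) / 2) : ℝ) := by
  have h := ProbabilityTheory.charFun_gaussianReal (μ := 0) (v := 1) t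
  rw [charFun_apply_real] at h
  have e : (∫ g, Complex.exp ((g * t : ℝ) * Complex.I) ∂gam) = ∫ (x : ℝ), Complex.exp (↑t * ↑x * Complex.I) ∂gam := by
    congr 1; ext g; push_cast; ring_nf
  rw [e, h]; push_cast; congr 1; ring_nf

lemma int_of_bdd {E : Type*} [NormedAddCommGroup E] [SecondCountableTopology E] [MeasurableSpace E] [BorelSpace E] {f : ℝ → E} (hf : Continuous f) {c : ℝ} (h : ∀ x, ‖f x‖ ≤ c) :
    Integrable f gam :=
  Integrable.of_bound hf.aestronglyMeasurable c (Filter.Eventually.of_forall h)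

lemma gauss_cos (t : ℝ) : ∫ g, Real.cos (g * t) ∂gam = Real.exp (-(t ^ 2) / 2) := by
  have h := gauss_cexp t
  have hi : Integrable (fun g : ℝ => Complex.exp ((g * t : ℝ) * Complex.I)) gam :=
    int_of_bdd (by fun_prop) (c := 1) (fun g => by rw [Complex.norm_exp_ofReal_mul_I])
  have h2 := integral_re (𝕜 := ℂ) hi
  have : (fun g : ℝ => Real.cos (g * t)) = fun g : ℝ => RCLike.re (Complex.exp ((g * t : ℝ) * Complex.I)) := by
    ext g; simp only [RCLike.re_eq_complex_re, Complex.exp_ofReal_mul_I_re]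
  rw [this, h2, h]
  simp only [RCLike.re_eq_complex_re, Complex.ofReal_re]

/-- Fourier bound for Gaussian-smoothed probabilities. -/
lemma gauss_fourier {α : Type*} [Fintype α] (w : α → ℝ) (t : α → ℝ) :
    Ex w (fun a => Real.exp (-(t a) ^ 2 / 2)) ≤
      ∫ g, ‖∑ a, (w a : ℂ) * Complex.exp ((g * t a : ℝ) * Complex.I)‖ ∂gam := by
  have hi : ∀ a, Integrable (fun g : ℝ => (w a : ℂ) * Complex.exp ((g * t a : ℝ) * Complex.I)) gam :=
    fun a => int_of_bdd (by fun_prop) (c := |w a|)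
      (fun g => by rw [norm_mul, Complex.norm_exp_ofReal_mul_I, Complex.norm_real, Real.norm_eq_abs, mul_one])
  have e : ((Ex w (fun a => Real.exp (-(t a) ^ 2 / 2)) : ℝ) : ℂ) =
      ∫ g, ∑ a, (w a : ℂ) * Complex.exp ((g * t a : ℝ) * Complex.I) ∂gam := by
    rw [integral_finsetSum _ (fun a _ => hi a)]
    unfold Ex
    simp only [Complex.ofReal_sum, Complex.ofReal_mul]
    refine Finset.sum_congr rfl fun a _ => ?_
    rw [integral_const_mul]
    have := gauss_cexp (t a)
    simp only [Complex.ofReal_mul] at this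
    rw [this]
  calc _ ≤ ‖((Ex w (fun a => Real.exp (-(t a) ^ 2 / 2)) : ℝ) : ℂ)‖ := by
        rw [Complex.norm_real]; exact le_abs_self _
    _ ≤ _ := by rw [e]; exact norm_integral_le_integral_norm _

/-- complex row product formula -/
lemma row_cprod {p : ℝ} {n : ℕ} (f : Fin n → Bool → ℂ) :
    ∑ X : Fin n → Bool, (rowW p X : ℂ) * ∏ j, f j (X j) = ∏ j, ((p : ℂ) * f j true + (1 - p) * f j false) := by
  have h : ∀ j, (p : ℂ) * f j true + (1 - p) * f j false = ∑ b : Bool, (bw p b : ℂ) * f j b := by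
    intro j; simp [bw]
  simp only [h]
  rw [Finset.prod_univ_sum, Fintype.piFinset_univ]
  refine Finset.sum_congr rfl fun X _ => ?_
  rw [Finset.prod_mul_distrib]
  simp [rowW, pw]

lemma cexp_dot {n : ℕ} (X : Fin n → Bool) (y : Fin n → ℝ) (θ : ℝ) :
    Complex.exp ((θ * dot X y : ℝ) * Complex.I) =
      ∏ j, (if X j = true then Complex.exp ((θ * y j : ℝ) * Complex.I) else 1) := by
  unfold dot
  rw [Finset.mul_sum]; push_cast
  rw [Finset.sum_mul, Complex.exp_sum]
  refine Finset.prod_congr rfl fun j _ => ?_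
  split_ifs <;> simp

lemma norm_factor {p : ℝ} (h0 : 0 ≤ p) (h1 : p ≤ 1 / 2) (φ : ℝ) :
    ‖(p : ℂ) * Complex.exp ((φ : ℝ) * Complex.I) + (1 - p)‖ ≤ Real.exp (-(p / 2 * (1 - Real.cos φ))) := by
  have e : ‖(p : ℂ) * Complex.exp ((φ : ℝ) * Complex.I) + (1 - p)‖ ^ 2 = 1 - 2 * p * (1 - p) * (1 - Real.cos φ) := by
    rw [Complex.sq_norm, Complex.normSq_apply]
    have hs := Real.sin_sq_add_cos_sq φ
    simp [Complex.exp_ofReal_mul_I_re, Complex.exp_ofReal_mul_I_im]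
    linear_combination p ^ 2 * hs
  have hc := Real.cos_le_one φ
  have h2 : ‖(p : ℂ) * Complex.exp ((φ : ℝ) * Complex.I) + (1 - p)‖ ^ 2 ≤ (Real.exp (-(p / 2 * (1 - Real.cos φ)))) ^ 2 := by
    rw [e, ← Real.exp_nat_mul]
    refine le_trans ?_ (Real.add_one_le_exp _)
    push_cast
    nlinarith [mul_nonneg h0 (sub_nonneg.2 hc)]
  exact le_of_sq_le_sq h2 (Real.exp_pos _).le

lemma row_char_le {p : ℝ} {n : ℕ} (h0 : 0 ≤ p) (h1 : p ≤ 1 / 2) (y : Fin n → ℝ) (θ : ℝ) :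
    ‖∑ X : Fin n → Bool, (rowW p X : ℂ) * Complex.exp ((θ * dot X y : ℝ) * Complex.I)‖ ≤
      Real.exp (-(p / 2 * ∑ j, (1 - Real.cos (θ * y j)))) := by
  simp only [cexp_dot]
  have := row_cprod (p := p) (n := n) (fun j b => if b = true then Complex.exp ((θ * y j : ℝ) * Complex.I) else 1)
  rw [this, norm_prod, Finset.mul_sum, ← Finset.sum_neg_distrib, Real.exp_sum]
  refine Finset.prod_le_prod (fun j _ => norm_nonneg _) fun j _ => ?_
  simpa using norm_factor h0 h1 (θ * y j)

lemma gauss_trig (A B D t : ℝ) :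
    ∫ g, (A + B * Real.cos (g * t) + D * Real.cos (g * (2 * t))) ∂gam =
      A + B * Real.exp (-(t ^ 2) / 2) + D * Real.exp (-((2 * t) ^ 2) / 2) := by
  have hc : ∀ (B s : ℝ), Integrable (fun g : ℝ => B * Real.cos (g * s)) gam := fun B s =>
    int_of_bdd (by fun_prop) (c := |B|) (fun g => by
      rw [norm_mul, Real.norm_eq_abs, Real.norm_eq_abs]
      exact mul_le_of_le_one_right (abs_nonneg _) (Real.abs_cos_le_one _))
  rw [integral_add, integral_add, integral_const_mul, integral_const_mul, gauss_cos, gauss_cos]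
  · simp
  · exact integrable_const _
  · exact hc _ _
  · exact (integrable_const _).add (hc _ _)
  · exact hc _ _

lemma exp_neg_le_quad {x : ℝ} (hx : 0 ≤ x) : Real.exp (-x) ≤ 1 - x + x ^ 2 / 2 := by
  have h := Real.quadratic_le_exp_of_nonneg hx
  rw [Real.exp_neg]
  have h1 : (Real.exp x)⁻¹ ≤ (1 + x + x ^ 2 / 2)⁻¹ := inv_anti₀ (by positivity) h
  refine h1.trans ?_
  rw [inv_le_iff_one_le_mul₀ (by positivity)]
  nlinarith [sq_nonneg (x ^ 2)]

lemma gauss_osc {a v : ℝ} (ha : 1 ≤ a) (hv : 0 < v) (hav : 1 ≤ a * v ^ 2) :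
    ∫ g, Real.exp (-(a / 2 * (1 - Real.cos (g * v)))) ∂gam ≤ 15 / 16 := by
  have hle : ∀ g, 0 ≤ 1 - Real.cos (g * v) := fun g => sub_nonneg.2 (Real.cos_le_one _)
  have hintg : Integrable (fun g => Real.exp (-(a / 2 * (1 - Real.cos (g * v))))) gam :=
    int_of_bdd (by fun_prop) (c := 1) (fun g => by
      rw [Real.norm_eq_abs, abs_of_pos (Real.exp_pos _), Real.exp_le_one_iff]
      have := hle g
      have : 0 ≤ a / 2 * (1 - Real.cos (g * v)) := by positivity
      linarith)
  have hint2 : ∀ A B D : ℝ, Integrable (fun g => A + B * Real.cos (g * v) + D * Real.cos (g * (2 * v))) gam :=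
    fun A B D => int_of_bdd (by fun_prop) (c := |A| + |B| + |D|) (fun g => by
      refine (norm_add₃_le).trans ?_
      simp only [norm_mul, Real.norm_eq_abs]
      have h1 := mul_le_of_le_one_right (abs_nonneg B) (Real.abs_cos_le_one (g * v))
      have h2 := mul_le_of_le_one_right (abs_nonneg D) (Real.abs_cos_le_one (g * (2 * v)))
      linarith)
  rcases le_or_gt v 1 with h1 | h1
  · set s := v ^ 2 / 2 with hs
    have hs0 : 0 < s := by positivity
    have hs1 : s ≤ 1 / 2 := by rw [hs]; nlinarith
    have hv2 : v ^ 2 = 2 * s := by rw [hs]; ring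
    have key : ∫ g, Real.exp (-(a / 2 * (1 - Real.cos (g * v)))) ∂gam ≤
        ∫ g, ((1 - 1 / (4 * s) + 3 / (64 * s ^ 2)) + (1 / (4 * s) - 1 / (16 * s ^ 2)) * Real.cos (g * v)
          + 1 / (64 * s ^ 2) * Real.cos (g * (2 * v))) ∂gam := by
      refine integral_mono hintg (hint2 _ _ _) fun g => ?_
      have hx : (1 - Real.cos (g * v)) / (4 * s) ≤ a / 2 * (1 - Real.cos (g * v)) := by
        rw [div_le_iff₀ (by positivity)]
        have h := hle g
        have h2 : 1 ≤ a * (2 * s) := by rw [← hv2]; exact hav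
        calc 1 - Real.cos (g * v) = 1 * (1 - Real.cos (g * v)) := by ring
          _ ≤ (a * (2 * s)) * (1 - Real.cos (g * v)) := mul_le_mul_of_nonneg_right h2 h
          _ = _ := by ring
      have hx0 : 0 ≤ (1 - Real.cos (g * v)) / (4 * s) := div_nonneg (hle g) (by positivity)
      refine (Real.exp_le_exp.2 (neg_le_neg hx)).trans ((exp_neg_le_quad hx0).trans (le_of_eq ?_))
      have : g * (2 * v) = 2 * (g * v) := by ring
      rw [this, Real.cos_two_mul]
      field_simp
      ring
    rw [gauss_trig] at key
    have e1 : -(v ^ 2) / 2 = -s := by rw [hs]; ring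
    have e2 : -((2 * v) ^ 2) / 2 = -(4 * s) := by rw [hs]; ring
    rw [e1, e2] at key
    refine key.trans ?_
    have b1 := exp_neg_le_quad hs0.le
    have b2 := exp_neg_le_quad (x := 4 * s) (by positivity)
    have b3 := Real.add_one_le_exp (-s)
    have : (1 - 1 / (4 * s) + 3 / (64 * s ^ 2)) + (1 / (4 * s) - 1 / (16 * s ^ 2)) * Real.exp (-s)
          + 1 / (64 * s ^ 2) * Real.exp (-(4 * s)) =
        1 - (1 - Real.exp (-s)) / (4 * s) + (3 / 2 - 2 * Real.exp (-s) + Real.exp (-(4 * s)) / 2) / (32 * s ^ 2) := by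
      field_simp; ring
    rw [this]
    have c1 : 1 / 4 - s / 8 ≤ (1 - Real.exp (-s)) / (4 * s) := by
      rw [le_div_iff₀ (by positivity)]; nlinarith
    have c2 : (3 / 2 - 2 * Real.exp (-s) + Real.exp (-(4 * s)) / 2) / (32 * s ^ 2) ≤ 1 / 8 := by
      rw [div_le_iff₀ (by positivity)]; nlinarith
    linarith
  · have key : ∫ g, Real.exp (-(a / 2 * (1 - Real.cos (g * v)))) ∂gam ≤
        ∫ g, (3 / 4 + 1 / 4 * Real.cos (g * v) + 0 * Real.cos (g * (2 * v))) ∂gam := by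
      refine integral_mono hintg (hint2 _ _ _) fun g => ?_
      have h0 := hle g
      have h2 := Real.neg_one_le_cos (g * v)
      have hx : (1 - Real.cos (g * v)) / 2 ≤ a / 2 * (1 - Real.cos (g * v)) := by nlinarith
      refine (Real.exp_le_exp.2 (neg_le_neg hx)).trans ((exp_neg_le_quad (by linarith)).trans ?_)
      nlinarith
    rw [gauss_trig] at key
    refine key.trans ?_
    have : Real.exp (-(v ^ 2) / 2) ≤ Real.exp (-(1 / 2)) := Real.exp_le_exp.2 (by nlinarith)
    have h3 := exp_neg_le_quad (x := 1 / 2) (by norm_num)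
    norm_num at h3
    linarith

lemma row_functional {p : ℝ} {n m : ℕ} (h0 : 0 < p) (h1 : p ≤ 1 / 2) (hm : 1 ≤ m * p) (y : Fin n → ℝ)
    (hy : m ≤ (univ.filter fun j => 200 * Real.sqrt (n / m) ≤ |y j|).card) :
    Ex (rowW p) (fun X : Fin n → Bool => Real.exp (-((dot X y) ^ 2 / (80000 * (p * n))))) ≤ 15 / 16 := by
  have hm0 : (0 : ℝ) < m := by
    by_contra h
    nlinarith
  have hmn : m ≤ n := hy.trans ((card_le_univ _).trans (by simp))
  have hn0 : (0 : ℝ) < n := hm0.trans_le (by exact_mod_cast hmn)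
  obtain ⟨J, hJ, hJc⟩ := Finset.exists_subset_card_eq hy
  set q := 200 * Real.sqrt (p * n) with hq
  have hq0 : 0 < q := by positivity
  have hq2 : q ^ 2 = 40000 * (p * n) := by
    rw [hq, mul_pow, Real.sq_sqrt (by positivity)]; norm_num
  have e : (fun X : Fin n → Bool => Real.exp (-((dot X y) ^ 2 / (80000 * (p * n))))) =
      fun X => Real.exp (-(dot X y / q) ^ 2 / 2) := by
    ext X; congr 1; rw [div_pow, hq2]; field_simp; ring
  rw [e]
  refine (gauss_fourier _ _).trans ?_
  have hJint : ∀ j, Integrable (fun g => Real.exp (-((m * p) / 2 * (1 - Real.cos (g * (y j / q)))))) gam := fun j =>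
    int_of_bdd (by fun_prop) (c := 1) (fun g => by
      rw [Real.norm_eq_abs, abs_of_pos (Real.exp_pos _), Real.exp_le_one_iff]
      have h := sub_nonneg.2 (Real.cos_le_one (g * (y j / q)))
      have : 0 ≤ (m * p) / 2 * (1 - Real.cos (g * (y j / q))) := by positivity
      linarith)
  calc _ ≤ ∫ g, ∑ j ∈ J, (m : ℝ)⁻¹ * Real.exp (-((m * p) / 2 * (1 - Real.cos (g * (y j / q))))) ∂gam := by
        refine integral_mono ?_ ?_ fun g => ?_
        · refine int_of_bdd (by fun_prop) (c := ∑ X : Fin n → Bool, |rowW p X|) fun g => ?_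
          rw [norm_norm]
          refine (norm_sum_le _ _).trans (Finset.sum_le_sum fun X _ => ?_)
          rw [norm_mul, Complex.norm_exp_ofReal_mul_I, Complex.norm_real, Real.norm_eq_abs, mul_one]
        · exact integrable_finsetSum _ fun j _ => (hJint j).const_mul _
        · simp only []
          have e2 : ∀ X : Fin n → Bool, g * (dot X y / q) = (g / q) * dot X y := fun X => by ring
          simp only [e2]
          refine (row_char_le h0.le h1 y (g / q)).trans ?_
          have hj := convexOn_exp.map_sum_le (t := J) (w := fun _ => (m : ℝ)⁻¹)
            (p := fun j => -((m * p) / 2 * (1 - Real.cos (g * (y j / q))))) (fun _ _ => by positivity)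
            (by rw [Finset.sum_const, hJc, nsmul_eq_mul]; field_simp) (fun _ _ => Set.mem_univ _)
          simp only [smul_eq_mul] at hj
          refine le_trans (Real.exp_le_exp.2 ?_) hj
          have e3 : ∀ j, (m : ℝ)⁻¹ * -((m * p) / 2 * (1 - Real.cos (g * (y j / q)))) =
              -(p / 2 * (1 - Real.cos (g / q * y j))) := fun j => by
            have : g * (y j / q) = g / q * y j := by ring
            rw [this]; field_simp
          simp only [e3, Finset.sum_neg_distrib, ← Finset.mul_sum]
          have : ∑ j ∈ J, (1 - Real.cos (g / q * y j)) ≤ ∑ j, (1 - Real.cos (g / q * y j)) :=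
            Finset.sum_le_sum_of_subset_of_nonneg (subset_univ _)
              fun j _ _ => sub_nonneg.2 (Real.cos_le_one _)
          nlinarith
    _ = ∑ j ∈ J, (m : ℝ)⁻¹ * ∫ g, Real.exp (-((m * p) / 2 * (1 - Real.cos (g * (y j / q))))) ∂gam := by
        rw [integral_finsetSum _ fun j _ => (hJint j).const_mul _]
        simp only [integral_const_mul]
    _ ≤ ∑ j ∈ J, (m : ℝ)⁻¹ * (15 / 16) := by
        refine Finset.sum_le_sum fun j hj => mul_le_mul_of_nonneg_left ?_ (by positivity)
        have hyj := (mem_filter.1 (hJ hj)).2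
        have hy0 : 0 < |y j| := lt_of_lt_of_le (by positivity) hyj
        have e4 : ∀ g, Real.cos (g * (y j / q)) = Real.cos (g * (|y j| / q)) := by
          intro g
          rcases abs_choice (y j) with h | h
          · rw [h]
          · rw [h, ← Real.cos_neg]; congr 1; ring
        simp only [e4]
        refine gauss_osc hm (by positivity) ?_
        rw [div_pow, hq2]
        have : (200 * Real.sqrt (n / m)) ^ 2 ≤ |y j| ^ 2 := by gcongr
        rw [mul_pow, Real.sq_sqrt (by positivity)] at this
        have h5 : 40000 * (n : ℝ) ≤ |y j| ^ 2 * m := by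
          have := mul_le_mul_of_nonneg_right this hm0.le
          rw [mul_assoc, div_mul_cancel₀ _ hm0.ne'] at this
          linarith
        rw [mul_div_assoc', le_div_iff₀ (by positivity)]
        nlinarith
    _ = 15 / 16 := by
        rw [Finset.sum_const, hJc, nsmul_eq_mul]; field_simp
end SB

set_option linter.all false
namespace SB
open Finset

lemma sum_Icc_symm_succ (f : ℤ → ℝ) (M : ℕ) :
    ∑ z ∈ Finset.Icc (-((M + 1 : ℕ) : ℤ)) ((M + 1 : ℕ) : ℤ), f z =
      ∑ z ∈ Finset.Icc (-(M : ℤ)) (M : ℤ), f z + (f (M + 1) + f (-(M + 1))) := by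
  have : Finset.Icc (-((M + 1 : ℕ) : ℤ)) ((M + 1 : ℕ) : ℤ) =
      insert ((M : ℤ) + 1) (insert (-((M : ℤ) + 1)) (Finset.Icc (-(M : ℤ)) (M : ℤ))) := by
    ext z; simp only [mem_insert, mem_Icc]; push_cast; omega
  rw [this, sum_insert, sum_insert]
  · ring
  · simp only [mem_Icc]; omega
  · simp only [mem_insert, mem_Icc]; omega

lemma sum_weight_two {N : ℝ} (hN : 0 < N) (M : ℤ) :
    ∑ z ∈ Finset.Icc (-M) M, ((1 + |(z : ℝ)| / N) ^ 2)⁻¹ ≤ 1 + 2 * N := by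
  rcases lt_or_ge M 0 with h | h
  · rw [Finset.Icc_eq_empty (by omega)]; simp; positivity
  obtain ⟨M, rfl⟩ := Int.eq_ofNat_of_zero_le h
  have : ∑ z ∈ Finset.Icc (-(M : ℤ)) M, ((1 + |(z : ℝ)| / N) ^ 2)⁻¹ ≤ 1 + 2 * (N - N ^ 2 / (N + M)) := by
    induction M with
    | zero => simp; field_simp; simp
    | succ M ih =>
      rw [sum_Icc_symm_succ]
      have ih := ih (by positivity)
      have e : ((1 + |(((M : ℤ) + 1 : ℤ) : ℝ)| / N) ^ 2)⁻¹ = N ^ 2 / (N + M + 1) ^ 2 := by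
        push_cast
        rw [abs_of_nonneg (by positivity)]
        field_simp
        ring_nf
      have e' : ((1 + |((-((M : ℤ) + 1) : ℤ) : ℝ)| / N) ^ 2)⁻¹ = N ^ 2 / (N + M + 1) ^ 2 := by
        rw [← e]; push_cast; rw [abs_neg]
      rw [e, e']
      have : N ^ 2 / (N + M + 1) ^ 2 ≤ N ^ 2 / (N + M) - N ^ 2 / (N + M + 1) := by
        rw [div_sub_div _ _ (by positivity) (by positivity), div_le_div_iff₀ (by positivity) (by positivity)]
        have : N ^ 2 * (N + M + 1) - (N + M) * N ^ 2 = N ^ 2 := by ring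
        rw [this]
        have h0 : 0 < N + M := by positivity
        nlinarith [mul_pos (sq_pos_of_pos hN) h0, mul_pos (sq_pos_of_pos hN) (mul_pos h0 h0)]
      push_cast
      have e3 : N + ((M : ℝ) + 1) = N + M + 1 := by ring
      rw [e3]
      linarith
  refine this.trans ?_
  have : 0 ≤ N ^ 2 / (N + M) := by positivity
  linarith

lemma sum_weight_twelve (M : ℤ) :
    ∑ z ∈ Finset.Icc (-M) M, ((1 + |(z : ℝ)| / 1) ^ 12)⁻¹ ≤ 1 + 1 / 512 := by
  have h2 := sum_weight_two (N := 1) one_pos M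
  have : ∀ z : ℤ, ((1 + |(z : ℝ)| / 1) ^ 12)⁻¹ ≤
      (1 / 1024) * ((1 + |(z : ℝ)| / 1) ^ 2)⁻¹ + (if z = 0 then 1 - 1 / 1024 else 0) := by
    intro z
    split_ifs with h
    · subst h; simp
    · have h1 : (1 : ℝ) ≤ |(z : ℝ)| := by exact_mod_cast Int.one_le_abs h
      rw [add_zero, div_one, ← one_div, ← one_div, div_mul_div_comm, mul_one]
      apply one_div_le_one_div_of_le (by positivity)
      have : (1 + |(z : ℝ)|) ^ 12 = (1 + |(z : ℝ)|) ^ 10 * (1 + |(z : ℝ)|) ^ 2 := by ring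
      rw [this]
      gcongr
      calc (1024 : ℝ) = 2 ^ 10 := by norm_num
        _ ≤ _ := by gcongr; linarith
  refine (Finset.sum_le_sum fun z _ => this z).trans ?_
  rw [Finset.sum_add_distrib, ← Finset.mul_sum]
  have h3 : ∑ z ∈ Finset.Icc (-M) M, (if z = 0 then (1 - 1 / 1024 : ℝ) else 0) ≤ 1 - 1 / 1024 := by
    rw [Finset.sum_ite_eq']
    split_ifs <;> norm_num
  linarith

lemma tensor {p : ℝ} {n : ℕ} {ι : Type} [Fintype ι] [DecidableEq ι] (h0 : 0 ≤ p) (h1 : p ≤ 1)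
    (S : (ι → Fin n → Bool) → Prop) {c : ℝ} (hc : 0 ≤ c) (f : ι → (Fin n → Bool) → ℝ)
    (hf : ∀ i X, 0 ≤ f i X) (h : ∀ Q, S Q → 1 ≤ c * ∏ i, f i (Q i)) :
    Pr (matW p) S ≤ c * ∏ i, Ex (rowW p) (f i) := by
  have e : c * ∏ i, Ex (rowW p) (f i) = Ex (matW p) (fun Q : ι → Fin n → Bool => c * ∏ i, f i (Q i)) := by
    rw [Ex_smul]; unfold matW; rw [Ex_pw_prod]
  rw [e]
  exact Pr_le_Ex (matW_nonneg h0 h1) (fun Q => mul_nonneg hc (Finset.prod_nonneg fun i _ => hf _ _)) h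

/-- The structured-vector event. -/
def NetBad {ι : Type} [Fintype ι] (p : ℝ) {n : ℕ} (Q : ι → Fin n → Bool) : Prop :=
  ∃ z : Fin n → ℤ, ∃ l : ℤ, |l| ≤ (n : ℤ) ^ 4 ∧ ∑ j, Real.log (1 + |(z j : ℝ)| / 1) ≤ n / 1000 ∧
    (∃ m : ℕ, 1 ≤ m * p ∧
      m ≤ (univ.filter fun j => 200 * Real.sqrt (n / m) ≤ |(l : ℝ) / n ^ 2 + z j|).card) ∧
    ∑ i, (dot (Q i) (fun j => (l : ℝ) / n ^ 2 + z j)) ^ 2 ≤ 50 * n * (p * n)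

lemma card_zset_one (n : ℕ) : ((zset n 1 (n / 1000)).card : ℝ) ≤ Real.exp (n / 50) := by
  have h := zset_sum_le (n := n) (N := 1) (A := n / 1000) one_pos 12 (fun _ => 1) (fun _ => zero_le_one)
  simp only [prod_const_one, sum_const, nsmul_eq_mul, mul_one, one_mul] at h
  refine h.trans ?_
  have h2 : (∑ z ∈ Finset.Icc (-⌈Real.exp ((n : ℝ) / 1000)⌉) ⌈Real.exp ((n : ℝ) / 1000)⌉,
      ((1 + |(z : ℝ)| / 1) ^ 12)⁻¹) ^ n ≤ Real.exp (n * (1 / 512)) := by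
    rw [Real.exp_nat_mul]
    refine pow_le_pow_left₀ (Finset.sum_nonneg fun z _ => by positivity) ?_ _
    refine (sum_weight_twelve _).trans ?_
    have := Real.add_one_le_exp (1 / 512 : ℝ)
    linarith
  refine (mul_le_mul_of_nonneg_left h2 (Real.exp_pos _).le).trans ?_
  rw [← Real.exp_add, Real.exp_le_exp]
  push_cast
  have : (0 : ℝ) ≤ n := by positivity
  nlinarith

lemma net_prob {p : ℝ} {n : ℕ} {ι : Type} [Fintype ι] [DecidableEq ι] (hι : Fintype.card ι + 1 = n)
    (h0 : 0 < p) (h1 : p ≤ 1 / 2) :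
    Pr (matW p) (fun Q : ι → Fin n → Bool => NetBad p Q) ≤ 4 * n ^ 4 * Real.exp (-(n / 50)) := by
  classical
  have hn : 1 ≤ n := by omega
  have hn1 : (1 : ℝ) ≤ n := by exact_mod_cast hn
  set Zs := zset n 1 (n / 1000) ×ˢ Finset.Icc (-((n : ℤ) ^ 4)) ((n : ℤ) ^ 4) with hZs
  have h2 : p ≤ 1 := by linarith
  have hmono : Pr (matW p) (fun Q : ι → Fin n → Bool => NetBad p Q) ≤
      Pr (matW p) (fun Q : ι → Fin n → Bool => ∃ zl ∈ Zs,
        ((∃ m : ℕ, 1 ≤ m * p ∧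
      m ≤ (univ.filter fun j => 200 * Real.sqrt (n / m) ≤ |(zl.2 : ℝ) / n ^ 2 + zl.1 j|).card) ∧
    ∑ i, (dot (Q i) (fun j => (zl.2 : ℝ) / n ^ 2 + zl.1 j)) ^ 2 ≤ 50 * n * (p * n))) := by
    refine Pr_mono (matW_nonneg h0.le h2) fun Q hQ => ?_
    obtain ⟨z, l, hl, hz, hm, hs⟩ := hQ
    refine ⟨(z, l), ?_, hm, hs⟩
    rw [hZs, mem_product, mem_zset one_pos, mem_Icc]
    exact ⟨hz, abs_le.1 hl⟩
  refine hmono.trans ?_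
  have hc : 0 ≤ Real.exp (n / 1600) * (15 / 16) ^ (n - 1) := by positivity
  refine (Pr_exists_le_card (matW_nonneg h0.le h2) Zs _ (c := Real.exp (n / 1600) * (15 / 16) ^ (n - 1)) ?_).trans ?_
  · rintro ⟨z, l⟩ _
    by_cases hm : ∃ m : ℕ, 1 ≤ m * p ∧
      m ≤ (univ.filter fun j => 200 * Real.sqrt (n / m) ≤ |(l : ℝ) / n ^ 2 + z j|).card
    · obtain ⟨m, hm1, hm2⟩ := id hm
      have hrf := row_functional h0 h1 hm1 (fun j => (l : ℝ) / n ^ 2 + z j) hm2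
      refine (tensor h0.le h2 _ (Real.exp_pos (n / 1600)).le
        (fun _ X => Real.exp (-((dot X (fun j => (l : ℝ) / n ^ 2 + z j)) ^ 2 / (80000 * (p * n)))))
        (fun _ _ => (Real.exp_pos _).le) ?_).trans ?_
      · rintro Q ⟨_, hs⟩
        rw [← Real.exp_sum, ← Real.exp_add]
        apply Real.one_le_exp
        rw [Finset.sum_neg_distrib, ← Finset.sum_div]
        have : (∑ i, (dot (Q i) (fun j => (l : ℝ) / n ^ 2 + z j)) ^ 2) / (80000 * (p * n)) ≤ n / 1600 := by
          rw [div_le_iff₀ (by positivity)]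
          nlinarith
        linarith
      · refine mul_le_mul_of_nonneg_left ?_ (Real.exp_pos _).le
        rw [Finset.prod_const, card_univ]
        have : Fintype.card ι = n - 1 := by omega
        rw [this]
        exact pow_le_pow_left₀ (Ex_nonneg (rowW_nonneg h0.le h2) fun _ => (Real.exp_pos _).le) hrf _
    · refine le_trans (le_of_eq ?_) hc
      unfold Pr
      refine Finset.sum_eq_zero fun Q _ => ?_
      rw [ind_false (fun h => hm h.1), mul_zero]
  · have hcard : (Zs.card : ℝ) ≤ Real.exp (n / 50) * (3 * n ^ 4) := by
      rw [hZs, card_product]; push_cast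
      refine mul_le_mul (card_zset_one n) ?_ (by positivity) (Real.exp_pos _).le
      have : ((Finset.Icc (-((n : ℤ) ^ 4)) ((n : ℤ) ^ 4)).card : ℤ) = 2 * (n : ℤ) ^ 4 + 1 := by
        rw [Int.card_Icc]
        have : (0 : ℤ) ≤ (n : ℤ) ^ 4 := by positivity
        rw [Int.toNat_of_nonneg (by linarith)]; ring
      have h5 : ((Finset.Icc (-((n : ℤ) ^ 4)) ((n : ℤ) ^ 4)).card : ℝ) = 2 * (n : ℝ) ^ 4 + 1 := by exact_mod_cast this
      rw [h5]
      have : (1 : ℝ) ≤ (n : ℝ) ^ 4 := one_le_pow₀ hn1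
      linarith
    have hpow : ((15 / 16 : ℝ)) ^ (n - 1) ≤ (16 / 15) * Real.exp (-(n / 16)) := by
      have e : (n : ℝ) = ((n - 1 : ℕ) : ℝ) + 1 := by push_cast [Nat.cast_sub hn]; ring
      have h6 : (15 / 16 : ℝ) ≤ Real.exp (-(1 / 16)) := by
        have := Real.add_one_le_exp (-(1 / 16) : ℝ); linarith
      have h7 : (1 : ℝ) ≤ 16 / 15 * Real.exp (-(1 / 16)) := by linarith
      have h8 : Real.exp (-((n : ℝ) / 16)) = Real.exp (-(1 / 16)) ^ (n - 1) * Real.exp (-(1 / 16)) := by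
        rw [← Real.exp_nat_mul, ← Real.exp_add]; congr 1; rw [e]; push_cast [Nat.cast_sub hn]; ring
      rw [h8]
      calc (15 / 16 : ℝ) ^ (n - 1) ≤ Real.exp (-(1 / 16)) ^ (n - 1) := pow_le_pow_left₀ (by norm_num) h6 _
        _ ≤ Real.exp (-(1 / 16)) ^ (n - 1) * (16 / 15 * Real.exp (-(1 / 16))) := le_mul_of_one_le_right (by positivity) h7
        _ = _ := by ring
    calc (Zs.card : ℝ) * (Real.exp (n / 1600) * (15 / 16) ^ (n - 1))
        ≤ (Real.exp (n / 50) * (3 * n ^ 4)) * (Real.exp (n / 1600) * ((16 / 15) * Real.exp (-(n / 16)))) := by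
          gcongr
      _ = 16 / 5 * n ^ 4 * (Real.exp (n / 50) * Real.exp (n / 1600) * Real.exp (-(n / 16))) := by ring
      _ ≤ 4 * n ^ 4 * Real.exp (-(n / 50)) := by
          rw [← Real.exp_add, ← Real.exp_add]
          gcongr
          · norm_num
          · linarith
end SB

set_option linter.all false
namespace SB
open Finset

lemma sum_logplus (n : ℕ) {M : ℝ} (hM : 0 ≤ M) :
    ∑ m ∈ range n, max 0 (Real.log (M / ((m : ℝ) + 1))) ≤ M := by
  have h1 : ∑ m ∈ range n, max 0 (Real.log (M / ((m : ℝ) + 1))) ≤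
      ∑ m ∈ range ⌊M⌋₊, Real.log (M / ((m : ℝ) + 1)) := by
    calc _ = ∑ m ∈ (range n).filter (fun m => m < ⌊M⌋₊), max 0 (Real.log (M / ((m : ℝ) + 1))) := by
          rw [Finset.sum_filter]
          refine Finset.sum_congr rfl fun m _ => ?_
          split_ifs with h
          · rfl
          · rw [max_eq_left]
            have : M < m + 1 := by
              have := Nat.lt_floor_add_one M
              push Not at h
              have h' : (⌊M⌋₊ : ℝ) ≤ m := by exact_mod_cast h
              linarith
            exact Real.log_nonpos (by positivity) (by rw [div_le_one (by positivity)]; linarith)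
      _ = ∑ m ∈ (range n).filter (fun m => m < ⌊M⌋₊), Real.log (M / ((m : ℝ) + 1)) := by
          refine Finset.sum_congr rfl fun m hm => ?_
          have h := (mem_filter.1 hm).2
          rw [max_eq_right]
          have h2 : ((m + 1 : ℕ) : ℝ) ≤ M := (Nat.le_floor_iff hM).1 h
          push_cast at h2
          exact Real.log_nonneg (by rw [le_div_iff₀ (by positivity)]; linarith)
      _ ≤ _ := by
          refine Finset.sum_le_sum_of_subset_of_nonneg (fun m hm => mem_range.2 (mem_filter.1 hm).2) ?_
          intro m hm _
          have h2 : ((m + 1 : ℕ) : ℝ) ≤ M := (Nat.le_floor_iff hM).1 (mem_range.1 hm)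
          push_cast at h2
          exact Real.log_nonneg (by rw [le_div_iff₀ (by positivity)]; linarith)
  refine h1.trans ?_
  rcases hM.eq_or_lt with h | h
  · rw [← h]; simp
  have h2 : ∀ k : ℕ, ∑ m ∈ range k, Real.log (M / ((m : ℝ) + 1)) = Real.log (M ^ k / k.factorial) := by
    intro k
    induction k with
    | zero => simp
    | succ k ih =>
      rw [sum_range_succ, ih, ← Real.log_mul (by positivity) (by positivity), Nat.factorial_succ]
      congr 1; push_cast; field_simp; ring
  rw [h2, Real.log_le_iff_le_exp (by positivity)]
  exact Real.pow_div_factorial_le_exp M hM _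

lemma exists_sort {n : ℕ} (f : Fin n → ℝ) : ∃ e : Equiv.Perm (Fin n), Antitone (fun i => f (e i)) := by
  refine ⟨Tuple.sort (fun j => - f j), fun i j hij => ?_⟩
  have := Tuple.monotone_sort (fun j => - f j) hij
  simp only [Function.comp] at this
  linarith

lemma exists_median {n : ℕ} (hn : 0 < n) (u : Fin n → ℝ) :
    ∃ lam, n ≤ 2 * (univ.filter fun j => u j ≤ lam).card ∧ n ≤ 2 * (univ.filter fun j => lam ≤ u j).card := by
  obtain ⟨e, he⟩ := exists_sort u
  have h : n / 2 < n := by omega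
  refine ⟨u (e ⟨n / 2, h⟩), ?_, ?_⟩
  · have : ((univ.filter fun i : Fin n => n / 2 ≤ i.val).map e.toEmbedding) ⊆
        univ.filter fun j => u j ≤ u (e ⟨n / 2, h⟩) := by
      intro j hj
      obtain ⟨i, hi, rfl⟩ := mem_map.1 hj
      have := (mem_filter.1 hi).2
      exact mem_filter.2 ⟨mem_univ _, he (show (⟨n / 2, h⟩ : Fin n) ≤ i from this)⟩
    have h2 := card_le_card this
    rw [card_map] at h2
    have h3 : (univ.filter fun i : Fin n => n / 2 ≤ i.val).card = n - n / 2 := by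
      have := Fin.card_Ici (⟨n / 2, h⟩ : Fin n)
      rw [← this]; congr 1; ext i; simp [Fin.le_def]
    omega
  · have : ((univ.filter fun i : Fin n => i.val ≤ n / 2).map e.toEmbedding) ⊆
        univ.filter fun j => u (e ⟨n / 2, h⟩) ≤ u j := by
      intro j hj
      obtain ⟨i, hi, rfl⟩ := mem_map.1 hj
      have := (mem_filter.1 hi).2
      exact mem_filter.2 ⟨mem_univ _, he (show i ≤ (⟨n / 2, h⟩ : Fin n) from this)⟩
    have h2 := card_le_card this
    rw [card_map] at h2
    have h3 : (univ.filter fun i : Fin n => i.val ≤ n / 2).card = n / 2 + 1 := by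
      have := Fin.card_Iic (⟨n / 2, h⟩ : Fin n)
      rw [← this]; congr 1; ext i; simp [Fin.le_def]
    omega

/-- m-th largest value (1-indexed) along the sorting permutation. -/
noncomputable def UU {n : ℕ} (u : Fin n → ℝ) (e : Equiv.Perm (Fin n)) (m : ℕ) : ℝ :=
  if h : m - 1 < n then |u (e ⟨m - 1, h⟩)| else 0

section prof
variable {n : ℕ} {u : Fin n → ℝ} {e : Equiv.Perm (Fin n)}

lemma UU_nonneg (m : ℕ) : 0 ≤ UU u e m := by
  unfold UU; split_ifs <;> positivity

lemma UU_anti (he : Antitone (fun i => |u (e i)|)) : Antitone (UU u e) := by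
  intro m m' h
  unfold UU
  split_ifs with h1 h2
  · exact he (show (⟨m - 1, h2⟩ : Fin n) ≤ ⟨m' - 1, h1⟩ from (by show m - 1 ≤ m' - 1; omega))
  · omega
  · positivity
  · exact le_rfl

lemma UU_eq (i : Fin n) : UU u e (i.val + 1) = |u (e i)| := by
  unfold UU; simp

lemma med_le_UU (he : Antitone (fun i => |u (e i)|)) {lam : ℝ}
    (h1 : n ≤ 2 * (univ.filter fun j => u j ≤ lam).card) (h2 : n ≤ 2 * (univ.filter fun j => lam ≤ u j).card)
    {m : ℕ} (hm : 1 ≤ m) (hmn : 2 * m ≤ n) : |lam| ≤ UU u e m := by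
  by_contra hcon
  push Not at hcon
  have hc : n ≤ 2 * (univ.filter fun j => |lam| ≤ |u j|).card := by
    rcases le_or_gt 0 lam with h | h
    · refine h2.trans (Nat.mul_le_mul_left 2 (card_le_card fun j hj => ?_))
      have := (mem_filter.1 hj).2
      refine mem_filter.2 ⟨mem_univ _, ?_⟩
      rw [abs_of_nonneg h, abs_of_nonneg (h.trans this)]; exact this
    · refine h1.trans (Nat.mul_le_mul_left 2 (card_le_card fun j hj => ?_))
      have := (mem_filter.1 hj).2
      refine mem_filter.2 ⟨mem_univ _, ?_⟩
      rw [abs_of_neg h, abs_of_neg (this.trans_lt h)]; linarith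
  have hsub : (univ.filter fun j => |lam| ≤ |u j|) ⊆
      ((univ.filter fun i : Fin n => i.val < m - 1).map e.toEmbedding) := by
    intro j hj
    have h3 := (mem_filter.1 hj).2
    refine mem_map.2 ⟨e.symm j, mem_filter.2 ⟨mem_univ _, ?_⟩, by simp⟩
    by_contra h4
    push Not at h4
    have h5 := UU_anti (u := u) he (show m ≤ (e.symm j).val + 1 by omega)
    rw [UU_eq] at h5
    simp at h5
    linarith
  have h6 := card_le_card hsub
  rw [card_map] at h6
  have h7 : (univ.filter fun i : Fin n => i.val < m - 1).card ≤ m - 1 := by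
    have : (univ.filter fun i : Fin n => i.val < m - 1).card = (range (m-1)).card := by
      have hb : m - 1 < n := by omega
      have := Fin.card_Iio (⟨m - 1, hb⟩ : Fin n)
      rw [card_range]; refine Eq.trans ?_ this; congr 1; ext i; simp [Fin.lt_def]
    rw [this, card_range]
  omega

variable {ι : Type} {p : ℝ} {Q : ι → Fin n → Bool}

lemma ker_bound (X : Fin n → Bool) (hX : dot X u = 0) (j0 : Fin n) (hj0 : X j0 = true) {c : ℝ} (hc0 : 0 ≤ c)
    (hc : ∀ j, j ≠ j0 → X j = true → |u j| ≤ c) : |u j0| ≤ n * c := by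
  unfold dot at hX
  rw [← Finset.add_sum_erase _ _ (mem_univ j0), if_pos hj0] at hX
  have : u j0 = -∑ j ∈ univ.erase j0, (if X j = true then u j else 0) := by linarith
  rw [this, abs_neg]
  refine (Finset.abs_sum_le_sum_abs _ _).trans ?_
  calc _ ≤ ∑ j ∈ univ.erase j0, c := by
        refine Finset.sum_le_sum fun j hj => ?_
        split_ifs with h
        · exact hc j (ne_of_mem_erase hj) h
        · simpa using hc0
    _ ≤ _ := by
        rw [Finset.sum_const, nsmul_eq_mul]
        gcongr
        exact (card_le_univ _).trans (by simp)

lemma expand_step (he : Antitone (fun i => |u (e i)|)) (hE : Expand p Q) (hcol : ∀ j, ∃ i, Q i j = true)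
    (hker : ∀ i, dot (Q i) u = 0) {m : ℕ} (hm : 1 ≤ m) (hmp : m * p ≤ 1) (hmn : 2 * m ≤ n) :
    UU u e m ≤ n * UU u e (2 * m) := by
  rcases Nat.lt_or_ge 1 m with h1 | h1
  · obtain ⟨i, a, ha, hq, hb⟩ := hE m h1 hmp hmn (fun a => e ⟨a.val, by omega⟩) (by
      intro a b hab
      have := e.injective hab
      simpa [Fin.ext_iff] using this)
    have hbd := ker_bound (Q i) (hker i) _ hq (UU_nonneg (u := u) (e := e) (2 * m)) (by
      intro j hj hjt
      have h3 : ¬ (e.symm j).val < 2 * m := by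
        intro hlt
        have := hb ⟨(e.symm j).val, hlt⟩ (by
          rintro rfl
          apply hj; simp)
        simp at this
        rw [this] at hjt; exact absurd hjt (by simp)
      have h5 := UU_anti (u := u) he (show 2 * m ≤ (e.symm j).val + 1 by omega)
      rw [UU_eq] at h5
      simpa using h5)
    refine le_trans ?_ hbd
    have h6 := UU_anti (u := u) he (show a.val + 1 ≤ m by omega)
    have h7 := UU_eq (u := u) (e := e) ⟨a.val, by omega⟩
    simp only [] at h7
    rw [h7] at h6
    exact h6
  · have : m = 1 := by omega
    subst this
    have hn : 0 < n := by omega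
    obtain ⟨i, hi⟩ := hcol (e ⟨0, hn⟩)
    have hbd := ker_bound (Q i) (hker i) _ hi (UU_nonneg (u := u) (e := e) (2 * 1)) (by
      intro j hj hjt
      have h3 : (e.symm j).val ≠ 0 := by
        intro h0
        apply hj
        have : e.symm j = ⟨0, hn⟩ := Fin.ext h0
        rw [← this]; simp
      have h5 := UU_anti (u := u) he (show 2 * 1 ≤ (e.symm j).val + 1 by omega)
      rw [UU_eq] at h5
      simpa using h5)
    have h7 := UU_eq (u := u) (e := e) ⟨0, hn⟩
    simp only [zero_add] at h7
    rw [h7]; exact hbd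

lemma expand_chain (he : Antitone (fun i => |u (e i)|)) (hE : Expand p Q) (hcol : ∀ j, ∃ i, Q i j = true)
    (hker : ∀ i, dot (Q i) u = 0) (hp : 0 < p) {m1 : ℕ} (hm1 : ((m1 : ℝ) - 1) * p ≤ 1) (hmn : 2 * m1 ≤ n)
    {b : ℝ} (hb0 : 0 ≤ b) (hb : (n : ℝ) = 2 ^ b) :
    ∀ k m : ℕ, 1 ≤ m → m ≤ m1 → m1 ≤ m + k → UU u e m ≤ (2 * m1 / m : ℝ) ^ b * UU u e m1 := by
  intro k
  induction k using Nat.strong_induction_on with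
  | _ k ih =>
    intro m h1 h2 h3
    have hm0 : (0 : ℝ) < m := by exact_mod_cast h1
    have hmm : (m : ℝ) ≤ m1 := by exact_mod_cast h2
    rcases h2.eq_or_lt with h | h
    · subst h
      have : (2 * m / m : ℝ) = 2 := by field_simp
      rw [this]
      exact le_mul_of_one_le_left (UU_nonneg _) (Real.one_le_rpow (by norm_num) hb0)
    · have hlt : (m : ℝ) ≤ m1 - 1 := by
        have : m + 1 ≤ m1 := h
        have : (m : ℝ) + 1 ≤ m1 := by exact_mod_cast this
        linarith
      have hst := expand_step he hE hcol hker h1 (le_trans (by gcongr) hm1) (by omega)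
      rw [hb] at hst
      rcases Nat.lt_or_ge (2 * m) m1 with h4 | h4
      · have h5 := ih (m1 - 2 * m) (by omega) (2 * m) (by omega) h4.le (by omega)
        refine hst.trans ?_
        have : (2 * m1 / m : ℝ) = 2 * (2 * m1 / ((2 * m : ℕ) : ℝ)) := by push_cast; field_simp
        rw [this, Real.mul_rpow (by norm_num) (by positivity), mul_assoc]
        gcongr
      · refine hst.trans ?_
        have h5 := UU_anti (u := u) he h4
        have h6 : (2 : ℝ) ^ b ≤ (2 * m1 / m : ℝ) ^ b := by
          apply Real.rpow_le_rpow (by norm_num) _ hb0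
          rw [le_div_iff₀ hm0]; linarith
        exact mul_le_mul h6 h5 (UU_nonneg _) (by positivity)

end prof
end SB

set_option linter.all false
namespace SB
open Finset

lemma exists_le_of_Ex {α : Type*} [Fintype α] {w : α → ℝ} (hw : ∀ a, 0 ≤ w a) (h1 : ∑ a, w a = 1) {f : α → ℝ} {c : ℝ}
    (h : Ex w f ≤ c) : ∃ a, f a ≤ c := by
  obtain ⟨a, ha⟩ := exists_ge_of_Ex hw h1 (f := fun a => (-1) * f a) (c := -c) (by rw [Ex_smul]; linarith)
  exact ⟨a, by linarith⟩

lemma sum_cnt_le {ι : Type} [Fintype ι] {n : ℕ} (hι : Fintype.card ι + 1 = n) {d : ℝ} (hd : 1 ≤ d)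
    {Q : ι → Fin n → Bool} (hQ : ¬ TwoIrr d Q) : ∑ i, (cnt (Q i) : ℝ) ≤ 11 * n * d := by
  classical
  have hc : (Fintype.card ι : ℝ) + 1 = n := by exact_mod_cast hι
  have hcn : ∀ i, (cnt (Q i) : ℝ) ≤ n := fun i => by
    have : cnt (Q i) ≤ n := (card_le_univ _).trans (by simp)
    exact_mod_cast this
  by_cases h : ∃ i, ¬ Reg d (Q i)
  · obtain ⟨i, hi⟩ := h
    have : ∀ j ∈ univ.erase i, (cnt (Q j) : ℝ) ≤ 10 * d := by
      intro j hj
      by_contra hcon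
      exact hQ ⟨i, j, (ne_of_mem_erase hj).symm, hi, fun hr => hcon hr.2⟩
    rw [← Finset.add_sum_erase _ _ (mem_univ i)]
    have h2 := Finset.sum_le_card_nsmul _ _ _ this
    rw [nsmul_eq_mul] at h2
    have h3 : ((univ.erase i).card : ℝ) ≤ n := by
      have : (univ.erase i).card ≤ Fintype.card ι := card_le_univ _
      have : ((univ.erase i).card : ℝ) ≤ Fintype.card ι := by exact_mod_cast this
      linarith
    have h4 := hcn i
    have h5 : ((univ.erase i).card : ℝ) * (10 * d) ≤ n * (10 * d) := by gcongr
    have : (0 : ℝ) ≤ n := by positivity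
    nlinarith
  · push Not at h
    have h2 := Finset.sum_le_card_nsmul univ (fun i => (cnt (Q i) : ℝ)) (10 * d) (fun i _ => (h i).2)
    rw [nsmul_eq_mul, card_univ] at h2
    have : (0 : ℝ) ≤ n := by positivity
    nlinarith

/-- Randomized rounding with all properties. -/
lemma rounding {ι : Type} [Fintype ι] {n : ℕ} (hι : Fintype.card ι + 1 = n) {d : ℝ} (hd : 1 ≤ d)
    {Q : ι → Fin n → Bool} (hQ : ¬ TwoIrr d Q) (v : Fin n → ℝ) {N A : ℝ} (hN : 0 < N) (hA : 0 < A)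
    (hv : ∑ j, Real.log (1 + |v j| / N) ≤ A / 8) (F : (Fin n → ℤ) → ℝ) (hF0 : ∀ z, 0 ≤ F z)
    (hF : Ex (rdW v) (fun b => F (rz v b)) ≤ 1 / 2) :
    ∃ z : Fin n → ℤ, (∀ j, |(z j : ℝ) - v j| ≤ 1) ∧
      ∑ i, (dot (Q i) (fun j => (z j : ℝ) - v j)) ^ 2 ≤ 22 * n * d ∧
      ∑ j, Real.log (1 + |(z j : ℝ)| / N) ≤ A ∧ F z < 1 := by
  have hn : (1 : ℝ) ≤ n := by
    have : 1 ≤ n := by omega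
    exact_mod_cast this
  have h1 : Ex (rdW v) (fun b => ((22 * n * d)⁻¹ * ∑ i, (dot (Q i) (fun j => (rz v b j : ℝ) - v j)) ^ 2 +
      A⁻¹ * ∑ j, Real.log (1 + |(rz v b j : ℝ)| / N)) + F (rz v b)) ≤ 3 / 4 := by
    rw [Ex_add, Ex_add, Ex_smul, Ex_smul, Ex_sum, Ex_sum]
    have a1 : ∑ i, Ex (rdW v) (fun b => (dot (Q i) (fun j => (rz v b j : ℝ) - v j)) ^ 2) ≤ 11 * n * d / 4 := by
      refine (Finset.sum_le_sum fun i _ => round_var v (Q i)).trans ?_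
      rw [← Finset.sum_div]
      have := sum_cnt_le hι hd hQ
      linarith
    have a2 : ∑ j, Ex (rdW v) (fun b => Real.log (1 + |(rz v b j : ℝ)| / N)) ≤ A / 8 :=
      (Finset.sum_le_sum fun j _ => round_log v hN j).trans hv
    have b1 : (22 * n * d)⁻¹ * ∑ i, Ex (rdW v) (fun b => (dot (Q i) (fun j => (rz v b j : ℝ) - v j)) ^ 2) ≤ 1 / 8 := by
      rw [inv_mul_le_iff₀ (by positivity)]; linarith
    have b2 : A⁻¹ * ∑ j, Ex (rdW v) (fun b => Real.log (1 + |(rz v b j : ℝ)| / N)) ≤ 1 / 8 := by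
      rw [inv_mul_le_iff₀ (by positivity)]; linarith
    linarith
  obtain ⟨b, hb⟩ := exists_le_of_Ex (rdW_nonneg v) (rdW_sum v) h1
  have c1 : 0 ≤ (22 * n * d)⁻¹ * ∑ i, (dot (Q i) (fun j => (rz v b j : ℝ) - v j)) ^ 2 :=
    mul_nonneg (by positivity) (Finset.sum_nonneg fun i _ => sq_nonneg _)
  have c2 : 0 ≤ A⁻¹ * ∑ j, Real.log (1 + |(rz v b j : ℝ)| / N) :=
    mul_nonneg (by positivity) (Finset.sum_nonneg fun i _ => log_term_nonneg _ hN)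
  have c3 := hF0 (rz v b)
  refine ⟨rz v b, rz_close v b, ?_, ?_, by linarith⟩
  · have : (22 * n * d)⁻¹ * ∑ i, (dot (Q i) (fun j => (rz v b j : ℝ) - v j)) ^ 2 ≤ 1 := by linarith
    rwa [inv_mul_le_iff₀ (by positivity), mul_one] at this
  · have : A⁻¹ * ∑ j, Real.log (1 + |(rz v b j : ℝ)| / N) ≤ 1 := by linarith
    rwa [inv_mul_le_iff₀ (by positivity), mul_one] at this

lemma dot_add {n : ℕ} (X : Fin n → Bool) (a b : Fin n → ℝ) : dot X (fun j => a j + b j) = dot X a + dot X b := by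
  simp only [dot_eq, Finset.sum_add_distrib]

lemma dot_smul {n : ℕ} (X : Fin n → Bool) (c : ℝ) (b : Fin n → ℝ) : dot X (fun j => c * b j) = c * dot X b := by
  simp only [dot_eq, Finset.mul_sum]

lemma dot_const {n : ℕ} (X : Fin n → Bool) (c : ℝ) : dot X (fun _ => c) = cnt X * c := by
  simp [dot_eq, cnt]

/-- Passing from a rounded kernel vector to an integer vector plus an affine shift. -/
lemma shift_bound {ι : Type} [Fintype ι] {n : ℕ} (hι : Fintype.card ι + 1 = n) {d : ℝ} (hd : 1 ≤ d)
    {Q : ι → Fin n → Bool} {u : Fin n → ℝ} (hker : ∀ i, dot (Q i) u = 0) {τ lam : ℝ} (v : Fin n → ℝ)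
    (hv : ∀ j, v j = τ * (u j - lam)) (z : Fin n → ℤ)
    (hz : ∑ i, (dot (Q i) (fun j => (z j : ℝ) - v j)) ^ 2 ≤ 22 * n * d) :
    ∑ i, (dot (Q i) (fun j => (⌊n ^ 2 * (τ * lam)⌋ : ℝ) / n ^ 2 + z j)) ^ 2 ≤ 50 * n * d ∧
      |(⌊n ^ 2 * (τ * lam)⌋ : ℝ) / n ^ 2 - τ * lam| ≤ 1 / n ^ 2 := by
  have hn : (1 : ℝ) ≤ n := by
    have : 1 ≤ n := by omega
    exact_mod_cast this
  have hδ : |(⌊n ^ 2 * (τ * lam)⌋ : ℝ) / n ^ 2 - τ * lam| ≤ 1 / n ^ 2 := by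
    have h1 := Int.floor_le ((n : ℝ) ^ 2 * (τ * lam))
    have h2 := Int.lt_floor_add_one ((n : ℝ) ^ 2 * (τ * lam))
    have : (⌊(n : ℝ) ^ 2 * (τ * lam)⌋ : ℝ) / n ^ 2 - τ * lam = (⌊(n : ℝ) ^ 2 * (τ * lam)⌋ - n ^ 2 * (τ * lam)) / n ^ 2 := by
      field_simp
    rw [this, abs_div, abs_of_pos (show (0 : ℝ) < (n : ℝ) ^ 2 by positivity)]
    gcongr
    rw [abs_le]; constructor <;> linarith
  refine ⟨?_, hδ⟩
  set δ := (⌊n ^ 2 * (τ * lam)⌋ : ℝ) / n ^ 2 - τ * lam with hδd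
  have hrow : ∀ i, (dot (Q i) (fun j => (⌊n ^ 2 * (τ * lam)⌋ : ℝ) / n ^ 2 + z j)) ^ 2 ≤
      2 * (dot (Q i) (fun j => (z j : ℝ) - v j)) ^ 2 + 2 / n := by
    intro i
    have e : (fun j => (⌊n ^ 2 * (τ * lam)⌋ : ℝ) / n ^ 2 + z j) =
        fun j => (δ + τ * u j) + ((z j : ℝ) - v j) := by
      ext j; rw [hv, hδd]; ring
    rw [e, dot_add (Q i) (fun j => δ + τ * u j) (fun j => (z j : ℝ) - v j), dot_add (Q i) (fun _ => δ) (fun j => τ * u j),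
      dot_smul, dot_const, hker, mul_zero, add_zero]
    have hcn : (cnt (Q i) : ℝ) ≤ n := by
      have : cnt (Q i) ≤ n := (card_le_univ _).trans (by simp)
      exact_mod_cast this
    have h2 : (cnt (Q i) * δ) ^ 2 ≤ 1 / n := by
      rw [← sq_abs, abs_mul, abs_of_nonneg (show (0 : ℝ) ≤ cnt (Q i) by positivity)]
      have : (cnt (Q i) : ℝ) * |δ| ≤ n * (1 / n ^ 2) := by gcongr
      calc _ ≤ ((n : ℝ) * (1 / n ^ 2)) ^ 2 := by gcongr
        _ = 1 / n * (1 / n) := by field_simp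
        _ ≤ 1 / n * 1 := by gcongr; rw [div_le_one (by positivity)]; exact hn
        _ = _ := by ring
    have h3 : (2 : ℝ) / n = 2 * (1 / n) := by ring
    rw [h3]
    nlinarith [sq_nonneg (cnt (Q i) * δ - dot (Q i) (fun j => (z j : ℝ) - v j))]
  refine (Finset.sum_le_sum fun i _ => hrow i).trans ?_
  rw [Finset.sum_add_distrib, ← Finset.mul_sum, Finset.sum_const, nsmul_eq_mul, card_univ]
  have hc : (Fintype.card ι : ℝ) ≤ n := by
    have : Fintype.card ι ≤ n := by omega
    exact_mod_cast this
  have : (Fintype.card ι : ℝ) * (2 / n) ≤ n * (2 / n) := by gcongr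
  have h4 : (n : ℝ) * (2 / n) = 2 := by field_simp
  nlinarith

end SB

set_option linter.all false
namespace SB
open Finset

/-- Profile of a kernel vector. -/
structure Prof {n : ℕ} (u : Fin n → ℝ) (σ lam : ℝ) : Prop where
  pos : 0 < σ
  psi : ∑ j, Real.log (1 + |u j - lam| / σ) ≤ 10 * n
  spread : (n : ℝ) / 1000000 ≤ (univ.filter fun j => σ / 16000 < |u j - lam|).card
  med1 : n ≤ 2 * (univ.filter fun j => u j ≤ lam).card
  med2 : n ≤ 2 * (univ.filter fun j => lam ≤ u j).card
  lam_le : |lam| ≤ 800 * σ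
  norm_le : eNorm u ≤ Real.exp (1.5 * (Real.log (2 * n)) ^ 2) * σ

section
variable {n : ℕ} {u : Fin n → ℝ} {e : Equiv.Perm (Fin n)}

lemma rank_bound (he : Antitone (fun i => |u (e i)|)) {m1 : ℕ} (hm1 : 1 ≤ m1) (hm1n : 2 * m1 ≤ n) {b σ : ℝ} (hb0 : 0 ≤ b)
    (hσ0 : 0 < σ)
    (hch : ∀ m : ℕ, 1 ≤ m → m ≤ m1 → UU u e m ≤ (2 * m1 / m : ℝ) ^ b * UU u e m1)
    (hσ : ∀ m : ℕ, m1 ≤ m → 2 * m ≤ n → UU u e m ≤ 400 * Real.sqrt (n / m) * σ)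
    (m : ℕ) (h1 : 1 ≤ m) (h2 : m ≤ n) :
    UU u e m ≤ 800 * Real.exp (1 / 2 * Real.log (n / m) + b * max 0 (Real.log (2 * m1 / m))) * σ := by
  have hm0 : (0 : ℝ) < m := by exact_mod_cast h1
  have hn0 : (0 : ℝ) < n := by exact_mod_cast (by omega : 0 < n)
  have hsq : ∀ x : ℝ, 0 < x → Real.sqrt x = Real.exp (1 / 2 * Real.log x) := by
    intro x hx
    rw [Real.sqrt_eq_rpow, Real.rpow_def_of_pos hx]; congr 1; ring
  have hmn : (1 : ℝ) ≤ n / m := by rw [le_div_iff₀ hm0]; simpa using (by exact_mod_cast h2 : (m : ℝ) ≤ n)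
  have hlog : 0 ≤ Real.log ((n : ℝ) / m) := Real.log_nonneg hmn
  have hmax : 0 ≤ b * max 0 (Real.log (2 * m1 / m)) := mul_nonneg hb0 (le_max_left _ _)
  rcases le_or_gt m1 m with h | h
  · rcases le_or_gt (2 * m) n with h3 | h3
    · refine (hσ m h h3).trans ?_
      rw [hsq _ (by positivity)]
      gcongr
      · norm_num
      · linarith
    · have hA := hσ (n / 2) (by omega) (by omega)
      refine (UU_anti (u := u) he (show n / 2 ≤ m by omega)).trans (hA.trans ?_)
      have h4 : (n : ℝ) ≤ 4 * ((n / 2 : ℕ) : ℝ) := by exact_mod_cast (by omega : n ≤ 4 * (n / 2))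
      have h5 : (0 : ℝ) < ((n / 2 : ℕ) : ℝ) := by linarith
      have h6 : Real.sqrt (n / ((n / 2 : ℕ) : ℝ)) ≤ 2 := by
        rw [Real.sqrt_le_left (by norm_num), div_le_iff₀ h5]; linarith
      have h7 : 1 ≤ Real.exp (1 / 2 * Real.log (n / m) + b * max 0 (Real.log (2 * m1 / m))) :=
        Real.one_le_exp (by linarith)
      have : 400 * Real.sqrt (n / ((n / 2 : ℕ) : ℝ)) ≤ 800 * Real.exp (1 / 2 * Real.log (n / m) + b * max 0 (Real.log (2 * m1 / m))) := by
        linarith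
      gcongr
  · have hA := hσ m1 le_rfl hm1n
    have hmm : (m : ℝ) ≤ m1 := by exact_mod_cast h.le
    refine (hch m h1 h.le).trans ?_
    have h3 : (2 * m1 / m : ℝ) ^ b ≤ Real.exp (b * max 0 (Real.log (2 * m1 / m))) := by
      rw [Real.rpow_def_of_pos (by positivity), mul_comm]
      gcongr
      exact le_max_right _ _
    have h4 : Real.sqrt (n / m1) ≤ Real.exp (1 / 2 * Real.log (n / m)) := by
      rw [← hsq _ (by positivity)]
      exact Real.sqrt_le_sqrt (by gcongr)
    rw [Real.exp_add]
    calc _ ≤ Real.exp (b * max 0 (Real.log (2 * m1 / m))) * (400 * Real.exp (1 / 2 * Real.log (n / m)) * σ) := by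
          refine mul_le_mul h3 (hA.trans (by gcongr)) (UU_nonneg _) (Real.exp_pos _).le
      _ ≤ Real.exp (b * max 0 (Real.log (2 * m1 / m))) * (800 * Real.exp (1 / 2 * Real.log (n / m)) * σ) := by
          gcongr; norm_num
      _ = _ := by ring

lemma log1601 : Real.log 1601 ≤ 8 := by
  have h : Real.log 1601 ≤ Real.log (2 ^ 11) := Real.log_le_log (by norm_num) (by norm_num)
  rw [Real.log_pow] at h
  have := Real.log_two_lt_d9
  push_cast at h
  linarith

lemma psi_sum (hn : 1 ≤ n) {m1 : ℕ} {b σ lam : ℝ} (hb0 : 0 ≤ b) (hσ0 : 0 < σ) (hlam : |lam| ≤ 800 * σ)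
    (hr : ∀ m : ℕ, 1 ≤ m → m ≤ n →
      UU u e m ≤ 800 * Real.exp (1 / 2 * Real.log (n / m) + b * max 0 (Real.log (2 * m1 / m))) * σ)
    (B : Finset (Fin n)) {T : ℝ} (hT : 0 ≤ T) :
    ∑ j ∈ B, Real.log (1 + |u j - lam| / σ) ≤ B.card * (8 + T / 2) + 1 / 2 * (n * Real.exp (-T)) + b * (2 * m1) := by
  have hn0 : (0 : ℝ) < n := by exact_mod_cast hn
  let g : Fin n → ℝ := fun i => 1 / 2 * max 0 (Real.log (n * Real.exp (-T) / ((i.val : ℝ) + 1))) +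
    b * max 0 (Real.log (2 * m1 / ((i.val : ℝ) + 1)))
  have hg0 : ∀ i, 0 ≤ g i := fun i => add_nonneg (mul_nonneg (by norm_num) (le_max_left _ _)) (mul_nonneg hb0 (le_max_left _ _))
  have hterm : ∀ j, Real.log (1 + |u j - lam| / σ) ≤ (8 + T / 2) + g (e.symm j) := by
    intro j
    set i := e.symm j with hi
    have hu : |u j| = UU u e (i.val + 1) := by rw [UU_eq, hi]; simp
    have hri := hr (i.val + 1) (by omega) (by omega)
    rw [← hu] at hri
    push_cast at hri
    set E := 1 / 2 * Real.log (n / ((i.val : ℝ) + 1)) + b * max 0 (Real.log (2 * m1 / ((i.val : ℝ) + 1))) with hE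
    have hin : (i.val : ℝ) + 1 ≤ n := by exact_mod_cast i.isLt
    have hlog : 0 ≤ Real.log ((n : ℝ) / ((i.val : ℝ) + 1)) := Real.log_nonneg (by rw [le_div_iff₀ (by positivity)]; linarith)
    have hE0 : 0 ≤ E := add_nonneg (by linarith) (mul_nonneg hb0 (le_max_left _ _))
    have h1 : 1 + |u j - lam| / σ ≤ 1601 * Real.exp E := by
      have h2 : |u j - lam| ≤ |u j| + |lam| := abs_sub _ _
      have h3 : |u j - lam| / σ ≤ 800 * Real.exp E + 800 := by
        rw [div_le_iff₀ hσ0]; nlinarith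
      have h4 := Real.one_le_exp hE0
      linarith
    have h5 : Real.log (1 + |u j - lam| / σ) ≤ 8 + E := by
      have h0 : 0 ≤ |u j - lam| / σ := by positivity
      refine (Real.log_le_log (by linarith) h1).trans ?_
      rw [Real.log_mul (by norm_num) (Real.exp_pos _).ne', Real.log_exp]
      have := log1601
      linarith
    refine h5.trans ?_
    have h6 : Real.log ((n : ℝ) / ((i.val : ℝ) + 1)) = T + Real.log (n * Real.exp (-T) / ((i.val : ℝ) + 1)) := by
      have : (n : ℝ) * Real.exp (-T) / ((i.val : ℝ) + 1) = n / ((i.val : ℝ) + 1) * Real.exp (-T) := by ring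
      rw [this, Real.log_mul (by positivity) (Real.exp_pos _).ne', Real.log_exp]; ring
    have h7 := le_max_right 0 (Real.log (n * Real.exp (-T) / ((i.val : ℝ) + 1)))
    simp only [g, hE, h6]
    linarith
  refine (Finset.sum_le_sum fun j _ => hterm j).trans ?_
  rw [Finset.sum_add_distrib, Finset.sum_const, nsmul_eq_mul]
  have h8 : ∑ j ∈ B, g (e.symm j) ≤ ∑ i, g i := by
    calc _ ≤ ∑ j, g (e.symm j) := Finset.sum_le_sum_of_subset_of_nonneg (subset_univ _) fun j _ _ => hg0 _
      _ = _ := Equiv.sum_comp e.symm g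
  have h9 : ∑ i, g i ≤ 1 / 2 * (n * Real.exp (-T)) + b * (2 * m1) := by
    simp only [g]
    rw [Finset.sum_add_distrib, ← Finset.mul_sum, ← Finset.mul_sum]
    have s1 := sum_logplus n (M := n * Real.exp (-T)) (by positivity)
    have s2 := sum_logplus n (M := 2 * m1) (by positivity)
    rw [Finset.sum_range] at s1 s2
    gcongr
  linarith

end

set_option maxHeartbeats 2000000 in
lemma exists_prof {ι : Type} [Fintype ι] {n : ℕ} (hι : Fintype.card ι + 1 = n) {p : ℝ} (hp : 0 < p) (hp1 : p ≤ 1)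
    (hd : 1000000 * Real.log n ≤ p * n) (hlog : 40 ≤ Real.log n) {Q : ι → Fin n → Bool}
    (hE : Expand p Q) (hT : ¬ TwoIrr (p * n) Q) (hNet : ¬ NetBad p Q) (hcol : ∀ j, ∃ i, Q i j = true)
    {u : Fin n → ℝ} (hu : u ≠ 0) (hker : ∀ i, dot (Q i) u = 0) :
    ∃ σ lam, Prof u σ lam := by
  have hn : 1 ≤ n := by omega
  have hn1 : (1 : ℝ) ≤ n := by exact_mod_cast hn
  have hn0 : (0 : ℝ) < n := by linarith
  have hlogle : Real.log n ≤ n := (Real.log_le_sub_one_of_pos hn0).trans (by linarith)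
  have hn40 : (40 : ℝ) ≤ n := by linarith
  obtain ⟨e, he⟩ := exists_sort (fun j => |u j|)
  obtain ⟨lam, med1, med2⟩ := exists_median hn u
  set m1 := ⌈1 / p⌉₊ with hm1d
  have hip : 1 / p ≤ n / (1000000 * Real.log n) := by
    rw [div_le_div_iff₀ hp (by positivity)]; linarith
  have hip2 : 1 / p ≤ n / 1000000 := hip.trans (by gcongr; linarith)
  have hm1p : 1 / p ≤ m1 := Nat.le_ceil _
  have hm1l : (m1 : ℝ) < 1 / p + 1 := Nat.ceil_lt_add_one (by positivity)
  have hm1 : 1 ≤ m1 := Nat.one_le_ceil_iff.2 (by positivity)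
  have hp1' : 1 ≤ 1 / p := by rw [le_div_iff₀ hp]; linarith
  have hm1n : 2 * m1 ≤ n := by
    have : 2 * (m1 : ℝ) ≤ n := by linarith
    exact_mod_cast this
  set b := Real.log n / Real.log 2 with hb
  have hl2 := Real.log_two_gt_d9
  have hb0 : 0 ≤ b := by rw [hb]; positivity
  have hb2 : (n : ℝ) = 2 ^ b := by
    rw [hb, Real.rpow_def_of_pos (by norm_num), mul_div_cancel₀ _ (by positivity), Real.exp_log hn0]
  have hch : ∀ m : ℕ, 1 ≤ m → m ≤ m1 → UU u e m ≤ (2 * m1 / m : ℝ) ^ b * UU u e m1 := fun m h1 h2 =>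
    expand_chain he hE hcol hker hp (by
      have : ((m1 : ℝ) - 1) * p ≤ 1 / p * p := by gcongr; linarith
      rwa [div_mul_cancel₀ _ hp.ne'] at this) hm1n hb0 hb2 m1 m h1 h2 (by omega)
  have hU1 : ∀ j, |u j| ≤ UU u e 1 := by
    intro j
    have := UU_anti (u := u) he (show 1 ≤ (e.symm j).val + 1 by omega)
    rw [UU_eq] at this; simpa using this
  have hUpos : 0 < UU u e m1 := by
    by_contra hcon
    have h0 : UU u e m1 = 0 := le_antisymm (not_lt.1 hcon) (UU_nonneg _)
    apply hu
    ext j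
    have h3 := hch 1 le_rfl hm1
    rw [h0, mul_zero] at h3
    have := hU1 j
    have : |u j| ≤ 0 := by linarith
    simpa using this
  -- choice of σ
  obtain ⟨ms, hms, hmax⟩ := Finset.exists_max_image (Finset.Icc m1 (n / 2))
    (fun m : ℕ => 1 / 400 * Real.sqrt (m / n) * UU u e m) ⟨m1, mem_Icc.2 ⟨le_rfl, by omega⟩⟩
  rw [mem_Icc] at hms
  set σ := 1 / 400 * Real.sqrt (ms / n) * UU u e ms with hσd
  have hσ0 : 0 < σ := by
    have := hmax m1 (mem_Icc.2 ⟨le_rfl, by omega⟩)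
    refine lt_of_lt_of_le ?_ this
    have : (0 : ℝ) < m1 := by exact_mod_cast hm1
    positivity
  have hinv : ∀ m : ℕ, 1 ≤ m → Real.sqrt (m / n) * Real.sqrt (n / m) = 1 := by
    intro m hm
    have : (0 : ℝ) < m := by exact_mod_cast hm
    rw [← Real.sqrt_mul (by positivity)]
    have : (m / n : ℝ) * (n / m) = 1 := by field_simp
    rw [this, Real.sqrt_one]
  have hσ : ∀ m : ℕ, m1 ≤ m → 2 * m ≤ n → UU u e m ≤ 400 * Real.sqrt (n / m) * σ := by
    intro m h1 h2
    have h3 := hmax m (mem_Icc.2 ⟨h1, by omega⟩)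
    have h4 := hinv m (by omega)
    have h5 := mul_le_mul_of_nonneg_left h3 (show 0 ≤ 400 * Real.sqrt ((n : ℝ) / m) by positivity)
    refine le_trans (le_of_eq ?_) h5
    have : 400 * Real.sqrt ((n : ℝ) / m) * (1 / 400 * Real.sqrt (m / n) * UU u e m) =
      (Real.sqrt (m / n) * Real.sqrt (n / m)) * UU u e m := by ring
    rw [this, h4, one_mul]
  have hr := rank_bound he hm1 hm1n hb0 hσ0 hch hσ
  have hlam : |lam| ≤ 800 * σ := by
    have h1 := med_le_UU (m := n / 2) he med1 med2 (by omega) (by omega)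
    refine h1.trans ((hσ (n / 2) (by omega) (by omega)).trans ?_)
    have h4 : (n : ℝ) ≤ 4 * ((n / 2 : ℕ) : ℝ) := by exact_mod_cast (by omega : n ≤ 4 * (n / 2))
    have h5 : (0 : ℝ) < ((n / 2 : ℕ) : ℝ) := by linarith
    have h6 : Real.sqrt (n / ((n / 2 : ℕ) : ℝ)) ≤ 2 := by
      rw [Real.sqrt_le_left (by norm_num), div_le_iff₀ h5]; linarith
    have : 400 * Real.sqrt (n / ((n / 2 : ℕ) : ℝ)) ≤ 800 := by linarith
    gcongr
  have hpsi := psi_sum hn hb0 hσ0 hlam hr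
  have hbm : b * (2 * m1) ≤ n / 100000 := by
    have h1 : (m1 : ℝ) ≤ 2 * (n / (1000000 * Real.log n)) := by linarith
    have h2 : b ≤ 2 * Real.log n := by
      rw [hb, div_le_iff₀ (by positivity)]; nlinarith
    calc b * (2 * m1) ≤ (2 * Real.log n) * (2 * (2 * (n / (1000000 * Real.log n)))) := by gcongr
      _ = n * (8 / 1000000) := by field_simp; norm_num
      _ ≤ n / 100000 := by linarith
  have hd1 : 1 ≤ p * n := by linarith
  -- lower bound on psi
  have hlow : (n : ℝ) / 8000 < ∑ j, Real.log (1 + |u j - lam| / σ) := by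
    by_contra hcon
    push Not at hcon
    apply hNet
    obtain ⟨z, hz1, hz2, hz3, _⟩ := rounding hι hd1 hT (fun j => σ⁻¹ * (u j - lam)) (N := 1) (A := n / 1000) one_pos
      (by positivity) (by
        have : ∀ j, Real.log (1 + |σ⁻¹ * (u j - lam)| / 1) = Real.log (1 + |u j - lam| / σ) := by
          intro j; rw [abs_mul, abs_of_pos (inv_pos.2 hσ0), div_one, inv_mul_eq_div]
        simp only [this]
        linarith) (fun _ => 0) (fun _ => le_rfl) (by simp [Ex])
    obtain ⟨hs1, hs2⟩ := shift_bound hι hd1 hker (fun j => σ⁻¹ * (u j - lam)) (fun j => rfl) z hz2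
    refine ⟨z, ⌊(n : ℝ) ^ 2 * (σ⁻¹ * lam)⌋, ?_, hz3, ⟨ms, ?_, ?_⟩, hs1⟩
    · have hl1 : |σ⁻¹ * lam| ≤ 800 := by
        rw [abs_mul, abs_of_pos (inv_pos.2 hσ0), inv_mul_le_iff₀ hσ0]; linarith
      have hl2 := abs_le.1 hl1
      have h3 : |(n : ℝ) ^ 2 * (σ⁻¹ * lam)| ≤ n ^ 2 * 800 := by
        rw [abs_mul, abs_of_nonneg (by positivity)]; gcongr
      have h4 := abs_le.1 h3
      have h5 : (n : ℝ) ^ 2 * 800 + 1 ≤ n ^ 4 := by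
        have : (1600 : ℝ) ≤ n ^ 2 := by nlinarith
        nlinarith
      have f1 := Int.floor_le ((n : ℝ) ^ 2 * (σ⁻¹ * lam))
      have f2 := Int.lt_floor_add_one ((n : ℝ) ^ 2 * (σ⁻¹ * lam))
      have : |(⌊(n : ℝ) ^ 2 * (σ⁻¹ * lam)⌋ : ℝ)| ≤ (n : ℝ) ^ 4 := by
        rw [abs_le]; constructor <;> linarith [h4.1, h4.2]
      exact_mod_cast this
    · have : (m1 : ℝ) ≤ ms := by exact_mod_cast hms.1
      calc 1 = 1 / p * p := by field_simp
        _ ≤ ms * p := by gcongr; linarith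
    · have hms1 : 1 ≤ ms := hm1.trans hms.1
      have hsub : ((univ.filter fun i : Fin n => i.val < ms).map e.toEmbedding) ⊆
          univ.filter fun j => 200 * Real.sqrt (n / ms) ≤ |(⌊(n : ℝ) ^ 2 * (σ⁻¹ * lam)⌋ : ℝ) / n ^ 2 + z j| := by
        intro j hj
        obtain ⟨i, hi, rfl⟩ := mem_map.1 hj
        have hi := (mem_filter.1 hi).2
        refine mem_filter.2 ⟨mem_univ _, ?_⟩
        simp only [Equiv.coe_toEmbedding]
        have h1 := UU_anti (u := u) he (show i.val + 1 ≤ ms from hi)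
        rw [UU_eq] at h1
        have h2 : UU u e ms = 400 * Real.sqrt (n / ms) * σ := by
          have : 400 * Real.sqrt ((n : ℝ) / ms) * σ = (Real.sqrt (ms / n) * Real.sqrt (n / ms)) * UU u e ms := by
            rw [hσd]; ring
          rw [this, hinv ms hms1, one_mul]
        rw [h2] at h1
        have h3 : 400 * Real.sqrt (n / ms) ≤ |σ⁻¹ * u (e i)| := by
          rw [abs_mul, abs_of_pos (inv_pos.2 hσ0), inv_mul_eq_div, le_div_iff₀ hσ0]; exact h1
        have hz := hz1 (e i)
        have h4 : 1 / (n : ℝ) ^ 2 ≤ 1 / 2 := by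
          apply one_div_le_one_div_of_le (by norm_num)
          nlinarith
        have h5 : (1 : ℝ) ≤ Real.sqrt (n / ms) := by
          rw [Real.one_le_sqrt, le_div_iff₀ (by exact_mod_cast hms1)]
          have : ms ≤ n := by omega
          have : (ms : ℝ) ≤ n := by exact_mod_cast this
          linarith
        have e1 : (⌊(n : ℝ) ^ 2 * (σ⁻¹ * lam)⌋ : ℝ) / n ^ 2 + z (e i) = σ⁻¹ * u (e i) +
          (((⌊(n : ℝ) ^ 2 * (σ⁻¹ * lam)⌋ : ℝ) / n ^ 2 - σ⁻¹ * lam) + (z (e i) - σ⁻¹ * (u (e i) - lam))) := by ring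
        rw [e1]
        have t1 := abs_add_le ((⌊(n : ℝ) ^ 2 * (σ⁻¹ * lam)⌋ : ℝ) / n ^ 2 - σ⁻¹ * lam) (z (e i) - σ⁻¹ * (u (e i) - lam))
        have t2 := abs_sub_abs_le_abs_add (σ⁻¹ * u (e i)) (((⌊(n : ℝ) ^ 2 * (σ⁻¹ * lam)⌋ : ℝ) / n ^ 2 - σ⁻¹ * lam) + (z (e i) - σ⁻¹ * (u (e i) - lam)))
        linarith
      have h2 := card_le_card hsub
      rw [card_map] at h2
      have h3 : (univ.filter fun i : Fin n => i.val < ms).card = ms := by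
        have hb : ms < n := by omega
        have := Fin.card_Iio (⟨ms, hb⟩ : Fin n)
        refine Eq.trans ?_ this
        congr 1; ext i; simp [Fin.lt_def]
      rwa [h3] at h2
  refine ⟨σ, lam, hσ0, ?_, ?_, med1, med2, hlam, ?_⟩
  · have := hpsi univ (T := 0) le_rfl
    simp only [card_univ, Fintype.card_fin, neg_zero, Real.exp_zero, mul_one, zero_div, add_zero] at this
    linarith
  · set B := univ.filter fun j => σ / 16000 < |u j - lam| with hB
    have h1 := hpsi B (T := 11) (by norm_num)
    have h2 : ∑ j ∈ univ.filter (fun j => ¬ (σ / 16000 < |u j - lam|)), Real.log (1 + |u j - lam| / σ) ≤ n / 16000 := by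
      refine (Finset.sum_le_card_nsmul _ _ (1 / 16000) ?_).trans ?_
      · intro j hj
        have := (mem_filter.1 hj).2
        push Not at this
        have h3 : |u j - lam| / σ ≤ 1 / 16000 := by rw [div_le_iff₀ hσ0]; linarith
        have h0 : 0 ≤ |u j - lam| / σ := by positivity
        refine (Real.log_le_sub_one_of_pos (by linarith)).trans (by linarith)
      · rw [nsmul_eq_mul]
        have : ((univ.filter (fun j => ¬ (σ / 16000 < |u j - lam|))).card : ℝ) ≤ n := by
          have : (univ.filter (fun j => ¬ (σ / 16000 < |u j - lam|))).card ≤ n := (card_le_univ _).trans (by simp)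
          exact_mod_cast this
        linarith
    have h3 := Finset.sum_filter_add_sum_filter_not univ (fun j => σ / 16000 < |u j - lam|)
      (fun j => Real.log (1 + |u j - lam| / σ))
    have h4 : Real.exp (-11) ≤ 1 / 40000 := by
      rw [Real.exp_neg, ← one_div]
      apply one_div_le_one_div_of_le (by norm_num)
      have : Real.exp 11 = Real.exp 1 ^ 11 := by rw [← Real.exp_nat_mul]; congr 1; norm_num
      rw [this]
      have := Real.exp_one_gt_d9
      calc (40000 : ℝ) ≤ 2.7 ^ 11 := by norm_num
        _ ≤ _ := by gcongr; linarith
    have h5 : (n : ℝ) * Real.exp (-11) ≤ n * (1 / 40000) := by gcongr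
    rw [← hB] at h3
    have h6 : (0 : ℝ) ≤ B.card := Nat.cast_nonneg _
    linarith
  · -- norm
    have h1 := hr 1 le_rfl hn
    have hE1 : 1 / 2 * Real.log ((n : ℝ) / ((1 : ℕ) : ℝ)) + b * max 0 (Real.log (2 * m1 / ((1 : ℕ) : ℝ))) ≤
        1 / 2 * Real.log n + b * Real.log n := by
      have : max 0 (Real.log (2 * m1 / ((1 : ℕ) : ℝ))) ≤ Real.log n := by
        refine max_le (by linarith) ?_
        have : (0 : ℝ) < m1 := by exact_mod_cast hm1
        rw [Nat.cast_one, div_one]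
        exact Real.log_le_log (by positivity) (by exact_mod_cast hm1n)
      simp only [Nat.cast_one, div_one] at this ⊢
      gcongr
    have h2 : eNorm u ≤ n * UU u e 1 := by
      have hU := UU_nonneg (u := u) (e := e) 1
      have : eNorm u ^ 2 ≤ (n * UU u e 1) ^ 2 := by
        rw [eNorm_sq]
        calc ∑ j, u j ^ 2 ≤ ∑ j : Fin n, UU u e 1 ^ 2 := by
              refine Finset.sum_le_sum fun j _ => ?_
              rw [← sq_abs]; gcongr; exact hU1 j
          _ = n * UU u e 1 ^ 2 := by simp
          _ ≤ n ^ 2 * UU u e 1 ^ 2 := by gcongr; nlinarith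
          _ = _ := by ring
      exact le_of_sq_le_sq this (by positivity)
    refine h2.trans ?_
    have h3 : n * UU u e 1 ≤ n * (800 * Real.exp (1 / 2 * Real.log n + b * Real.log n) * σ) := by
      gcongr
      exact h1.trans (by gcongr)
    refine h3.trans ?_
    have h4 : n * (800 * Real.exp (1 / 2 * Real.log n + b * Real.log n) * σ) =
        (Real.exp (Real.log n) * 800 * Real.exp (1 / 2 * Real.log n + b * Real.log n)) * σ := by
      rw [Real.exp_log hn0]; ring
    rw [h4]
    refine mul_le_mul_of_nonneg_right ?_ hσ0.le
    have h5 : (800 : ℝ) ≤ Real.exp 8 := by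
      rw [← Real.log_le_iff_le_exp (by norm_num)]
      exact (Real.log_le_log (by norm_num) (by norm_num)).trans log1601
    calc _ ≤ Real.exp (Real.log n) * Real.exp 8 * Real.exp (1 / 2 * Real.log n + b * Real.log n) := by gcongr
      _ ≤ _ := by
          rw [← Real.exp_add, ← Real.exp_add, Real.exp_le_exp]
          have h6 : Real.log (2 * n) = Real.log 2 + Real.log n := Real.log_mul (by norm_num) hn0.ne'
          have h7 : b ≤ 1.45 * Real.log n := by
            rw [hb, div_le_iff₀ (by positivity)]
            nlinarith
          rw [h6]
          nlinarith
end SB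

set_option linter.all false
namespace SB
open Finset

/-- Modulus of the exponential sum. -/
noncomputable def Sy {n : ℕ} (y : Fin n → ℝ) (θ : ℝ) : ℝ := ‖∑ j, Complex.exp ((θ * y j : ℝ) * Complex.I)‖

/-- Modulus of the truncated characteristic function of a row functional. -/
noncomputable def phi (p : ℝ) {n : ℕ} (y : Fin n → ℝ) (θ : ℝ) : ℝ :=
  ‖∑ X : Fin n → Bool, ((rowW p X * ind (Reg (p * n) X) : ℝ) : ℂ) * Complex.exp ((θ * dot X y : ℝ) * Complex.I)‖

section
variable {p : ℝ} {n : ℕ}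

lemma Sy_le (y : Fin n → ℝ) (θ : ℝ) : Sy y θ ≤ n := by
  unfold Sy
  refine (norm_sum_le _ _).trans ?_
  simp only [Complex.norm_exp_ofReal_mul_I]
  simp

lemma Sy_nonneg (y : Fin n → ℝ) (θ : ℝ) : 0 ≤ Sy y θ := norm_nonneg _

lemma sum_cos_le (y : Fin n → ℝ) (θ : ℝ) : ∑ j, Real.cos (θ * y j) ≤ Sy y θ := by
  have := Complex.re_le_norm (∑ j, Complex.exp ((θ * y j : ℝ) * Complex.I))
  rw [Complex.re_sum] at this
  simp only [Complex.exp_ofReal_mul_I_re] at this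
  exact this

lemma ind_not_add (S : Prop) : ind S + ind (¬ S) = 1 := by
  by_cases h : S <;> simp [ind, h]

lemma phi_le_one (h0 : 0 ≤ p) (h1 : p ≤ 1) (y : Fin n → ℝ) (θ : ℝ) : phi p y θ ≤ 1 := by
  unfold phi
  refine (norm_sum_le _ _).trans ?_
  calc _ ≤ ∑ X : Fin n → Bool, rowW p X := by
        refine Finset.sum_le_sum fun X _ => ?_
        rw [norm_mul, Complex.norm_exp_ofReal_mul_I, mul_one, Complex.norm_real]
        have hw := rowW_nonneg h0 h1 X
        by_cases h : Reg (p * n) X <;> simp [ind, h, abs_of_nonneg hw, hw]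
    _ = 1 := rowW_sum

lemma phi_le_char (h0 : 0 ≤ p) (h1 : p ≤ 1 / 2) (y : Fin n → ℝ) (θ : ℝ) :
    phi p y θ ≤ Real.exp (-(p / 2 * (n - Sy y θ))) + 2 * Real.exp (-(0.9 * (p * n))) := by
  have hp1 : p ≤ 1 := by linarith
  have e : ∑ X : Fin n → Bool, ((rowW p X * ind (Reg (p * n) X) : ℝ) : ℂ) * Complex.exp ((θ * dot X y : ℝ) * Complex.I)
      = ∑ X : Fin n → Bool, (rowW p X : ℂ) * Complex.exp ((θ * dot X y : ℝ) * Complex.I)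
        - ∑ X : Fin n → Bool, ((rowW p X * ind (¬ Reg (p * n) X) : ℝ) : ℂ) * Complex.exp ((θ * dot X y : ℝ) * Complex.I) := by
    rw [← Finset.sum_sub_distrib]
    refine Finset.sum_congr rfl fun X _ => ?_
    have := ind_not_add (Reg (p * n) X)
    have h2 : ind (Reg (p * n) X) = 1 - ind (¬ Reg (p * n) X) := by linarith
    rw [h2]; push_cast; ring
  unfold phi
  rw [e]
  refine (norm_sub_le _ _).trans (add_le_add ?_ ?_)
  · refine (row_char_le h0 h1 y θ).trans ?_
    rw [Real.exp_le_exp, neg_le_neg_iff]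
    rw [Finset.sum_sub_distrib]
    simp only [sum_const, card_univ, Fintype.card_fin, nsmul_eq_mul, mul_one]
    have := sum_cos_le y θ
    gcongr
  · refine (norm_sum_le _ _).trans (le_trans ?_ (irreg_le (n := n) h0 hp1))
    unfold Pr
    refine Finset.sum_le_sum fun X _ => ?_
    rw [norm_mul, Complex.norm_exp_ofReal_mul_I, mul_one, Complex.norm_real, Real.norm_eq_abs, abs_of_nonneg]
    exact mul_nonneg (rowW_nonneg h0 hp1 X) (by by_cases h : Reg (p * n) X <;> simp [ind, h])

lemma tilt_le (h0 : 0 ≤ p) (h1 : p ≤ 1) {R : ℝ} (hR : R ^ 2 * p ≤ 1) (y : Fin n → ℝ) (θ : ℝ) (hS : R * Sy y θ ≤ n)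
    {τ : ℂ} (hτ : ‖τ‖ = R) :
    ‖∑ X : Fin n → Bool, (rowW p X : ℂ) * (τ ^ cnt X * Complex.exp ((θ * dot X y : ℝ) * Complex.I))‖ ≤
      Real.exp (1.5 * (p * n)) := by
  have e1 : ∀ X : Fin n → Bool, τ ^ cnt X * Complex.exp ((θ * dot X y : ℝ) * Complex.I) =
      ∏ j, (if X j = true then τ * Complex.exp ((θ * y j : ℝ) * Complex.I) else 1) := by
    intro X
    rw [cexp_dot]
    have : τ ^ cnt X = ∏ j, (if X j = true then τ else 1) := by
      rw [Finset.prod_ite]; simp [cnt]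
    rw [this, ← Finset.prod_mul_distrib]
    refine Finset.prod_congr rfl fun j _ => ?_
    split_ifs <;> simp
  simp only [e1]
  rw [row_cprod (p := p) (n := n) (fun j b => if b = true then τ * Complex.exp ((θ * y j : ℝ) * Complex.I) else 1)]
  simp only [if_true, Bool.false_eq_true, if_false, mul_one]
  rw [norm_prod]
  have hf : ∀ j, ‖(p : ℂ) * (τ * Complex.exp ((θ * y j : ℝ) * Complex.I)) + (1 - p)‖ ^ 2 ≤
      Real.exp (2 * (1 - p) * p * (τ * Complex.exp ((θ * y j : ℝ) * Complex.I)).re + p) := by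
    intro j
    set w := τ * Complex.exp ((θ * y j : ℝ) * Complex.I) with hw
    have hwn : w.re * w.re + w.im * w.im = R ^ 2 := by
      have : ‖w‖ = R := by rw [hw, norm_mul, Complex.norm_exp_ofReal_mul_I, mul_one, hτ]
      rw [← this, Complex.sq_norm, Complex.normSq_apply]
    have : ‖(p : ℂ) * w + (1 - p)‖ ^ 2 = (1 - p) ^ 2 + 2 * (1 - p) * p * w.re + p ^ 2 * R ^ 2 := by
      rw [Complex.sq_norm, Complex.normSq_apply, ← hwn]
      simp
      ring
    rw [this]
    have h3 : p ^ 2 * R ^ 2 ≤ p := by nlinarith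
    have h4 : (1 - p) ^ 2 ≤ 1 := by nlinarith
    have := Real.add_one_le_exp (2 * (1 - p) * p * w.re + p)
    linarith
  have hsq : (∏ j, ‖(p : ℂ) * (τ * Complex.exp ((θ * y j : ℝ) * Complex.I)) + (1 - p)‖) ^ 2 ≤ Real.exp (1.5 * (p * n)) ^ 2 := by
    rw [← Finset.prod_pow]
    refine (Finset.prod_le_prod (fun j _ => by positivity) fun j _ => hf j).trans ?_
    rw [← Real.exp_sum, Finset.sum_add_distrib, ← Finset.mul_sum, ← Complex.re_sum, ← Finset.mul_sum, ← Real.exp_nat_mul,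
      Real.exp_le_exp]
    have h5 : (τ * ∑ j, Complex.exp ((θ * y j : ℝ) * Complex.I)).re ≤ n := by
      refine (Complex.re_le_norm _).trans ?_
      rw [norm_mul, hτ]; exact hS
    simp only [sum_const, card_univ, Fintype.card_fin, nsmul_eq_mul]
    push_cast
    have h6 : 0 ≤ 2 * (1 - p) * p := by nlinarith
    have h7 : 2 * (1 - p) * p * (τ * ∑ j, Complex.exp ((θ * y j : ℝ) * Complex.I)).re ≤ 2 * (1 - p) * p * n := by gcongr
    have h8 : (0 : ℝ) ≤ n := by positivity
    have h9 : 0 ≤ p * p * n := by positivity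
    push_cast at h7
    nlinarith
  exact le_of_sq_le_sq hsq (Real.exp_pos _).le

lemma root_sum {M c k : ℕ} (hc : c < M) (hk : k < M) :
    ∑ m ∈ range M, (Complex.exp (2 * Real.pi * Complex.I / M) ^ m) ^ (c + (M - k)) = if c = k then (M : ℂ) else 0 := by
  have hM : M ≠ 0 := by omega
  have hz := Complex.isPrimitiveRoot_exp M hM
  set ζ := Complex.exp (2 * Real.pi * Complex.I / M) with hζ
  have e : ∀ m, (ζ ^ m) ^ (c + (M - k)) = (ζ ^ (c + (M - k))) ^ m := fun m => by rw [← pow_mul, ← pow_mul, mul_comm]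
  simp only [e]
  split_ifs with h
  · have : c + (M - k) = M := by omega
    rw [this, hz.pow_eq_one]; simp
  · have hne : ζ ^ (c + (M - k)) ≠ 1 := by
      rw [Ne, hz.pow_eq_one_iff_dvd]
      rintro ⟨q, hq⟩
      have h1 : q ≠ 0 := by rintro rfl; omega
      have h2 : q < 2 := by
        by_contra h2
        have : M * 2 ≤ M * q := Nat.mul_le_mul_left _ (by omega)
        omega
      have h3 : q = 1 := by omega
      rw [h3] at hq; omega
    rw [geom_sum_eq hne, ← pow_mul, mul_comm, pow_mul, hz.pow_eq_one]; simp

lemma cnt_le (X : Fin n → Bool) : cnt X ≤ n := by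
  unfold cnt; exact (card_le_univ _).trans (by simp)

lemma phi_le_tilt (h0 : 0 ≤ p) (h1 : p ≤ 1) (hp : p ≤ Real.exp (-800)) (y : Fin n → ℝ) (θ : ℝ)
    (hS : Sy y θ ≤ Real.exp (-400) * n) :
    phi p y θ ≤ (n + 1) * Real.exp (-(2.5 * (p * n))) := by
  classical
  set R := Real.exp 400 with hRd
  have hR1 : R ^ 2 * p ≤ 1 := by
    calc R ^ 2 * p ≤ R ^ 2 * Real.exp (-800) := by gcongr
      _ = 1 := by rw [hRd, ← Real.exp_nat_mul, ← Real.exp_add]; norm_num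
  have hR2 : R * Sy y θ ≤ n := by
    calc R * Sy y θ ≤ R * (Real.exp (-400) * n) := by gcongr
      _ = n := by rw [← mul_assoc, hRd, ← Real.exp_add]; norm_num
  have hR0 : 0 < R := Real.exp_pos _
  set M := n + 1 with hM
  set ζ := Complex.exp (2 * Real.pi * Complex.I / M) with hζ
  have hζ1 : ∀ m, ‖ζ ^ m‖ = 1 := by
    intro m
    rw [norm_pow, IsPrimitiveRoot.norm'_eq_one (Complex.isPrimitiveRoot_exp M (by omega)) (by omega), one_pow]
  let K := (range M).filter fun k : ℕ => p * n / 100 ≤ (k : ℝ) ∧ (k : ℝ) ≤ 10 * (p * n)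
  have hind : ∀ X : Fin n → Bool, ((ind (Reg (p * n) X) : ℝ) : ℂ) =
      ∑ k ∈ K, ((M : ℂ)⁻¹ * ∑ m ∈ range M, ((R : ℂ) ^ k)⁻¹ * (ζ ^ m) ^ (M - k) * ((R : ℂ) * ζ ^ m) ^ cnt X) := by
    intro X
    have hX : cnt X < M := by have := cnt_le X; omega
    have hk : ∀ k ∈ K, ((M : ℂ)⁻¹ * ∑ m ∈ range M, ((R : ℂ) ^ k)⁻¹ * (ζ ^ m) ^ (M - k) * ((R : ℂ) * ζ ^ m) ^ cnt X) =
        if cnt X = k then 1 else 0 := by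
      intro k hk
      have hkM : k < M := mem_range.1 (mem_filter.1 hk).1
      have : ∀ m, ((R : ℂ) ^ k)⁻¹ * (ζ ^ m) ^ (M - k) * ((R : ℂ) * ζ ^ m) ^ cnt X =
          ((R : ℂ) ^ k)⁻¹ * (R : ℂ) ^ cnt X * (ζ ^ m) ^ (cnt X + (M - k)) := by
        intro m; rw [mul_pow, pow_add]; ring
      simp only [this]
      rw [← Finset.mul_sum, root_sum hX hkM]
      split_ifs with h
      · rw [h]
        have hRc : (R : ℂ) ≠ 0 := by exact_mod_cast hR0.ne'
        have hMc : (M : ℂ) ≠ 0 := by exact_mod_cast (by omega : M ≠ 0)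
        field_simp
      · simp
    rw [Finset.sum_congr rfl hk, Finset.sum_ite_eq]
    by_cases h : Reg (p * n) X
    · have : cnt X ∈ K := mem_filter.2 ⟨mem_range.2 hX, h⟩
      simp [ind, h, this]
    · have : cnt X ∉ K := fun hh => h (mem_filter.1 hh).2
      simp [ind, h, this]
  have hmain : ∑ X : Fin n → Bool, ((rowW p X * ind (Reg (p * n) X) : ℝ) : ℂ) * Complex.exp ((θ * dot X y : ℝ) * Complex.I) =
      ∑ k ∈ K, ((M : ℂ)⁻¹ * ∑ m ∈ range M, ((R : ℂ) ^ k)⁻¹ * (ζ ^ m) ^ (M - k) *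
        ∑ X : Fin n → Bool, (rowW p X : ℂ) * (((R : ℂ) * ζ ^ m) ^ cnt X * Complex.exp ((θ * dot X y : ℝ) * Complex.I))) := by
    simp only [Complex.ofReal_mul, hind]
    simp only [Finset.mul_sum, Finset.sum_mul]
    rw [Finset.sum_comm]
    refine Finset.sum_congr rfl fun k _ => ?_
    rw [Finset.sum_comm]
    refine Finset.sum_congr rfl fun m _ => ?_
    refine Finset.sum_congr rfl fun X _ => ?_
    ring
  unfold phi
  rw [hmain]
  refine (norm_sum_le _ _).trans ?_
  have hb : ∀ k ∈ K, ‖((M : ℂ)⁻¹ * ∑ m ∈ range M, ((R : ℂ) ^ k)⁻¹ * (ζ ^ m) ^ (M - k) *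
        ∑ X : Fin n → Bool, (rowW p X : ℂ) * (((R : ℂ) * ζ ^ m) ^ cnt X * Complex.exp ((θ * dot X y : ℝ) * Complex.I)))‖ ≤
      Real.exp (-(2.5 * (p * n))) := by
    intro k hk
    have hk2 := (mem_filter.1 hk).2.1
    rw [norm_mul]
    have h2 : ∀ m ∈ range M, ‖((R : ℂ) ^ k)⁻¹ * (ζ ^ m) ^ (M - k) *
        ∑ X : Fin n → Bool, (rowW p X : ℂ) * (((R : ℂ) * ζ ^ m) ^ cnt X * Complex.exp ((θ * dot X y : ℝ) * Complex.I))‖ ≤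
        Real.exp (-(2.5 * (p * n))) := by
      intro m _
      rw [norm_mul, norm_mul, norm_pow (ζ ^ m), hζ1, one_pow, mul_one, norm_inv, norm_pow, Complex.norm_real,
        Real.norm_eq_abs, abs_of_pos hR0]
      have h3 := tilt_le h0 h1 hR1 y θ hR2 (τ := (R : ℂ) * ζ ^ m) (by
        rw [norm_mul, hζ1, mul_one, Complex.norm_real, Real.norm_eq_abs, abs_of_pos hR0])
      have h4 : (R ^ k)⁻¹ ≤ Real.exp (-(4 * (p * n))) := by
        rw [hRd, ← Real.exp_nat_mul, ← Real.exp_neg, Real.exp_le_exp]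
        linarith
      calc _ ≤ Real.exp (-(4 * (p * n))) * Real.exp (1.5 * (p * n)) := by gcongr
        _ = _ := by rw [← Real.exp_add]; congr 1; ring
    have h5 := (norm_sum_le (range M) _).trans (Finset.sum_le_card_nsmul _ _ _ h2)
    rw [card_range, nsmul_eq_mul] at h5
    rw [norm_inv, Complex.norm_natCast]
    have hMp : (0 : ℝ) < M := by exact_mod_cast (by omega : 0 < M)
    rw [inv_mul_le_iff₀ hMp]
    exact h5
  refine (Finset.sum_le_card_nsmul _ _ _ hb).trans ?_
  rw [nsmul_eq_mul]
  have hcard : (K.card : ℝ) ≤ n + 1 := by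
    have : K.card ≤ n + 1 := (card_filter_le _ _).trans (by simp [hM])
    exact_mod_cast this
  gcongr

end
end SB

set_option linter.all false
namespace SB
open Finset

lemma gam_exp_sq {b : ℝ} (hb : -(1 / 2) < b) : ∫ g, Real.exp (-(b * g ^ 2)) ∂gam = 1 / Real.sqrt (1 + 2 * b) := by
  rw [gam, ProbabilityTheory.integral_gaussianReal_eq_integral_smul (by norm_num)]
  have : ∀ x : ℝ, ProbabilityTheory.gaussianPDFReal 0 1 x • Real.exp (-(b * x ^ 2)) =
      (Real.sqrt (2 * Real.pi))⁻¹ * Real.exp (-(1 / 2 + b) * x ^ 2) := by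
    intro x
    rw [ProbabilityTheory.gaussianPDFReal_def]
    simp only [NNReal.coe_one, mul_one, sub_zero, smul_eq_mul]
    rw [mul_assoc, ← Real.exp_add]
    congr 2; ring
  simp only [this]
  rw [integral_const_mul, integral_gaussian, ← Real.sqrt_inv, ← Real.sqrt_mul (by positivity), one_div (Real.sqrt _), ← Real.sqrt_inv]
  congr 1
  have h1 : 1 / 2 + b ≠ 0 := by linarith
  have h2 : 1 + 2 * b ≠ 0 := by linarith
  have h3 : (1 : ℝ) + b * 2 ≠ 0 := by linarith
  have := Real.pi_pos.ne'
  field_simp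

lemma gam_exp_sq_int {b : ℝ} (hb : -(1 / 2) < b) : Integrable (fun g => Real.exp (-(b * g ^ 2))) gam := by
  by_contra h
  have h1 := gam_exp_sq hb
  rw [integral_undef h] at h1
  have : 0 < 1 / Real.sqrt (1 + 2 * b) := by
    have : 0 < 1 + 2 * b := by linarith
    positivity
  linarith

lemma gam_set {J : Set ℝ} (hJ : MeasurableSet J) {a b s : ℝ} (hab : a ≤ b) (h1 : J ⊆ Set.Icc a b) (h2 : ∀ g ∈ J, s ^ 2 ≤ g ^ 2) :
    gam.real J ≤ Real.exp (-(s ^ 2 / 2)) * (b - a) := by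
  have h : gam J ≤ ENNReal.ofReal (Real.exp (-(s ^ 2 / 2)) * (b - a)) := by
    rw [gam, ProbabilityTheory.gaussianReal_apply _ (by norm_num)]
    calc ∫⁻ x in J, ProbabilityTheory.gaussianPDF 0 1 x ≤ ∫⁻ x in J, ENNReal.ofReal (Real.exp (-(s ^ 2 / 2))) := by
          refine setLIntegral_mono measurable_const fun x hx => ?_
          unfold ProbabilityTheory.gaussianPDF
          apply ENNReal.ofReal_le_ofReal
          rw [ProbabilityTheory.gaussianPDFReal_def]
          simp only [NNReal.coe_one, mul_one, sub_zero]
          have h3 : (Real.sqrt (2 * Real.pi))⁻¹ ≤ 1 := by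
            apply inv_le_one_of_one_le₀
            rw [Real.one_le_sqrt]
            have := Real.pi_gt_three
            linarith
          calc _ ≤ 1 * Real.exp (-x ^ 2 / 2) := by gcongr
            _ ≤ _ := by
              rw [one_mul, Real.exp_le_exp]
              have := h2 x hx
              linarith
      _ = ENNReal.ofReal (Real.exp (-(s ^ 2 / 2))) * volume J := by rw [setLIntegral_const]
      _ ≤ ENNReal.ofReal (Real.exp (-(s ^ 2 / 2))) * volume (Set.Icc a b) := by gcongr
      _ = _ := by rw [Real.volume_Icc, ← ENNReal.ofReal_mul (Real.exp_pos _).le]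
  refine (ENNReal.toReal_mono ENNReal.ofReal_ne_top h).trans ?_
  rw [ENNReal.toReal_ofReal]
  exact mul_nonneg (Real.exp_pos _).le (by linarith)

/-- Truncated small-ball functional. -/
noncomputable def rho (p : ℝ) {n : ℕ} (y : Fin n → ℝ) : ℝ :=
  Ex (rowW p) (fun X : Fin n → Bool => ind (Reg (p * n) X) * Real.exp (-((dot X y) ^ 2 / (32 * (p * n)))))

/-- No k well separated large frequencies. -/
def FreqGood (k : ℕ) {n : ℕ} (y : Fin n → ℝ) (N : ℝ) : Prop :=
  ¬ ∃ t : Fin k → ℝ, (∀ i, |t i| ≤ 1) ∧ (∀ i j, i ≠ j → k / N ≤ |t i - t j|) ∧ ∀ i, Real.exp (-400) * n ≤ Sy y (t i)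

def NearZero (H : ℝ) {n : ℕ} (y : Fin n → ℝ) (N : ℝ) : Prop :=
  ∀ θ : ℝ, |θ| * (H * N) ≤ 1 → 0.000000000000000001 * (N * θ) ^ 2 * n ≤ n - Sy y θ

section
variable {p : ℝ} {n : ℕ}

lemma rho_le_phi (h0 : 0 ≤ p) (hd : 0 < p * n) (y : Fin n → ℝ) :
    rho p y ≤ ∫ g, phi p y (g / (4 * Real.sqrt (p * n))) ∂gam := by
  have h := gauss_fourier (fun X : Fin n → Bool => rowW p X * ind (Reg (p * n) X)) (fun X => dot X y / (4 * Real.sqrt (p * n)))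
  refine le_trans (le_of_eq ?_) (h.trans (le_of_eq ?_))
  · unfold rho Ex
    refine Finset.sum_congr rfl fun X _ => ?_
    rw [mul_assoc]
    have : -(dot X y ^ 2 / (32 * (p * n))) = -(dot X y / (4 * Real.sqrt (p * n))) ^ 2 / 2 := by
      rw [div_pow, mul_pow, Real.sq_sqrt hd.le]
      ring
    simp only [this]
  · congr 1; ext g
    unfold phi
    congr 1
    refine Finset.sum_congr rfl fun X _ => ?_
    congr 4; ring

lemma phi_cont (y : Fin n → ℝ) (s : ℝ) : Continuous fun g : ℝ => phi p y (g / s) := by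
  unfold phi; fun_prop

lemma phi_nonneg (y : Fin n → ℝ) (θ : ℝ) : 0 ≤ phi p y θ := norm_nonneg _

lemma phi_int (h0 : 0 ≤ p) (h1 : p ≤ 1) (y : Fin n → ℝ) (s : ℝ) : Integrable (fun g : ℝ => phi p y (g / s)) gam :=
  int_of_bdd (phi_cont y s) (c := 1) fun g => by
    rw [Real.norm_eq_abs, abs_of_nonneg (phi_nonneg _ _)]; exact phi_le_one h0 h1 _ _

lemma one_sub_cos_mul (m : ℕ) (x : ℝ) : 1 - Real.cos (m * x) ≤ m ^ 2 * (1 - Real.cos x) := by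
  have hs : ∀ (m : ℕ) (x : ℝ), |Real.sin (m * x)| ≤ m * |Real.sin x| := by
    intro m x
    induction m with
    | zero => simp
    | succ m ih =>
      have e : ((m + 1 : ℕ) : ℝ) * x = m * x + x := by push_cast; ring
      rw [e, Real.sin_add]
      refine (abs_add_le _ _).trans ?_
      rw [abs_mul, abs_mul]
      have := Real.abs_cos_le_one x
      have := Real.abs_cos_le_one (m * x)
      have h1 : |Real.sin (m * x)| * |Real.cos x| ≤ m * |Real.sin x| * 1 := by gcongr
      have h2 : |Real.cos (m * x)| * |Real.sin x| ≤ 1 * |Real.sin x| := by gcongr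
      push_cast; linarith
  have e : ∀ x : ℝ, 1 - Real.cos x = 2 * Real.sin (x / 2) ^ 2 := by
    intro x
    rw [Real.sin_sq_eq_half_sub, mul_div_cancel₀ _ (by norm_num)]; ring
  rw [e, e]
  have h := hs m (x / 2)
  rw [show m * x / 2 = m * (x / 2) by ring, ← sq_abs, ← sq_abs (Real.sin (x / 2))]
  calc 2 * |Real.sin (m * (x / 2))| ^ 2 ≤ 2 * (m * |Real.sin (x / 2)|) ^ 2 := by gcongr
    _ = _ := by ring

lemma Sy_sq (y : Fin n → ℝ) (θ : ℝ) : (n : ℝ) ^ 2 - Sy y θ ^ 2 = ∑ i, ∑ j, (1 - Real.cos (θ * (y i - y j))) := by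
  have h1 : Sy y θ ^ 2 = (∑ j, Real.cos (θ * y j)) ^ 2 + (∑ j, Real.sin (θ * y j)) ^ 2 := by
    unfold Sy
    rw [Complex.sq_norm, Complex.normSq_apply, Complex.re_sum, Complex.im_sum]
    simp only [Complex.exp_ofReal_mul_I_re, Complex.exp_ofReal_mul_I_im]
    ring
  rw [h1]
  have h2 : ∀ i j, 1 - Real.cos (θ * (y i - y j)) = 1 -
      (Real.cos (θ * y i) * Real.cos (θ * y j) + Real.sin (θ * y i) * Real.sin (θ * y j)) := by
    intro i j; rw [mul_sub, Real.cos_sub]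
  simp only [h2, Finset.sum_sub_distrib, Finset.sum_add_distrib, ← Finset.mul_sum, ← Finset.sum_mul]
  simp; ring

lemma Sy_mult (y : Fin n → ℝ) (θ : ℝ) (m : ℕ) :
    (n : ℝ) ^ 2 - Sy y (m * θ) ^ 2 ≤ m ^ 2 * ((n : ℝ) ^ 2 - Sy y θ ^ 2) := by
  rw [Sy_sq, Sy_sq, Finset.mul_sum]
  refine Finset.sum_le_sum fun i _ => ?_
  rw [Finset.mul_sum]
  refine Finset.sum_le_sum fun j _ => ?_
  rw [mul_assoc]; exact one_sub_cos_mul m _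

lemma Sy_shift (y : Fin n → ℝ) (c θ : ℝ) : Sy (fun j => c + y j) θ = Sy y θ := by
  have h := Sy_sq (fun j => c + y j) θ
  have h2 := Sy_sq y θ
  simp only [add_sub_add_left_eq_sub] at h
  have : Sy (fun j => c + y j) θ ^ 2 = Sy y θ ^ 2 := by linarith
  exact (sq_eq_sq₀ (Sy_nonneg _ _) (Sy_nonneg _ _)).1 this

/-- Covering of the large spectrum. -/
lemma freq_cover {k : ℕ} {y : Fin n → ℝ} {N : ℝ} (hN : 0 < N) (h : FreqGood k y N) :
    ∃ m, m < k ∧ ∃ t : Fin m → ℝ, ∀ θ, |θ| ≤ 1 → Real.exp (-400) * n ≤ Sy y θ → ∃ i, |θ - t i| ≤ k / N := by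
  classical
  let P : ℕ → Prop := fun m => ∃ t : Fin m → ℝ, (∀ i, |t i| ≤ 1) ∧ (∀ i j, i ≠ j → k / N ≤ |t i - t j|) ∧
    ∀ i, Real.exp (-400) * n ≤ Sy y (t i)
  have hP0 : P 0 := ⟨Fin.elim0, fun i => i.elim0, fun i => i.elim0, fun i => i.elim0⟩
  have hPk : ¬ P k := h
  have : ∃ m, m < k ∧ P m ∧ ¬ P (m + 1) := by
    by_contra hcon
    push Not at hcon
    have : ∀ m, m ≤ k → P m := by
      intro m
      induction m with
      | zero => intro _; exact hP0
      | succ m ih => intro hm; exact hcon m (by omega) (ih (by omega))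
    exact hPk (this k le_rfl)
  obtain ⟨m, hm, ⟨t, h1, h2, h3⟩, hn⟩ := this
  refine ⟨m, hm, t, fun θ hθ hS => ?_⟩
  by_contra hcon
  push Not at hcon
  apply hn
  refine ⟨Fin.cons θ t, ?_, ?_, ?_⟩
  · intro i; refine Fin.cases ?_ (fun i => ?_) i
    · simpa using hθ
    · simpa using h1 i
  · intro i j
    refine Fin.cases ?_ (fun i => ?_) i <;> refine Fin.cases ?_ (fun j => ?_) j
    · intro h; exact absurd rfl h
    · intro _; simpa using (hcon j).le
    · intro _; simp only [Fin.cons_succ, Fin.cons_zero]; rw [abs_sub_comm]; exact (hcon i).le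
    · intro hij; simp only [Fin.cons_succ]; exact h2 i j (fun h => hij (by rw [h]))
  · intro i; refine Fin.cases ?_ (fun i => ?_) i
    · simpa using hS
    · simpa using h3 i

/-- Middle frequencies. -/
lemma freq_mid {k j0 : ℕ} {y : Fin n → ℝ} {N H : ℝ} (hk : 1 ≤ k) (hj : 1 ≤ j0) (hH : 0 < H) (hN : 0 < N) (hkH : k * H ≤ j0)
    (h : FreqGood k y N) {θ : ℝ} (h1 : 1 ≤ |θ| * (H * N)) (h2 : |θ| * (k * j0) ≤ 1) :
    n / (4 * (k * j0) ^ 2) ≤ n - Sy y θ := by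
  unfold FreqGood at h
  push Not at h
  have hk0 : (0 : ℝ) < k := by exact_mod_cast hk
  have hj0 : (0 : ℝ) < j0 := by exact_mod_cast hj
  obtain ⟨i, hi⟩ := h (fun i => (((i.val + 1) * j0 : ℕ) : ℝ) * θ) (by
    intro i
    rw [abs_mul, Nat.abs_cast]
    refine le_trans ?_ h2
    have : (((i.val + 1) * j0 : ℕ) : ℝ) ≤ k * j0 := by
      exact_mod_cast Nat.mul_le_mul_right _ i.isLt
    rw [mul_comm]; gcongr) (by
    intro i j hij
    rw [← sub_mul, abs_mul]
    have h3 : (1 : ℝ) ≤ |(i.val : ℝ) - j.val| := by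
      have : (1 : ℤ) ≤ |(i.val : ℤ) - j.val| := Int.one_le_abs (by
        have : i.val ≠ j.val := fun h => hij (Fin.ext h)
        omega)
      exact_mod_cast this
    have h4 : |(((i.val + 1) * j0 : ℕ) : ℝ) - (((j.val + 1) * j0 : ℕ) : ℝ)| = |(i.val : ℝ) - j.val| * j0 := by
      push_cast
      rw [← sub_mul, abs_mul, abs_of_pos hj0]; ring_nf
    rw [h4, div_le_iff₀ hN]
    calc (k : ℝ) ≤ k * (|θ| * (H * N)) := by nlinarith
      _ = 1 * (k * H) * |θ| * N := by ring
      _ ≤ |(i.val : ℝ) - j.val| * j0 * |θ| * N := by gcongr)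
  have hm := Sy_mult y θ ((i.val + 1) * j0)
  set m := (i.val + 1) * j0 with hmd
  have hmk : (m : ℝ) ≤ k * j0 := by exact_mod_cast Nat.mul_le_mul_right _ i.isLt
  have hm0 : (0 : ℝ) ≤ m := by positivity
  have hSn := Sy_le y θ
  have hS0 := Sy_nonneg y θ
  have he : Real.exp (-400) ≤ 1 / 2 := by
    have h1 := Real.add_one_le_exp (400 : ℝ)
    rw [Real.exp_neg, ← one_div]
    exact one_div_le_one_div_of_le (by norm_num) (by linarith)
  have hn0 : (0 : ℝ) ≤ n := by positivity
  have h5 : Sy y (m * θ) ≤ 1 / 2 * n := hi.le.trans (by gcongr)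
  have h6 : Sy y (m * θ) ^ 2 ≤ (1 / 2 * n) ^ 2 := by
    have := Sy_nonneg y (m * θ)
    gcongr
  have h7 : (m : ℝ) ^ 2 * ((n : ℝ) ^ 2 - Sy y θ ^ 2) ≤ (k * j0) ^ 2 * ((n : ℝ) ^ 2 - Sy y θ ^ 2) := by
    have : 0 ≤ (n : ℝ) ^ 2 - Sy y θ ^ 2 := by nlinarith
    gcongr
  have h8 : (n : ℝ) ^ 2 - Sy y θ ^ 2 ≤ 2 * n * (n - Sy y θ) := by nlinarith
  rcases hn0.eq_or_lt with hz | hz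
  · rw [← hz] at hSn ⊢; simp; linarith
  · rw [div_le_iff₀ (by positivity)]
    have h9 : (n : ℝ) * n ≤ n * ((n - Sy y θ) * (4 * (k * j0) ^ 2)) := by
      have : (k * j0 : ℝ) ^ 2 * ((n : ℝ) ^ 2 - Sy y θ ^ 2) ≤ (k * j0 : ℝ) ^ 2 * (2 * n * (n - Sy y θ)) := by gcongr
      nlinarith
    exact le_of_mul_le_mul_left h9 hz
end
end SB

set_option linter.all false
namespace SB
open Finset

/-- Integrable with a bound on the integral. -/
def IB (f : ℝ → ℝ) (c : ℝ) : Prop := Integrable f gam ∧ ∫ g, f g ∂gam ≤ c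

lemma IB.add {f g : ℝ → ℝ} {a b : ℝ} (hf : IB f a) (hg : IB g b) : IB (fun x => f x + g x) (a + b) := by
  refine ⟨hf.1.add hg.1, ?_⟩
  rw [integral_add hf.1 hg.1]
  exact add_le_add hf.2 hg.2

lemma IB.sum {m : ℕ} {f : Fin m → ℝ → ℝ} {a : ℝ} (hf : ∀ i, IB (f i) a) : IB (fun x => ∑ i, f i x) (m * a) := by
  refine ⟨integrable_finsetSum _ fun i _ => (hf i).1, ?_⟩
  rw [integral_finsetSum _ fun i _ => (hf i).1]
  refine (Finset.sum_le_sum fun i _ => (hf i).2).trans ?_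
  simp

lemma IB.const (c : ℝ) : IB (fun _ => c) c := by
  refine ⟨integrable_const _, ?_⟩
  simp

lemma IB.mono {f : ℝ → ℝ} {a b : ℝ} (hf : IB f a) (h : a ≤ b) : IB f b := ⟨hf.1, hf.2.trans h⟩

lemma IB.mul {f : ℝ → ℝ} {a c : ℝ} (hf : IB f a) (hc : 0 ≤ c) : IB (fun x => c * f x) (c * a) := by
  refine ⟨hf.1.const_mul c, ?_⟩
  rw [integral_const_mul]
  exact mul_le_mul_of_nonneg_left hf.2 hc

lemma IB.ind {J : Set ℝ} (hJ : MeasurableSet J) {a b s : ℝ} (hab : a ≤ b) (h1 : J ⊆ Set.Icc a b) (h2 : ∀ g ∈ J, s ^ 2 ≤ g ^ 2) :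
    IB (fun g => SB.ind (g ∈ J)) (Real.exp (-(s ^ 2 / 2)) * (b - a)) := by
  have e : (fun g => SB.ind (g ∈ J)) = J.indicator (fun _ => (1 : ℝ)) := by
    ext g; by_cases h : g ∈ J <;> simp [SB.ind, h]
  rw [e]
  refine ⟨(integrable_const _).indicator hJ, ?_⟩
  rw [integral_indicator_const _ hJ]
  simpa using gam_set hJ hab h1 h2

lemma IB.gauss {b : ℝ} (hb : -(1 / 2) < b) : IB (fun g => Real.exp (-(b * g ^ 2))) (1 / Real.sqrt (1 + 2 * b)) :=
  ⟨gam_exp_sq_int hb, (gam_exp_sq hb).le⟩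

section
variable {p : ℝ} {n : ℕ}

lemma IB_near {N : ℝ} (hN : 0 < N) : IB (fun g => Real.exp (-(0.000000000000000001 * N ^ 2 / 32 * g ^ 2))) (4000000000 / N) := by
  refine (IB.gauss (b := 0.000000000000000001 * N ^ 2 / 32) ?_).mono ?_
  · have : 0 ≤ 0.000000000000000001 * N ^ 2 / 32 := by positivity
    linarith
  · have h1 : N / 4000000000 ≤ Real.sqrt (1 + 2 * (0.000000000000000001 * N ^ 2 / 32)) := by
      apply Real.le_sqrt_of_sq_le
      rw [div_pow]
      norm_num
      linarith
    calc _ ≤ 1 / (N / 4000000000) := by gcongr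
      _ = _ := by rw [one_div_div]

lemma IB_tail : IB (fun g => Real.exp (-(-(1 / 4) * g ^ 2))) 2 := by
  refine (IB.gauss (b := -(1 / 4)) (by norm_num)).mono ?_
  have : (1 / 2 : ℝ) ≤ Real.sqrt (1 + 2 * (-(1 / 4))) := by
    apply Real.le_sqrt_of_sq_le; norm_num
  calc _ ≤ 1 / (1 / 2 : ℝ) := by gcongr
    _ = 2 := by norm_num

lemma ind_nn (S : Prop) : 0 ≤ ind S := by by_cases h : S <;> simp [ind, h]

lemma phi_near (h0 : 0 < p) (h1 : p ≤ 1 / 2) (hd : 0 < p * n) {H N : ℝ} {y : Fin n → ℝ} (hnear : NearZero H y N) {g : ℝ}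
    (hg : |g / (4 * Real.sqrt (p * n))| * (H * N) ≤ 1) :
    phi p y (g / (4 * Real.sqrt (p * n))) ≤ Real.exp (-(0.000000000000000001 * N ^ 2 / 32 * g ^ 2)) + 2 * Real.exp (-(0.9 * (p * n))) := by
  refine (phi_le_char h0.le h1 y _).trans (add_le_add ?_ le_rfl)
  rw [Real.exp_le_exp, neg_le_neg_iff]
  have h := hnear _ hg
  have h2 : (g / (4 * Real.sqrt (p * n))) ^ 2 = g ^ 2 / (16 * (p * n)) := by
    rw [div_pow, mul_pow, Real.sq_sqrt hd.le]; norm_num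
  have h3 := mul_le_mul_of_nonneg_left h (by linarith : 0 ≤ p / 2)
  refine le_trans (le_of_eq ?_) h3
  rw [mul_pow, h2]
  have hn : (n : ℝ) ≠ 0 := by rintro h; rw [h] at hd; simp at hd
  field_simp
  norm_num
  ring

set_option maxHeartbeats 1000000 in
lemma rho_bound {k j0 : ℕ} {H N : ℝ} (hk : 1 ≤ k) (hj : 1 ≤ j0) (hH : 8 ≤ H) (hN : 0 < N) (hkH : k * H ≤ j0)
    (h0 : 0 < p) (hp : p ≤ Real.exp (-800)) (hp1 : p ≤ 1 / 2) (hd : 0 < p * n) {y : Fin n → ℝ} (hnear : NearZero H y N)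
    (hF : FreqGood k y N) (hNd : N ≤ Real.exp (2 * (p * n))) (hn : (n : ℝ) + 1 ≤ Real.exp (p * n / 2))
    (c1 : 8 * k ^ 2 * Real.sqrt (p * n) * (Real.exp (-(p / 2 * (n / (4 * (k * j0) ^ 2)))) + 2 * Real.exp (-(0.9 * (p * n)))) ≤ 1)
    (c2 : 8 * k ^ 2 * Real.sqrt (p * n) * Real.exp (-(8 * (p * n) / (k * j0) ^ 2)) ≤ 1)
    (c3 : 2 * Real.exp (-(2 * (p * n))) ≤ 1) (c4 : Real.sqrt (p * n) * (2 * Real.exp (-(0.9 * (p * n)))) ≤ 1) :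
    rho p y ≤ 5000000000 / N := by
  have hk0 : (0 : ℝ) < k := by exact_mod_cast hk
  have hj0 : (0 : ℝ) < j0 := by exact_mod_cast hj
  have hH0 : 0 < H := by linarith
  obtain ⟨m, hm, t, ht⟩ := freq_cover hN hF
  set s := 4 * Real.sqrt (p * n) with hs
  have hs0 : 0 < s := by have := Real.sqrt_pos.2 hd; linarith
  have hs2 : s ^ 2 = 16 * (p * n) := by rw [hs, mul_pow, Real.sq_sqrt hd.le]; norm_num
  let S1 : Set ℝ := Set.Icc (-(s / (H * N))) (s / (H * N))
  let J : Fin m → Set ℝ := fun i => Set.Icc (s * (t i - k / N)) (s * (t i + k / N))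
  let J' : Fin m → Set ℝ := fun i => J i ∩ {g | s / (k * j0) ≤ |g|}
  set η := Real.exp (-(p / 2 * (n / (4 * (k * j0) ^ 2)))) + 2 * Real.exp (-(0.9 * (p * n))) with hη
  have hη0 : 0 ≤ η := by positivity
  set P := 2 * Real.exp (-(0.9 * (p * n))) with hP
  have hP0 : 0 ≤ P := by positivity
  have hpt : ∀ g, phi p y (g / s) ≤ Real.exp (-(0.000000000000000001 * N ^ 2 / 32 * g ^ 2)) + P * ind (g ∈ S1) +
      ∑ i, (η * ind (g ∈ J i) + ind (g ∈ J' i)) + (n + 1) * Real.exp (-(2.5 * (p * n))) +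
        Real.exp (-(4 * (p * n))) * Real.exp (-(-(1 / 4) * g ^ 2)) := by
    intro g
    have a1 : 0 ≤ Real.exp (-(0.000000000000000001 * N ^ 2 / 32 * g ^ 2)) := (Real.exp_pos _).le
    have a2 : 0 ≤ P * ind (g ∈ S1) := mul_nonneg hP0 (ind_nn _)
    have a3 : ∀ i, 0 ≤ η * ind (g ∈ J i) + ind (g ∈ J' i) := fun i => add_nonneg (mul_nonneg hη0 (ind_nn _)) (ind_nn _)
    have a3' : 0 ≤ ∑ i, (η * ind (g ∈ J i) + ind (g ∈ J' i)) := Finset.sum_nonneg fun i _ => a3 i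
    have a4 : 0 ≤ ((n : ℝ) + 1) * Real.exp (-(2.5 * (p * n))) := by positivity
    have a5 : 0 ≤ Real.exp (-(4 * (p * n))) * Real.exp (-(-(1 / 4) * g ^ 2)) := by positivity
    have hone := phi_le_one h0.le (by linarith) y (g / s)
    have hgs : |g / s| = |g| / s := by rw [abs_div, abs_of_pos hs0]
    rcases le_or_gt (|g / s| * (H * N)) 1 with c | c
    · have := phi_near h0 hp1 hd hnear c
      have hmem : g ∈ S1 := by
        rw [hgs] at c
        show g ∈ Set.Icc _ _
        rw [Set.mem_Icc, ← abs_le, le_div_iff₀ (by positivity)]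
        rw [div_mul_eq_mul_div, div_le_iff₀ hs0] at c
        linarith
      rw [ind_true hmem]
      linarith
    rcases lt_or_ge 1 (|g / s|) with c' | c'
    · have : 1 ≤ Real.exp (-(4 * (p * n))) * Real.exp (-(-(1 / 4) * g ^ 2)) := by
        rw [← Real.exp_add]
        apply Real.one_le_exp
        rw [hgs, lt_div_iff₀ hs0, one_mul] at c'
        have : s ^ 2 ≤ g ^ 2 := by rw [← sq_abs g]; gcongr
        linarith
      linarith
    rcases lt_or_ge (Sy y (g / s)) (Real.exp (-400) * n) with c4 | c4
    · have := phi_le_tilt h0.le (by linarith) hp y (g / s) c4.le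
      linarith
    obtain ⟨i, hi⟩ := ht _ c' c4
    have hmem : g ∈ J i := by
      have := abs_le.1 hi
      show g ∈ Set.Icc _ _
      rw [Set.mem_Icc]
      have e : g = s * (g / s) := by field_simp
      constructor
      · rw [e]; gcongr; linarith [this.1]
      · conv_lhs => rw [e]
        gcongr; linarith [this.2]
    have hsum : η * ind (g ∈ J i) + ind (g ∈ J' i) ≤ ∑ i, (η * ind (g ∈ J i) + ind (g ∈ J' i)) :=
      Finset.single_le_sum (f := fun i => η * ind (g ∈ J i) + ind (g ∈ J' i)) (fun i _ => a3 i) (mem_univ i)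
    rw [ind_true hmem] at hsum
    rcases le_or_gt (|g / s| * (k * j0)) 1 with c5 | c5
    · have h3 := freq_mid hk hj hH0 hN hkH hF c.le c5
      have h4 := phi_le_char h0.le hp1 y (g / s)
      have h5 : phi p y (g / s) ≤ η := by
        refine h4.trans ?_
        rw [hη]; gcongr
      have := ind_nn (g ∈ J' i)
      linarith
    · have hmem' : g ∈ J' i := by
        refine ⟨hmem, ?_⟩
        rw [hgs, div_mul_eq_mul_div, lt_div_iff₀ hs0] at c5
        show s / (k * j0) ≤ |g|
        rw [div_le_iff₀ (by positivity)]
        linarith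
      rw [ind_true hmem'] at hsum
      linarith
  have i1 := IB_near hN
  have i2 : IB (fun g => P * ind (g ∈ S1)) (1 / N) := by
    refine ((IB.ind (J := S1) (a := -(s / (H * N))) (b := s / (H * N)) (s := 0) measurableSet_Icc ?_ subset_rfl
      (by intro g _; nlinarith [sq_nonneg g])).mul hP0).mono ?_
    · have : 0 ≤ s / (H * N) := by positivity
      linarith
    · have e : P * (Real.exp (-(0 ^ 2 / 2)) * (s / (H * N) - -(s / (H * N)))) = (Real.sqrt (p * n) * P) * (8 / H) / N := by
        rw [hs]; norm_num; ring
      rw [e]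
      have : 8 / H ≤ 1 := by rw [div_le_one hH0]; exact hH
      have h8 : 0 ≤ 8 / H := by positivity
      have h9 : 0 ≤ Real.sqrt (p * n) * P := by positivity
      gcongr
      nlinarith
  have hJm : ∀ i, MeasurableSet (J i) := fun i => measurableSet_Icc
  have hkN : 0 ≤ k / N := by positivity
  have hJle : ∀ i, s * (t i - k / N) ≤ s * (t i + k / N) := fun i => by gcongr; linarith
  have i3 : IB (fun g => ∑ i, (η * ind (g ∈ J i) + ind (g ∈ J' i))) (2 / N) := by
    have h := IB.sum (m := m) (f := fun i g => η * ind (g ∈ J i) + ind (g ∈ J' i))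
      (a := η * (8 * k * Real.sqrt (p * n) / N) + Real.exp (-(8 * (p * n) / (k * j0) ^ 2)) * (8 * k * Real.sqrt (p * n) / N)) (by
        intro i
        refine IB.add ?_ ?_
        · refine ((IB.ind (J := J i) (s := 0) (hJm i) (hJle i) subset_rfl (by intro g _; nlinarith [sq_nonneg g])).mul hη0).mono
            (le_of_eq ?_)
          rw [hs]; norm_num; left; ring
        · refine (IB.ind (J := J' i) (s := s / (k * j0)) ((hJm i).inter ?_) (hJle i) Set.inter_subset_left ?_).mono (le_of_eq ?_)
          · exact measurableSet_le measurable_const measurable_abs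
          · intro g hg
            have : s / (k * j0) ≤ |g| := hg.2
            rw [← sq_abs g]; gcongr
          · have e1 : (s / (k * j0 : ℝ)) ^ 2 / 2 = 8 * (p * n) / (k * j0) ^ 2 := by
              rw [div_pow, hs2]; ring
            rw [e1, hs]; ring)
    refine h.mono ?_
    have hmk : (m : ℝ) ≤ k := by exact_mod_cast hm.le
    have hA : 0 ≤ η * (8 * k * Real.sqrt (p * n) / N) + Real.exp (-(8 * (p * n) / (k * j0) ^ 2)) * (8 * k * Real.sqrt (p * n) / N) := by
      positivity
    calc _ ≤ k * (η * (8 * k * Real.sqrt (p * n) / N) + Real.exp (-(8 * (p * n) / (k * j0) ^ 2)) * (8 * k * Real.sqrt (p * n) / N)) := by gcongr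
      _ = (8 * k ^ 2 * Real.sqrt (p * n) * η + 8 * k ^ 2 * Real.sqrt (p * n) * Real.exp (-(8 * (p * n) / (k * j0) ^ 2))) / N := by ring
      _ ≤ (1 + 1) / N := by gcongr
      _ = _ := by norm_num
  have hNi : Real.exp (-(2 * (p * n))) ≤ 1 / N := by
    rw [Real.exp_neg, ← one_div]
    exact one_div_le_one_div_of_le hN hNd
  have i4 : IB (fun _ => ((n : ℝ) + 1) * Real.exp (-(2.5 * (p * n)))) (1 / N) := by
    refine (IB.const _).mono ?_
    refine le_trans ?_ hNi
    calc _ ≤ Real.exp (p * n / 2) * Real.exp (-(2.5 * (p * n))) := by gcongr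
      _ = _ := by rw [← Real.exp_add]; congr 1; ring
  have i5 : IB (fun g => Real.exp (-(4 * (p * n))) * Real.exp (-(-(1 / 4) * g ^ 2))) (1 / N) := by
    refine (IB_tail.mul (Real.exp_pos _).le).mono ?_
    refine le_trans ?_ hNi
    have : Real.exp (-(4 * (p * n))) = Real.exp (-(2 * (p * n))) * Real.exp (-(2 * (p * n))) := by
      rw [← Real.exp_add]; congr 1; ring
    rw [this]
    have := Real.exp_pos (-(2 * (p * n)))
    nlinarith
  have itot := (((i1.add i2).add i3).add i4).add i5
  refine (rho_le_phi h0.le hd y).trans ((integral_mono (phi_int h0.le (by linarith) y _) itot.1 hpt).trans (itot.2.trans ?_))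
  rw [← add_div, ← add_div, ← add_div, ← add_div]
  gcongr
  norm_num

lemma rho_base {H N : ℝ} (hH : 8 ≤ H) (hN : 0 < N)
    (h0 : 0 < p) (hp1 : p ≤ 1 / 2) (hd : 0 < p * n) {y : Fin n → ℝ} (hnear : NearZero H y N)
    (c1 : 2 * Real.exp (-(4 * (p * n) / (H * N) ^ 2)) ≤ 1 / N) (c4 : Real.sqrt (p * n) * (2 * Real.exp (-(0.9 * (p * n)))) ≤ 1) :
    rho p y ≤ 5000000000 / N := by
  have hH0 : 0 < H := by linarith
  set s := 4 * Real.sqrt (p * n) with hs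
  have hs0 : 0 < s := by have := Real.sqrt_pos.2 hd; linarith
  have hs2 : s ^ 2 = 16 * (p * n) := by rw [hs, mul_pow, Real.sq_sqrt hd.le]; norm_num
  let S1 : Set ℝ := Set.Icc (-(s / (H * N))) (s / (H * N))
  set P := 2 * Real.exp (-(0.9 * (p * n))) with hP
  have hP0 : 0 ≤ P := by positivity
  have hpt : ∀ g, phi p y (g / s) ≤ Real.exp (-(0.000000000000000001 * N ^ 2 / 32 * g ^ 2)) + P * ind (g ∈ S1) +
        Real.exp (-(4 * (p * n) / (H * N) ^ 2)) * Real.exp (-(-(1 / 4) * g ^ 2)) := by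
    intro g
    have a1 : 0 ≤ Real.exp (-(0.000000000000000001 * N ^ 2 / 32 * g ^ 2)) := (Real.exp_pos _).le
    have a2 : 0 ≤ P * ind (g ∈ S1) := mul_nonneg hP0 (ind_nn _)
    have a5 : 0 ≤ Real.exp (-(4 * (p * n) / (H * N) ^ 2)) * Real.exp (-(-(1 / 4) * g ^ 2)) := by positivity
    have hone := phi_le_one h0.le (by linarith) y (g / s)
    have hgs : |g / s| = |g| / s := by rw [abs_div, abs_of_pos hs0]
    rcases le_or_gt (|g / s| * (H * N)) 1 with c | c
    · have := phi_near h0 hp1 hd hnear c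
      have hmem : g ∈ S1 := by
        rw [hgs] at c
        show g ∈ Set.Icc _ _
        rw [Set.mem_Icc, ← abs_le, le_div_iff₀ (by positivity)]
        rw [div_mul_eq_mul_div, div_le_iff₀ hs0] at c
        linarith
      rw [ind_true hmem]
      linarith
    · have : 1 ≤ Real.exp (-(4 * (p * n) / (H * N) ^ 2)) * Real.exp (-(-(1 / 4) * g ^ 2)) := by
        rw [← Real.exp_add]
        apply Real.one_le_exp
        rw [hgs, div_mul_eq_mul_div, lt_div_iff₀ hs0, one_mul] at c
        have : s ^ 2 ≤ (|g| * (H * N)) ^ 2 := by gcongr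
        rw [mul_pow |g|, sq_abs, hs2] at this
        have h5 : 16 * (p * n) / (H * N) ^ 2 ≤ g ^ 2 := by
          rw [div_le_iff₀ (by positivity)]; linarith
        have h6 : 4 * (p * n) / (H * N) ^ 2 = (16 * (p * n) / (H * N) ^ 2) / 4 := by ring
        rw [h6]
        linarith
      linarith
  have i1 := IB_near hN
  have i2 : IB (fun g => P * ind (g ∈ S1)) (1 / N) := by
    refine ((IB.ind (J := S1) (a := -(s / (H * N))) (b := s / (H * N)) (s := 0) measurableSet_Icc ?_ subset_rfl
      (by intro g _; nlinarith [sq_nonneg g])).mul hP0).mono ?_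
    · have : 0 ≤ s / (H * N) := by positivity
      linarith
    · have e : P * (Real.exp (-(0 ^ 2 / 2)) * (s / (H * N) - -(s / (H * N)))) = (Real.sqrt (p * n) * P) * (8 / H) / N := by
        rw [hs]; norm_num; ring
      rw [e]
      have : 8 / H ≤ 1 := by rw [div_le_one hH0]; exact hH
      have h8 : 0 ≤ 8 / H := by positivity
      have h9 : 0 ≤ Real.sqrt (p * n) * P := by positivity
      gcongr
      nlinarith
  have i5 : IB (fun g => Real.exp (-(4 * (p * n) / (H * N) ^ 2)) * Real.exp (-(-(1 / 4) * g ^ 2))) (1 / N) := by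
    refine (IB_tail.mul (Real.exp_pos _).le).mono ?_
    linarith
  have itot := (i1.add i2).add i5
  refine (rho_le_phi h0.le hd y).trans ((integral_mono (phi_int h0.le (by linarith) y _) itot.1 hpt).trans (itot.2.trans ?_))
  rw [← add_div, ← add_div]
  gcongr
  norm_num
end
end SB

set_option linter.all false
namespace SB
open Finset

/-- Cut-off constant. -/
noncomputable def HH : ℝ := Real.exp 40000000

lemma HH_ge : (8 : ℝ) ≤ HH := by
  unfold HH
  have := Real.add_one_le_exp (40000000 : ℝ)
  linarith

lemma log_HH : Real.log HH = 40000000 := Real.log_exp _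

lemma near_of_prof {n : ℕ} {u : Fin n → ℝ} {σ lam : ℝ} (hP : Prof u σ lam) {N : ℝ} (hN : 64000 ≤ N) (z : Fin n → ℝ)
    (hz : ∀ j, |z j - N / σ * (u j - lam)| ≤ 1) : NearZero HH z N := by
  classical
  intro θ hθ
  have hσ := hP.pos
  have hH := HH_ge
  have hn0 : (0 : ℝ) ≤ n := by positivity
  set B := univ.filter fun j => HH * σ < |u j - lam| with hB
  have hBc : (B.card : ℝ) ≤ n / 4000000 := by
    have h1 : (B.card : ℝ) * 40000000 ≤ ∑ j ∈ B, Real.log (1 + |u j - lam| / σ) := by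
      rw [← nsmul_eq_mul]
      refine Finset.card_nsmul_le_sum _ _ _ fun j hj => ?_
      have h2 := (mem_filter.1 hj).2
      rw [← log_HH]
      refine Real.log_le_log (by linarith) ?_
      have : HH ≤ |u j - lam| / σ := by rw [le_div_iff₀ hσ]; exact h2.le
      linarith
    have h2 : ∑ j ∈ B, Real.log (1 + |u j - lam| / σ) ≤ ∑ j, Real.log (1 + |u j - lam| / σ) :=
      Finset.sum_le_sum_of_subset_of_nonneg (subset_univ _) fun j _ _ => Real.log_nonneg (by
        have : 0 ≤ |u j - lam| / σ := by positivity
        linarith)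
    have := hP.psi
    linarith
  -- the key pair bound
  have key : ∀ S T : Finset (Fin n), (n : ℝ) / 2000000 ≤ S.card → (n : ℝ) / 2 ≤ T.card →
      (∀ i ∈ S, ∀ j ∈ T, σ / 16000 ≤ |u i - u j|) → 0.000000000000000001 * (N * θ) ^ 2 * n ≤ n - Sy z θ := by
    intro S T hS hT hST
    have hS' : (n : ℝ) / 4000000 ≤ (S \ B).card := by
      have : S.card ≤ (S \ B).card + B.card := by
        have := Finset.card_le_card (show S ⊆ (S \ B) ∪ B from fun x hx => by
          by_cases h : x ∈ B <;> simp [h, hx])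
        exact this.trans (card_union_le _ _)
      have : (S.card : ℝ) ≤ (S \ B).card + B.card := by exact_mod_cast this
      linarith
    have hT' : (n : ℝ) / 4 ≤ (T \ B).card := by
      have : T.card ≤ (T \ B).card + B.card := by
        have := Finset.card_le_card (show T ⊆ (T \ B) ∪ B from fun x hx => by
          by_cases h : x ∈ B <;> simp [h, hx])
        exact this.trans (card_union_le _ _)
      have : (T.card : ℝ) ≤ (T \ B).card + B.card := by exact_mod_cast this
      linarith
    have hpair : ∀ i ∈ S \ B, ∀ j ∈ T \ B, 0.00000000019 * (N * θ) ^ 2 ≤ 1 - Real.cos (θ * (z i - z j)) := by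
      intro i hi j hj
      rw [mem_sdiff] at hi hj
      have hiB : |u i - lam| ≤ HH * σ := by
        have := hi.2; rw [hB, mem_filter] at this; push Not at this; exact this (mem_univ _)
      have hjB : |u j - lam| ≤ HH * σ := by
        have := hj.2; rw [hB, mem_filter] at this; push Not at this; exact this (mem_univ _)
      have hij := hST i hi.1 j hj.1
      have hzi := abs_le.1 (hz i)
      have hzj := abs_le.1 (hz j)
      have hNσ : 0 < N / σ := by positivity
      have e : N / σ * (u i - lam) - N / σ * (u j - lam) = N / σ * (u i - u j) := by ring
      have hd : |(z i - z j) - N / σ * (u i - u j)| ≤ 2 := by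
        rw [abs_le]; constructor <;> linarith [hzi.1, hzi.2, hzj.1, hzj.2]
      have hab : |N / σ * (u i - u j)| = N / σ * |u i - u j| := by rw [abs_mul, abs_of_pos hNσ]
      have hlow : N / 16000 ≤ N / σ * |u i - u j| := by
        calc N / 16000 = N / σ * (σ / 16000) := by field_simp
          _ ≤ _ := by gcongr
      have hup : N / σ * |u i - u j| ≤ 2 * (HH * N) := by
        have : |u i - u j| ≤ 2 * (HH * σ) := by
          have : u i - u j = (u i - lam) - (u j - lam) := by ring
          rw [this]
          refine (abs_sub _ _).trans (by linarith)
        calc _ ≤ N / σ * (2 * (HH * σ)) := by gcongr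
          _ = _ := by field_simp
      have t1 := abs_sub_abs_le_abs_sub (N / σ * (u i - u j)) (z i - z j)
      have t2 := abs_sub_abs_le_abs_sub (z i - z j) (N / σ * (u i - u j))
      rw [abs_sub_comm (N / σ * (u i - u j)) (z i - z j), hab] at t1
      rw [hab] at t2
      have l1 : N / 32000 ≤ |z i - z j| := by linarith
      have l2 : |z i - z j| ≤ 3 * (HH * N) := by nlinarith
      have l3 : |θ * (z i - z j)| ≤ Real.pi := by
        rw [abs_mul]
        have := Real.pi_gt_three
        have : |θ| * |z i - z j| ≤ |θ| * (3 * (HH * N)) := by gcongr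
        linarith
      have hc := Real.cos_le_one_sub_mul_cos_sq l3
      have hpi : (0.2 : ℝ) ≤ 2 / Real.pi ^ 2 := by
        rw [le_div_iff₀ (by positivity)]
        have := Real.pi_lt_d2
        have := Real.pi_pos
        nlinarith
      have hsq : (N / 32000) ^ 2 * θ ^ 2 ≤ (θ * (z i - z j)) ^ 2 := by
        rw [mul_pow, ← sq_abs (z i - z j), mul_comm]
        gcongr
      have h0 : 0 ≤ (N / 32000) ^ 2 * θ ^ 2 := by positivity
      have h3 : 0.2 * ((N / 32000) ^ 2 * θ ^ 2) ≤ 2 / Real.pi ^ 2 * (θ * (z i - z j)) ^ 2 := by gcongr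
      have h4 : 0.00000000019 * (N * θ) ^ 2 ≤ 0.2 * ((N / 32000) ^ 2 * θ ^ 2) := by
        have : 0 ≤ N ^ 2 * θ ^ 2 := by positivity
        have e1 : 0.2 * ((N / 32000) ^ 2 * θ ^ 2) = 0.2 / 32000 ^ 2 * (N ^ 2 * θ ^ 2) := by ring
        have e2 : (0.00000000019 : ℝ) * (N * θ) ^ 2 = 0.00000000019 * (N ^ 2 * θ ^ 2) := by ring
        rw [e1, e2]
        gcongr
        norm_num
      linarith
    have hcos : ∀ i j, 0 ≤ 1 - Real.cos (θ * (z i - z j)) := fun i j => sub_nonneg.2 (Real.cos_le_one _)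
    have hsum : ((S \ B).card : ℝ) * ((T \ B).card * (0.00000000019 * (N * θ) ^ 2)) ≤ (n : ℝ) ^ 2 - Sy z θ ^ 2 := by
      rw [Sy_sq]
      calc _ = ∑ i ∈ S \ B, ∑ j ∈ T \ B, 0.00000000019 * (N * θ) ^ 2 := by simp only [sum_const, nsmul_eq_mul]
        _ ≤ ∑ i ∈ S \ B, ∑ j ∈ T \ B, (1 - Real.cos (θ * (z i - z j))) :=
            Finset.sum_le_sum fun i hi => Finset.sum_le_sum fun j hj => hpair i hi j hj
        _ ≤ ∑ i ∈ S \ B, ∑ j, (1 - Real.cos (θ * (z i - z j))) :=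
            Finset.sum_le_sum fun i hi => Finset.sum_le_sum_of_subset_of_nonneg (subset_univ _) fun j _ _ => hcos i j
        _ ≤ _ := Finset.sum_le_sum_of_subset_of_nonneg (subset_univ _) fun i _ _ => Finset.sum_nonneg fun j _ => hcos i j
    have hprod : (n : ℝ) / 4000000 * (n / 4 * (0.00000000019 * (N * θ) ^ 2)) ≤ (n : ℝ) ^ 2 - Sy z θ ^ 2 := by
      refine le_trans ?_ hsum
      gcongr
    have hSn := Sy_le z θ
    have hS0 := Sy_nonneg z θ
    rcases hn0.eq_or_lt with h | h
    · rw [← h] at hSn ⊢; simp; linarith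
    · have h8 : (n : ℝ) ^ 2 - Sy z θ ^ 2 ≤ 2 * n * (n - Sy z θ) := by nlinarith
      have h9 : (n : ℝ) * (0.000000000000000001 * (N * θ) ^ 2 * n) ≤ n * (n - Sy z θ) := by
        have h10 : 0 ≤ (n : ℝ) ^ 2 * (N * θ) ^ 2 := by positivity
        have e1 : (n : ℝ) / 4000000 * (n / 4 * (0.00000000019 * (N * θ) ^ 2)) = 0.00000000019 / 16000000 * ((n : ℝ) ^ 2 * (N * θ) ^ 2) := by ring
        have e2 : (n : ℝ) * (0.000000000000000001 * (N * θ) ^ 2 * n) = 0.000000000000000001 * ((n : ℝ) ^ 2 * (N * θ) ^ 2) := by ring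
        rw [e1] at hprod
        rw [e2]
        norm_num at hprod ⊢
        linarith
      exact le_of_mul_le_mul_left h9 h
  have hm1 : (n : ℝ) / 2 ≤ (univ.filter fun j => u j ≤ lam).card := by
    have : (n : ℝ) ≤ 2 * (univ.filter fun j => u j ≤ lam).card := by exact_mod_cast hP.med1
    linarith
  have hm2 : (n : ℝ) / 2 ≤ (univ.filter fun j => lam ≤ u j).card := by
    have : (n : ℝ) ≤ 2 * (univ.filter fun j => lam ≤ u j).card := by exact_mod_cast hP.med2
    linarith
  have hsplit : ((univ.filter fun j => σ / 16000 < |u j - lam|).card : ℝ) ≤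
      (univ.filter fun j => σ / 16000 < u j - lam).card + (univ.filter fun j => σ / 16000 < -(u j - lam)).card := by
    have := Finset.card_le_card (show (univ.filter fun j => σ / 16000 < |u j - lam|) ⊆
      (univ.filter fun j => σ / 16000 < u j - lam) ∪ (univ.filter fun j => σ / 16000 < -(u j - lam)) from fun x hx => by
        have := (mem_filter.1 hx).2
        rw [lt_abs] at this
        simpa using this)
    exact_mod_cast this.trans (card_union_le _ _)
  have hsp := hP.spread
  rcases le_or_gt ((n : ℝ) / 2000000) (univ.filter fun j => σ / 16000 < u j - lam).card with c | c
  · refine key _ _ c hm1 fun i hi j hj => ?_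
    have h1 := (mem_filter.1 hi).2
    have h2 := (mem_filter.1 hj).2
    refine le_trans ?_ (le_abs_self _)
    linarith
  · refine key (univ.filter fun j => σ / 16000 < -(u j - lam)) _ (by linarith) hm2 fun i hi j hj => ?_
    have h1 := (mem_filter.1 hi).2
    have h2 := (mem_filter.1 hj).2
    rw [abs_sub_comm]
    refine le_trans ?_ (le_abs_self _)
    linarith
end SB

set_option linter.all false
namespace SB
open Finset

lemma dirichlet_sum (φ ψ : ℝ) (M : ℕ) :
    2 * Real.sin (φ / 2) * ∑ z ∈ Finset.Icc (-(M : ℤ)) (M : ℤ), Real.cos (φ * z + ψ) =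
      Real.sin (φ * (M + 1 / 2) + ψ) - Real.sin (-(φ * (M + 1 / 2)) + ψ) := by
  have key : ∀ x : ℝ, 2 * Real.sin (φ / 2) * Real.cos (φ * x + ψ) =
      Real.sin (φ * (x + 1 / 2) + ψ) - Real.sin (φ * (x - 1 / 2) + ψ) := by
    intro x
    have e1 : φ * (x + 1 / 2) + ψ = (φ * x + ψ) + φ / 2 := by ring
    have e2 : φ * (x - 1 / 2) + ψ = (φ * x + ψ) - φ / 2 := by ring
    rw [e1, e2, Real.sin_add, Real.sin_sub]; ring
  induction M with
  | zero =>
    have := key 0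
    simp only [mul_zero, zero_add, zero_sub, mul_neg] at this
    simp
    rw [this]; ring_nf
  | succ M ih =>
    rw [sum_Icc_symm_succ (fun z : ℤ => Real.cos (φ * z + ψ)), mul_add, ih]
    have k1 := key (M + 1)
    have k2 := key (-(M + 1))
    push_cast
    rw [mul_add (2 * Real.sin (φ / 2)), k1, k2]
    have e1 : φ * ((M : ℝ) + 1 - 1 / 2) + ψ = φ * (M + 1 / 2) + ψ := by ring
    have e2 : φ * (-((M : ℝ) + 1) + 1 / 2) + ψ = -(φ * (M + 1 / 2)) + ψ := by ring
    have e3 : φ * (-((M : ℝ) + 1) - 1 / 2) + ψ = -(φ * (M + 1 + 1 / 2)) + ψ := by ring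
    rw [e1, e2, e3]; ring

lemma abel_bound (w D T : ℕ → ℝ) {B : ℝ} (hw : ∀ m, w (m + 1) ≤ w m) (hw0 : ∀ m, 0 ≤ w m)
    (hD : ∀ m, |D m| ≤ B) (h0 : T 0 = w 0 * D 0) (hs : ∀ m, T (m + 1) = T m + w (m + 1) * (D (m + 1) - D m))
    (M : ℕ) : |T M| ≤ w 0 * B := by
  have h : ∀ M, |T M - w M * D M| ≤ (w 0 - w M) * B := by
    intro M
    induction M with
    | zero => rw [h0]; simp
    | succ M ih =>
      have e : T (M + 1) - w (M + 1) * D (M + 1) = (T M - w M * D M) + (w M - w (M + 1)) * D M := by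
        rw [hs]; ring
      rw [e]
      refine (abs_add_le _ _).trans ?_
      rw [abs_mul, abs_of_nonneg (sub_nonneg.2 (hw M))]
      have := mul_le_mul_of_nonneg_left (hD M) (sub_nonneg.2 (hw M))
      linarith
  have h1 := h M
  have h2 : |w M * D M| ≤ w M * B := by
    rw [abs_mul, abs_of_nonneg (hw0 M)]
    exact mul_le_mul_of_nonneg_left (hD M) (hw0 M)
  have h3 : T M = (T M - w M * D M) + w M * D M := by ring
  rw [h3]
  refine (abs_add_le _ _).trans ?_
  linarith

lemma weight_fourier {N : ℝ} (hN : 0 < N) {φ : ℝ} (hφ0 : φ ≠ 0) (hφ : |φ| ≤ 2) (ψ : ℝ) (M : ℤ) :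
    |∑ z ∈ Finset.Icc (-M) M, ((1 + |(z : ℝ)| / N) ^ 2)⁻¹ * Real.cos (φ * z + ψ)| ≤ 4 / |φ| := by
  have hφp : 0 < |φ| := abs_pos.2 hφ0
  rcases lt_or_ge M 0 with h | h
  · rw [Finset.Icc_eq_empty (by omega)]; simp; positivity
  obtain ⟨M, rfl⟩ := Int.eq_ofNat_of_zero_le h
  have hsin : |φ| / 4 ≤ |Real.sin (φ / 2)| := by
    have := Real.mul_abs_le_abs_sin (x := φ / 2) (by rw [abs_div]; have := Real.pi_gt_three; norm_num; linarith)
    rw [abs_div] at this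
    have hpi := Real.pi_le_four
    have h2 : 2 / 4 * (|φ| / |2|) ≤ 2 / Real.pi * (|φ| / |2|) := by
      gcongr
    norm_num at h2 this ⊢
    linarith
  have hD : ∀ m : ℕ, |∑ z ∈ Finset.Icc (-(m : ℤ)) (m : ℤ), Real.cos (φ * z + ψ)| ≤ 4 / |φ| := by
    intro m
    have h1 := dirichlet_sum φ ψ m
    have h2 : |2 * Real.sin (φ / 2) * ∑ z ∈ Finset.Icc (-(m : ℤ)) (m : ℤ), Real.cos (φ * z + ψ)| ≤ 2 := by
      rw [h1]
      refine (abs_sub _ _).trans ?_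
      have := Real.abs_sin_le_one (φ * (m + 1 / 2) + ψ)
      have := Real.abs_sin_le_one (-(φ * (m + 1 / 2)) + ψ)
      linarith
    rw [abs_mul, abs_mul, abs_two] at h2
    rw [le_div_iff₀ hφp]
    have h3 := abs_nonneg (∑ z ∈ Finset.Icc (-(m : ℤ)) (m : ℤ), Real.cos (φ * z + ψ))
    nlinarith
  have := abel_bound (fun m => ((1 + (m : ℝ) / N) ^ 2)⁻¹)
    (fun m => ∑ z ∈ Finset.Icc (-(m : ℤ)) (m : ℤ), Real.cos (φ * z + ψ))
    (fun m => ∑ z ∈ Finset.Icc (-(m : ℤ)) (m : ℤ), ((1 + |(z : ℝ)| / N) ^ 2)⁻¹ * Real.cos (φ * z + ψ))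
    (B := 4 / |φ|) ?_ (fun m => by positivity) hD (by simp) ?_ M
  · simpa using this
  · intro m
    gcongr
    simp
  · intro m
    rw [sum_Icc_symm_succ (fun z : ℤ => ((1 + |(z : ℝ)| / N) ^ 2)⁻¹ * Real.cos (φ * z + ψ)),
      sum_Icc_symm_succ (fun z : ℤ => Real.cos (φ * z + ψ))]
    have e : |(((m : ℤ) + 1 : ℤ) : ℝ)| = ((m + 1 : ℕ) : ℝ) := by
      push_cast; exact abs_of_nonneg (by positivity)
    have e' : |((-((m : ℤ) + 1) : ℤ) : ℝ)| = ((m + 1 : ℕ) : ℝ) := by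
      push_cast; rw [abs_neg]; exact abs_of_nonneg (by positivity)
    rw [e, e']; ring

/-- weighted second moment of a sum of separated waves. -/
lemma wave_moment {k : ℕ} {N : ℝ} (hN : 1 ≤ N) (hk : 1 ≤ k) (θ ψ : Fin k → ℝ) (h1 : ∀ i, |θ i| ≤ 1)
    (hs : ∀ i j, i ≠ j → k / (2 * N) ≤ |θ i - θ j|) (M : ℤ) :
    ∑ z ∈ Finset.Icc (-M) M, ((1 + |(z : ℝ)| / N) ^ 2)⁻¹ * (∑ i, Real.cos (θ i * z + ψ i)) ^ 2 ≤ 11 * k * N := by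
  have hkr : (1 : ℝ) ≤ k := by exact_mod_cast hk
  have step : ∀ z : ℤ, (∑ i, Real.cos (θ i * z + ψ i)) ^ 2 ≤
      ∑ i, ∑ j, Real.cos ((θ i - θ j) * z + (ψ i - ψ j)) := by
    intro z
    have e : ∑ i, ∑ j, Real.cos ((θ i - θ j) * z + (ψ i - ψ j)) =
        (∑ i, Real.cos (θ i * z + ψ i)) ^ 2 + (∑ i, Real.sin (θ i * z + ψ i)) ^ 2 := by
      rw [sq, sq, Finset.sum_mul_sum, Finset.sum_mul_sum, ← Finset.sum_add_distrib]
      refine Finset.sum_congr rfl fun i _ => ?_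
      rw [← Finset.sum_add_distrib]
      refine Finset.sum_congr rfl fun j _ => ?_
      rw [← Real.cos_sub]; congr 1; ring
    rw [e]; nlinarith [sq_nonneg (∑ i, Real.sin (θ i * z + ψ i))]
  calc _ ≤ ∑ z ∈ Finset.Icc (-M) M, ((1 + |(z : ℝ)| / N) ^ 2)⁻¹ *
        ∑ i, ∑ j, Real.cos ((θ i - θ j) * z + (ψ i - ψ j)) := by
        refine Finset.sum_le_sum fun z _ => mul_le_mul_of_nonneg_left (step z) (by positivity)
    _ = ∑ i, ∑ j, ∑ z ∈ Finset.Icc (-M) M, ((1 + |(z : ℝ)| / N) ^ 2)⁻¹ *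
        Real.cos ((θ i - θ j) * z + (ψ i - ψ j)) := by
        simp only [Finset.mul_sum]
        rw [Finset.sum_comm]
        refine Finset.sum_congr rfl fun i _ => ?_
        rw [Finset.sum_comm]
    _ ≤ ∑ i : Fin k, ∑ j : Fin k, ((if i = j then 3 * N else 0) + 8 * N / k) := by
        refine Finset.sum_le_sum fun i _ => Finset.sum_le_sum fun j _ => ?_
        by_cases hij : i = j
        · subst hij
          simp only [sub_self, zero_mul, add_zero, Real.cos_zero, mul_one, if_true]
          have := sum_weight_two (by linarith : 0 < N) M
          have : 0 ≤ 8 * N / k := by positivity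
          linarith
        · rw [if_neg hij, zero_add]
          have hsij := hs i j hij
          have hpos : 0 < k / (2 * N) := by positivity
          have hne : θ i - θ j ≠ 0 := abs_pos.1 (hpos.trans_le hsij)
          have hle : |θ i - θ j| ≤ 2 := by
            refine (abs_sub _ _).trans ?_
            linarith [h1 i, h1 j]
          refine (le_abs_self _).trans ((weight_fourier (by linarith) hne hle _ M).trans ?_)
          calc 4 / |θ i - θ j| ≤ 4 / (k / (2 * N)) := by gcongr
            _ = 8 * N / k := by field_simp; norm_num
    _ = 11 * k * N := by
        simp only [Finset.sum_add_distrib, Finset.sum_ite_eq, mem_univ, if_true, Finset.sum_const, card_univ,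
          Fintype.card_fin, nsmul_eq_mul]
        field_simp; ring

end SB

set_option linter.all false
namespace SB
open Finset

lemma abs_cos_sub_cos_le' (a b : ℝ) : |Real.cos a - Real.cos b| ≤ |a - b| := by
  rw [Real.cos_sub_cos, abs_mul, abs_mul]
  have h1 := Real.abs_sin_le_one ((a + b) / 2)
  have h2 : |Real.sin ((a - b) / 2)| ≤ |(a - b) / 2| := Real.abs_sin_le_abs
  rw [abs_div, abs_two] at h2
  rw [abs_neg, abs_two]
  nlinarith [abs_nonneg (Real.sin ((a - b) / 2)), abs_nonneg (Real.sin ((a + b) / 2))]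

noncomputable def bet : ℝ := Real.exp (-400)
lemma bet_pos : 0 < bet := Real.exp_pos _
lemma bet_le : bet ≤ 1 := Real.exp_le_one_iff.2 (by norm_num)

noncomputable def H1 : ℝ := Real.exp (1280 * Real.exp 400)
lemma H1_ge : 1 ≤ H1 := Real.one_le_exp (by positivity)

noncomputable def GG (N : ℝ) : ℕ := ⌈8 * H1 * N / bet⌉₊

lemma GG_ge {N : ℝ} : 8 * H1 * N / bet ≤ GG N := Nat.le_ceil _

lemma GG_ge' {N : ℝ} (hN : 0 < N) : 4 * N ≤ GG N := by
  refine le_trans ?_ GG_ge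
  rw [le_div_iff₀ bet_pos]
  have := bet_le
  have := H1_ge
  have := bet_pos
  nlinarith [mul_pos hN bet_pos]

noncomputable def phs : Finset ℝ := {0, Real.pi, -(Real.pi / 2), Real.pi / 2}

lemma phs_card : phs.card ≤ 4 := Finset.card_le_four

lemma exists_phase {n : ℕ} (y : Fin n → ℝ) (t : ℝ) {c : ℝ} (h : c ≤ Sy y t) :
    ∃ ψ ∈ phs, c / 2 ≤ ∑ j, Real.cos (t * y j + ψ) := by
  set S := ∑ j, Complex.exp ((t * y j : ℝ) * Complex.I) with hS
  have hre : S.re = ∑ j, Real.cos (t * y j) := by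
    rw [hS, Complex.re_sum]
    exact Finset.sum_congr rfl fun j _ => Complex.exp_ofReal_mul_I_re _
  have him : S.im = ∑ j, Real.sin (t * y j) := by
    rw [hS, Complex.im_sum]
    exact Finset.sum_congr rfl fun j _ => Complex.exp_ofReal_mul_I_im _
  have hn : c ≤ |S.re| + |S.im| := h.trans (Complex.norm_le_abs_re_add_abs_im S)
  by_cases h1 : c / 2 ≤ |S.re|
  · rcases abs_cases S.re with ⟨e, _⟩ | ⟨e, _⟩
    · refine ⟨0, by simp [phs], ?_⟩
      rw [e, hre] at h1; simpa using h1
    · refine ⟨Real.pi, by simp [phs], ?_⟩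
      rw [e, hre] at h1
      simpa [Real.cos_add_pi] using h1
  · have h1 : c / 2 ≤ |S.im| := by linarith
    rcases abs_cases S.im with ⟨e, _⟩ | ⟨e, _⟩
    · refine ⟨-(Real.pi / 2), by simp [phs], ?_⟩
      rw [e, him] at h1
      simp only [← sub_eq_add_neg, Real.cos_sub_pi_div_two]; exact h1
    · refine ⟨Real.pi / 2, by simp [phs], ?_⟩
      rw [e, him] at h1
      simpa [Real.cos_add_pi_div_two] using h1

lemma freq_grid {k n : ℕ} {N : ℝ} (hN : 1 ≤ N) (hk : 1 ≤ k) {z : Fin n → ℤ}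
    (hz : ∑ j, Real.log (1 + |(z j : ℝ)| / N) ≤ 80 * n)
    (hb : ¬ FreqGood k (fun j => (z j : ℝ)) N) :
    ∃ g : Fin k → ℤ, (∀ i, g i ∈ Finset.Icc (-(GG N : ℤ)) (GG N : ℤ)) ∧
      (∀ i j, i ≠ j → k / (2 * N) ≤ |(g i : ℝ) / GG N - g j / GG N|) ∧
      ∃ ψ : Fin k → ℝ, (∀ i, ψ i ∈ phs) ∧ ∀ i, bet * n / 4 ≤ ∑ j, Real.cos ((g i : ℝ) / GG N * z j + ψ i) := by
  unfold FreqGood at hb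
  push Not at hb
  obtain ⟨t, ht1, hts, htS⟩ := hb
  have hN0 : 0 < N := by linarith
  have hkr : (1 : ℝ) ≤ k := by exact_mod_cast hk
  have hG := GG_ge' hN0
  set G : ℕ := GG N with hGdef
  have hG0 : (0 : ℝ) < G := by linarith
  have hclose : ∀ i, |t i - (⌊t i * G⌋ : ℝ) / G| ≤ 1 / G := by
    intro i
    have e : t i - (⌊t i * G⌋ : ℝ) / G = (t i * G - ⌊t i * G⌋) / G := by field_simp
    rw [e, abs_div, abs_of_pos hG0]
    gcongr
    rw [abs_of_nonneg (sub_nonneg.2 (Int.floor_le _))]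
    linarith [Int.lt_floor_add_one (t i * G)]
  refine ⟨fun i => ⌊t i * G⌋, ?_, ?_, ?_⟩
  · intro i
    have := abs_le.1 (ht1 i)
    rw [mem_Icc]
    constructor
    · rw [Int.le_floor]; push_cast; nlinarith
    · have : (⌊t i * G⌋ : ℝ) ≤ G := (Int.floor_le _).trans (by nlinarith)
      exact_mod_cast this
  · intro i j hij
    have h1 := hts i j hij
    have h2 := hclose i
    have h3 := hclose j
    have h4 : t i - t j = (t i - (⌊t i * G⌋ : ℝ) / G) + (((⌊t i * G⌋ : ℝ) / G - (⌊t j * G⌋ : ℝ) / G) - (t j - (⌊t j * G⌋ : ℝ) / G)) := by ring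
    rw [h4] at h1
    have h5 := h1.trans ((abs_add_le _ _).trans (add_le_add_right (abs_sub _ _) _))
    have h6 : (1 : ℝ) / G ≤ 1 / (4 * N) := by gcongr
    have h7 : (k : ℝ) / N = k / (2 * N) + k / (2 * N) := by field_simp; ring
    have h8 : 1 / (4 * N) + 1 / (4 * N) = 1 / (2 * N) := by field_simp; norm_num
    have h9 : 1 / (2 * N) ≤ k / (2 * N) := by gcongr
    linarith
  · choose ψ hψ1 hψ2 using fun i => exists_phase (fun j => (z j : ℝ)) (t i) (htS i)
    refine ⟨ψ, hψ1, fun i => ?_⟩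
    have h1 := hψ2 i
    have hcard := card_large_le hN0 (by linarith [H1_ge] : 0 < H1) hz
    have hlog : 1280 / bet ≤ Real.log (1 + H1) := by
      have : Real.log H1 ≤ Real.log (1 + H1) := Real.log_le_log (by linarith [H1_ge]) (by linarith)
      refine le_trans (le_of_eq ?_) this
      unfold H1 bet
      rw [Real.log_exp, Real.exp_neg, div_inv_eq_mul]
    set L := univ.filter (fun j => H1 * N < |(z j : ℝ)|) with hL
    have hLc : (L.card : ℝ) ≤ bet * n / 16 := by
      have h2 : (L.card : ℝ) * (1280 / bet) ≤ 80 * n :=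
        (mul_le_mul_of_nonneg_left hlog (Nat.cast_nonneg _)).trans hcard
      rw [mul_div_assoc', div_le_iff₀ bet_pos] at h2
      linarith
    have hpt : ∀ j, Real.cos (t i * z j + ψ i) - Real.cos ((⌊t i * G⌋ : ℝ) / G * z j + ψ i) ≤
        (if j ∈ L then 2 else 0) + bet / 8 := by
      intro j
      by_cases hj : j ∈ L
      · rw [if_pos hj]
        have := Real.cos_le_one (t i * z j + ψ i)
        have := Real.neg_one_le_cos ((⌊t i * G⌋ : ℝ) / G * z j + ψ i)
        have := bet_pos
        linarith
      · rw [if_neg hj, zero_add]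
        have hj' : |(z j : ℝ)| ≤ H1 * N := by
          by_contra hc
          exact hj (by rw [hL, mem_filter]; exact ⟨mem_univ _, by linarith⟩)
        refine (le_abs_self _).trans ((abs_cos_sub_cos_le' _ _).trans ?_)
        have e : t i * z j + ψ i - ((⌊t i * G⌋ : ℝ) / G * z j + ψ i) = (t i - (⌊t i * G⌋ : ℝ) / G) * z j := by ring
        rw [e, abs_mul]
        calc _ ≤ 1 / G * (H1 * N) := mul_le_mul (hclose i) hj' (abs_nonneg _) (by positivity)
          _ = H1 * N / G := by ring
          _ ≤ _ := by
            rw [div_le_iff₀ hG0]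
            have := GG_ge (N := N)
            rw [div_le_iff₀ bet_pos] at this
            linarith
    have hsum := Finset.sum_le_sum fun j (_ : j ∈ univ) => hpt j
    rw [Finset.sum_sub_distrib, Finset.sum_add_distrib, Finset.sum_ite_mem, univ_inter] at hsum
    simp only [Finset.sum_const, card_univ, Fintype.card_fin, nsmul_eq_mul] at hsum
    have : Real.exp (-400) = bet := rfl
    rw [this] at h1
    linarith

lemma wave_count {k n : ℕ} {N A τ : ℝ} (hN : 1 ≤ N) (hk : 1 ≤ k) (hτ : 0 ≤ τ)
    (hq : 704 * Real.exp (8 * τ / bet) ≤ k * bet ^ 2) (θ ψ : Fin k → ℝ) (h1 : ∀ i, |θ i| ≤ 1)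
    (hs : ∀ i j, i ≠ j → k / (2 * N) ≤ |θ i - θ j|) (T : Finset (Fin n → ℤ)) (hT : T ⊆ zset n N A)
    (hTb : ∀ z ∈ T, ∀ i, bet * n / 4 ≤ ∑ j, Real.cos (θ i * z j + ψ i)) :
    (T.card : ℝ) ≤ Real.exp (2 * A) * (4 * N) ^ n * Real.exp (-(τ * n)) := by
  classical
  have hkr : (1 : ℝ) ≤ k := by exact_mod_cast hk
  have hb := bet_pos
  set m := Real.exp (8 * τ / bet) with hm
  have hm1 : 1 ≤ m := Real.one_le_exp (by positivity)
  set ζ : ℤ → ℝ := fun z => ∑ i, Real.cos (θ i * z + ψ i) with hζ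
  set Φ : ℤ → ℝ := fun z => if k * bet / 8 ≤ ζ z then m else 1 with hΦ
  have hΦ0 : ∀ z, 0 ≤ Φ z := by intro z; simp only [hΦ]; split_ifs <;> linarith
  have hζk : ∀ z, ζ z ≤ k := by
    intro z
    calc ζ z ≤ ∑ i : Fin k, (1 : ℝ) := Finset.sum_le_sum fun i _ => Real.cos_le_one _
      _ = k := by simp
  have hlow : ∀ z ∈ T, Real.exp (τ * n) ≤ ∏ j, Φ (z j) := by
    intro z hz
    set B := univ.filter (fun j => k * bet / 8 ≤ ζ (z j)) with hB
    have e : ∏ j, Φ (z j) = m ^ B.card := by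
      simp only [hΦ]
      rw [Finset.prod_ite]; simp [hB]
    have hsum : k * (bet * n / 4) ≤ ∑ j, ζ (z j) := by
      simp only [hζ]
      rw [Finset.sum_comm]
      calc k * (bet * n / 4) = ∑ i : Fin k, bet * n / 4 := by simp
        _ ≤ _ := Finset.sum_le_sum fun i _ => hTb z hz i
    have hup : ∑ j, ζ (z j) ≤ ∑ j, ((if j ∈ B then (k : ℝ) else 0) + k * bet / 8) := by
      refine Finset.sum_le_sum fun j _ => ?_
      have hkb : 0 ≤ k * bet / 8 := by positivity
      by_cases hj : j ∈ B
      · rw [if_pos hj]; linarith [hζk (z j)]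
      · rw [if_neg hj]
        have : ¬ k * bet / 8 ≤ ζ (z j) := fun h => hj (by rw [hB, mem_filter]; exact ⟨mem_univ _, h⟩)
        linarith
    rw [Finset.sum_add_distrib, Finset.sum_ite_mem, univ_inter] at hup
    simp only [Finset.sum_const, card_univ, Fintype.card_fin, nsmul_eq_mul] at hup
    have hBc : bet * n / 8 ≤ B.card := by
      have : (k : ℝ) * (bet * n / 8) ≤ k * B.card := by nlinarith
      exact le_of_mul_le_mul_left this (by linarith)
    rw [e, hm, ← Real.exp_nat_mul, Real.exp_le_exp]
    calc τ * n = (bet * n / 8) * (8 * τ / bet) := by field_simp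
      _ ≤ _ := by gcongr
  have hle : (T.card : ℝ) * Real.exp (τ * n) ≤ ∑ z ∈ zset n N A, ∏ j, Φ (z j) := by
    rw [← nsmul_eq_mul]
    refine (Finset.card_nsmul_le_sum T _ _ hlow).trans ?_
    exact Finset.sum_le_sum_of_subset_of_nonneg hT fun z _ _ => Finset.prod_nonneg fun j _ => hΦ0 _
  have h2 := hle.trans (zset_sum_le (by linarith : 0 < N) 2 Φ hΦ0)
  set M := ⌈N * Real.exp A⌉
  have h3 : ∑ z ∈ Finset.Icc (-M) M, Φ z * ((1 + |(z : ℝ)| / N) ^ 2)⁻¹ ≤ 4 * N := by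
    have hpt : ∀ z : ℤ, Φ z ≤ 1 + m * (64 / (k * bet) ^ 2) * ζ z ^ 2 := by
      intro z
      have hnn : 0 ≤ m * (64 / (k * bet) ^ 2) * ζ z ^ 2 := by positivity
      simp only [hΦ]
      split_ifs with h
      · have h5 : (k * bet / 8) ^ 2 ≤ ζ z ^ 2 := pow_le_pow_left₀ (by positivity) h 2
        have h6 : m * (64 / (k * bet) ^ 2) * (k * bet / 8) ^ 2 ≤ m * (64 / (k * bet) ^ 2) * ζ z ^ 2 := by gcongr
        have h7 : m * (64 / (k * bet) ^ 2) * (k * bet / 8) ^ 2 = m := by field_simp; norm_num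
        linarith
      · linarith
    have hmom := wave_moment hN hk θ ψ h1 hs M
    calc _ ≤ ∑ z ∈ Finset.Icc (-M) M, (((1 + |(z : ℝ)| / N) ^ 2)⁻¹ +
          m * (64 / (k * bet) ^ 2) * (((1 + |(z : ℝ)| / N) ^ 2)⁻¹ * ζ z ^ 2)) := by
          refine Finset.sum_le_sum fun z _ => ?_
          have h8 : 0 ≤ ((1 + |(z : ℝ)| / N) ^ 2)⁻¹ := by positivity
          have := mul_le_mul_of_nonneg_right (hpt z) h8
          refine this.trans (le_of_eq (by ring))
      _ ≤ (1 + 2 * N) + m * (64 / (k * bet) ^ 2) * (11 * k * N) := by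
          rw [Finset.sum_add_distrib, ← Finset.mul_sum]
          refine add_le_add (sum_weight_two (by linarith) M) ?_
          refine mul_le_mul_of_nonneg_left hmom (by positivity)
      _ ≤ 4 * N := by
          have : m * (64 / (k * bet) ^ 2) * (11 * k * N) ≤ N := by
            have e : m * (64 / (k * bet) ^ 2) * (11 * k * N) = (704 * m) * N / (k * bet ^ 2) := by field_simp; norm_num
            rw [e, div_le_iff₀ (by positivity)]
            nlinarith
          linarith
  have h4 := h2.trans (mul_le_mul_of_nonneg_left (pow_le_pow_left₀
    (Finset.sum_nonneg fun z _ => mul_nonneg (hΦ0 _) (by positivity)) h3 n) (Real.exp_pos _).le)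
  rw [Real.exp_neg, ← div_eq_mul_inv, le_div_iff₀ (Real.exp_pos _)]
  exact_mod_cast h4

lemma freq_count {k n : ℕ} {N τ : ℝ} (hN : 1 ≤ N) (hk : 1 ≤ k) (hτ : 0 ≤ τ)
    (hq : 704 * Real.exp (8 * τ / bet) ≤ k * bet ^ 2) (T : Finset (Fin n → ℤ)) (hT : T ⊆ zset n N (80 * n))
    (hTb : ∀ z ∈ T, ¬ FreqGood k (fun j => (z j : ℝ)) N) :
    (T.card : ℝ) ≤ (4 * (2 * GG N + 1)) ^ k * (Real.exp (160 * n) * (4 * N) ^ n * Real.exp (-(τ * n))) := by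
  classical
  have hN0 : 0 < N := by linarith
  set G := GG N with hG
  have hG0 : (0 : ℝ) < G := by linarith [GG_ge' hN0]
  set I := ((Fintype.piFinset fun _ : Fin k => Finset.Icc (-(G : ℤ)) (G : ℤ)) ×ˢ
    (Fintype.piFinset fun _ : Fin k => phs)).filter
      (fun gp => ∀ i j, i ≠ j → k / (2 * N) ≤ |(gp.1 i : ℝ) / G - gp.1 j / G|) with hI
  have hsub : T ⊆ I.biUnion (fun gp => T.filter
      (fun z => ∀ i, bet * n / 4 ≤ ∑ j, Real.cos ((gp.1 i : ℝ) / G * z j + gp.2 i))) := by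
    intro z hz
    obtain ⟨g, hg1, hg2, ψ, hψ1, hψ2⟩ := freq_grid hN hk ((mem_zset hN0).1 (hT hz)) (hTb z hz)
    rw [mem_biUnion]
    refine ⟨(g, ψ), ?_, ?_⟩
    · rw [hI, mem_filter, mem_product, Fintype.mem_piFinset, Fintype.mem_piFinset]
      exact ⟨⟨hg1, hψ1⟩, hg2⟩
    · rw [mem_filter]; exact ⟨hz, hψ2⟩
  set c := Real.exp (160 * n) * (4 * N) ^ n * Real.exp (-(τ * n)) with hc
  have hc0 : 0 ≤ c := by positivity
  have h1 : (T.card : ℝ) ≤ ∑ gp ∈ I, c := by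
    have h := (card_le_card hsub).trans card_biUnion_le
    refine (Nat.cast_le.2 h).trans ?_
    push_cast
    refine Finset.sum_le_sum fun gp hgp => ?_
    rw [hI, mem_filter, mem_product, Fintype.mem_piFinset] at hgp
    have := wave_count (A := 80 * n) hN hk hτ hq (fun i => (gp.1 i : ℝ) / G) gp.2 ?_ hgp.2 (T.filter
      (fun z => ∀ i, bet * n / 4 ≤ ∑ j, Real.cos ((gp.1 i : ℝ) / G * z j + gp.2 i)))
      ((filter_subset _ _).trans hT) (fun z hz => (mem_filter.1 hz).2)
    · refine this.trans (le_of_eq ?_)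
      rw [hc]; ring_nf
    · intro i
      rw [abs_div, abs_of_pos hG0, div_le_one hG0]
      have := abs_le.2 (mem_Icc.1 (hgp.1.1 i))
      exact_mod_cast this
  have hIc : (I.card : ℝ) ≤ (4 * (2 * G + 1)) ^ k := by
    have h2 : I.card ≤ (2 * G + 1) ^ k * 4 ^ k := by
      refine (card_filter_le _ _).trans ?_
      rw [card_product, Fintype.card_piFinset, Fintype.card_piFinset]
      simp only [Finset.prod_const, card_univ, Fintype.card_fin, Int.card_Icc]
      refine Nat.mul_le_mul (Nat.pow_le_pow_left (by omega) _) (Nat.pow_le_pow_left phs_card _)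
    refine (Nat.cast_le.2 h2).trans (le_of_eq ?_)
    push_cast
    rw [mul_pow]; ring
  rw [Finset.sum_const, nsmul_eq_mul] at h1
  exact h1.trans (mul_le_mul_of_nonneg_right hIc hc0)

end SB

set_option linter.all false
namespace SB
open Finset

def BadLevel {ι : Type} [Fintype ι] (p : ℝ) (k : ℕ) (N : ℝ) {n : ℕ} (Q : ι → Fin n → Bool) : Prop :=
  ¬ TwoIrr (p * n) Q ∧ ∃ z z' : Fin n → ℤ, ∑ j, Real.log (1 + |(z j : ℝ)| / N) ≤ 80 * n ∧
    ¬ FreqGood k (fun j => (z j : ℝ)) N ∧ (∀ j, |z j - 2 * z' j| ≤ 3) ∧ ∃ l : ℤ, |(l : ℝ)| ≤ n ^ 3 * N ∧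
    rho p (fun j => (l : ℝ) / n ^ 2 + z' j) ≤ 10000000000 / N ∧
    ∑ i, (dot (Q i) (fun j => (l : ℝ) / n ^ 2 + z' j)) ^ 2 ≤ 50 * n * (p * n)

lemma rho_nonneg {p : ℝ} {n : ℕ} (h0 : 0 ≤ p) (h1 : p ≤ 1) (y : Fin n → ℝ) : 0 ≤ rho p y :=
  Ex_nonneg (rowW_nonneg h0 h1) fun X => mul_nonneg (ind_nonneg _) (Real.exp_pos _).le

/-- single vector tensorization. -/
lemma single_prob {p : ℝ} {n : ℕ} {ι : Type} [Fintype ι] [DecidableEq ι] (hι : Fintype.card ι + 1 = n) (hn : 2 ≤ n)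
    (h0 : 0 < p) (h1 : p ≤ 1) (y : Fin n → ℝ) {r : ℝ} (hr : rho p y ≤ r) :
    Pr (matW p) (fun Q : ι → Fin n → Bool => ¬ TwoIrr (p * n) Q ∧
      ∑ i, (dot (Q i) y) ^ 2 ≤ 50 * n * (p * n)) ≤ n * (Real.exp (50 / 32 * n) * r ^ (n - 2)) := by
  classical
  have hw := matW_nonneg (ι := ι) (n := n) h0.le h1
  have hn0 : (0 : ℝ) < n := by
    have : 0 < n := by omega
    exact_mod_cast this
  have hd : 0 < p * n := by positivity
  have hrho0 := rho_nonneg h0.le h1 y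
  have hr0 : 0 ≤ r := hrho0.trans hr
  have hne : Nonempty ι := Fintype.card_pos_iff.1 (by omega)
  refine (Pr_mono hw (T := fun Q : ι → Fin n → Bool => ∃ i0 ∈ (univ : Finset ι), (∀ i, i ≠ i0 → Reg (p * n) (Q i)) ∧
      ∑ i, (dot (Q i) y) ^ 2 ≤ 50 * n * (p * n)) ?_).trans ?_
  · rintro Q ⟨hQ, hs⟩
    by_cases h : ∃ i0, ¬ Reg (p * n) (Q i0)
    · obtain ⟨i0, hi0⟩ := h
      refine ⟨i0, mem_univ _, fun i hi => ?_, hs⟩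
      by_contra hc
      exact hQ ⟨i, i0, hi, hc, hi0⟩
    · push Not at h
      exact ⟨hne.some, mem_univ _, fun i _ => h i, hs⟩
  refine (Pr_exists_le_card hw univ _ (c := Real.exp (50 / 32 * n) * r ^ (n - 2)) ?_).trans ?_
  · intro i0 _
    refine (tensor h0.le h1 _ (Real.exp_pos (50 / 32 * n)).le
      (fun i X => if i = i0 then 1 else ind (Reg (p * n) X) * Real.exp (-((dot X y) ^ 2 / (32 * (p * n))))) ?_ ?_).trans ?_
    · intro i X
      split_ifs
      · norm_num
      · exact mul_nonneg (ind_nonneg _) (Real.exp_pos _).le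
    · rintro Q ⟨hreg, hs⟩
      have hlow : Real.exp (-((∑ i, (dot (Q i) y) ^ 2) / (32 * (p * n)))) ≤
          ∏ i, (if i = i0 then 1 else ind (Reg (p * n) (Q i)) * Real.exp (-((dot (Q i) y) ^ 2 / (32 * (p * n))))) := by
        rw [Finset.sum_div, ← Finset.sum_neg_distrib, Real.exp_sum]
        refine Finset.prod_le_prod (fun i _ => (Real.exp_pos _).le) fun i _ => ?_
        split_ifs with h
        · rw [Real.exp_le_one_iff]
          have : 0 ≤ (dot (Q i) y) ^ 2 / (32 * (p * n)) := by positivity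
          linarith
        · rw [ind_true (hreg i h), one_mul]
      refine le_trans ?_ (mul_le_mul_of_nonneg_left hlow (Real.exp_pos _).le)
      rw [← Real.exp_add]
      apply Real.one_le_exp
      have : (∑ i, (dot (Q i) y) ^ 2) / (32 * (p * n)) ≤ 50 / 32 * n := by
        rw [div_le_iff₀ (by positivity)]
        linarith
      linarith
    · refine mul_le_mul_of_nonneg_left ?_ (Real.exp_pos _).le
      rw [← Finset.mul_prod_erase univ _ (mem_univ i0)]
      have e1 : Ex (rowW p) (fun X : Fin n → Bool => if i0 = i0 then 1 else ind (Reg (p * n) X) *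
          Real.exp (-((dot X y) ^ 2 / (32 * (p * n))))) = 1 := by
        simp only [if_true]
        exact Ex_const rowW_sum 1
      rw [e1, one_mul]
      calc _ ≤ ∏ i ∈ univ.erase i0, r := by
            refine Finset.prod_le_prod (fun i hi => ?_) fun i hi => ?_
            · refine Ex_nonneg (rowW_nonneg h0.le h1) fun X => ?_
              split_ifs
              · norm_num
              · exact mul_nonneg (ind_nonneg _) (Real.exp_pos _).le
            · simp only [if_neg (ne_of_mem_erase hi)]
              exact hr
        _ = _ := by
            rw [Finset.prod_const, card_erase_of_mem (mem_univ _), card_univ]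
            congr 1; omega
  · rw [card_univ]
    have : (Fintype.card ι : ℝ) ≤ n := by exact_mod_cast (by omega : Fintype.card ι ≤ n)
    exact mul_le_mul_of_nonneg_right this (by positivity)

noncomputable def cG : ℝ := 4 * (16 * H1 / bet + 3)

lemma cG_ge : 1 ≤ cG := by
  have : 0 ≤ 16 * H1 / bet := div_nonneg (by linarith [H1_ge]) bet_pos.le
  unfold cG; linarith

lemma GG_le {N : ℝ} (hN : 1 ≤ N) : 4 * (2 * (GG N : ℝ) + 1) ≤ cG * N := by
  have h : (GG N : ℝ) ≤ 8 * H1 * N / bet + 1 := by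
    refine (Nat.ceil_lt_add_one ?_).le
    exact div_nonneg (mul_nonneg (by linarith [H1_ge]) (by linarith)) bet_pos.le
  unfold cG
  have e : 8 * H1 * N / bet = 8 * H1 / bet * N := by ring
  have e2 : 16 * H1 / bet = 2 * (8 * H1 / bet) := by ring
  rw [e] at h
  rw [e2]
  nlinarith

lemma bad_level_prob {p : ℝ} {n k : ℕ} {ι : Type} [Fintype ι] [DecidableEq ι] (hι : Fintype.card ι + 1 = n) (hn : 2 ≤ n)
    (h0 : 0 < p) (h1 : p ≤ 1) (hk : 1 ≤ k) {N : ℝ} (hN : 1 ≤ N) (hNd : N ≤ Real.exp (2 * (p * n)))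
    (hpk : 2 * p * (k + 3) ≤ 1) (hcn : cG ^ k ≤ Real.exp n)
    (hq : 704 * Real.exp (8 * 400 / bet) ≤ k * bet ^ 2) :
    Pr (matW p) (fun Q : ι → Fin n → Bool => BadLevel p k N Q) ≤ Real.exp (-n) := by
  classical
  have hw := matW_nonneg (ι := ι) (n := n) h0.le h1
  have hN0 : 0 < N := by linarith
  have hn2 : (2 : ℝ) ≤ n := by exact_mod_cast hn
  set T := (zset n N (80 * n)).filter (fun z => ¬ FreqGood k (fun j => (z j : ℝ)) N) with hT
  set W := Fintype.piFinset (fun _ : Fin n => Finset.Icc (-3 : ℤ) 3) with hW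
  set R := ⌊(n : ℝ) ^ 3 * N⌋ with hR
  set Z := (T ×ˢ W) ×ˢ Finset.Icc (-R) R with hZ
  set yy : ((Fin n → ℤ) × (Fin n → ℤ)) × ℤ → Fin n → ℝ :=
    fun x j => (x.2 : ℝ) / n ^ 2 + (((x.1.1 j + x.1.2 j) / 2 : ℤ) : ℝ) with hyy
  set cc := n * (Real.exp (50 / 32 * n) * (10000000000 / N) ^ (n - 2)) with hcc
  have hcc0 : 0 ≤ cc := by positivity
  refine (Pr_mono hw (T := fun Q : ι → Fin n → Bool => ∃ x ∈ Z, (rho p (yy x) ≤ 10000000000 / N ∧ (¬ TwoIrr (p * n) Q ∧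
      ∑ i, (dot (Q i) (yy x)) ^ 2 ≤ 50 * n * (p * n)))) ?_).trans ?_
  · rintro Q ⟨hQ, z, z', hz, hF, hzz, l, hl, hrho, hs⟩
    have he : yy ((z, fun j => 2 * z' j - z j), l) = fun j => (l : ℝ) / n ^ 2 + z' j := by
      funext j
      simp only [hyy]
      congr 2
      omega
    refine ⟨((z, fun j => 2 * z' j - z j), l), ?_, by rw [he]; exact hrho, hQ, by rw [he]; exact hs⟩
    rw [hZ, mem_product, mem_product, hT, mem_filter, mem_zset hN0, hW, Fintype.mem_piFinset, mem_Icc]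
    refine ⟨⟨⟨hz, hF⟩, fun j => ?_⟩, ?_⟩
    · rw [mem_Icc]
      have := abs_le.1 (hzz j)
      simp only
      omega
    · have hl2 : |l| ≤ R := by
        rw [hR, Int.le_floor]; push_cast; exact hl
      exact abs_le.1 hl2
  refine (Pr_exists_le_card hw Z _ (c := cc) ?_).trans ?_
  · intro x _
    by_cases hx : rho p (yy x) ≤ 10000000000 / N
    · refine (Pr_mono hw fun Q hQ => hQ.2).trans (single_prob hι hn h0 h1 (yy x) hx)
    · refine le_trans (le_of_eq ?_) hcc0
      unfold Pr
      refine Finset.sum_eq_zero fun Q _ => ?_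
      rw [ind_false (fun h => hx h.1), mul_zero]
  -- numeric estimate
  have hTc := freq_count (τ := 400) hN hk (by norm_num) hq T (filter_subset _ _) (fun z hz => (mem_filter.1 hz).2)
  have hWc : (W.card : ℝ) = 7 ^ n := by
    rw [hW, Fintype.card_piFinset]; simp
  have hRc : ((Finset.Icc (-R) R).card : ℝ) ≤ 3 * n ^ 3 * N := by
    have hR0 : 0 ≤ R := Int.floor_nonneg.2 (by positivity)
    have e : ((Finset.Icc (-R) R).card : ℝ) = 2 * R + 1 := by
      rw [Int.card_Icc]
      have : ((R + 1 - -R).toNat : ℤ) = 2 * R + 1 := by omega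
      exact_mod_cast this
    rw [e]
    have h2 : (R : ℝ) ≤ n ^ 3 * N := Int.floor_le _
    have h3 : 1 ≤ (n : ℝ) ^ 3 * N := one_le_mul_of_one_le_of_one_le (one_le_pow₀ (by linarith)) hN
    nlinarith
  have hZc : (Z.card : ℝ) = T.card * W.card * (Finset.Icc (-R) R).card := by
    rw [hZ, card_product, card_product]; push_cast; ring
  have hcG := cG_ge
  have hexpn : (n : ℝ) + 1 ≤ Real.exp n := Real.add_one_le_exp _
  have hn1 : (1 : ℝ) ≤ Real.exp n := Real.one_le_exp (by linarith)
  -- N powers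
  have hNk : N ^ (k + 3) ≤ Real.exp n := by
    calc N ^ (k + 3) ≤ Real.exp (2 * (p * n)) ^ (k + 3) := pow_le_pow_left₀ hN0.le hNd _
      _ = Real.exp (((k + 3 : ℕ) : ℝ) * (2 * (p * n))) := by rw [Real.exp_nat_mul]
      _ ≤ Real.exp n := by
          rw [Real.exp_le_exp]; push_cast
          nlinarith
  have hG : (4 * (2 * (GG N : ℝ) + 1)) ^ k ≤ Real.exp n * N ^ k := by
    calc _ ≤ (cG * N) ^ k := pow_le_pow_left₀ (by positivity) (GG_le hN) _
      _ = cG ^ k * N ^ k := mul_pow _ _ _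
      _ ≤ _ := by gcongr
  have h4e : (4 : ℝ) ≤ Real.exp 2 := by
    have := Real.exp_one_gt_d9
    rw [show (2 : ℝ) = 1 + 1 by norm_num, Real.exp_add]; nlinarith
  have h7e : (7 : ℝ) ≤ Real.exp 2 := by
    have := Real.exp_one_gt_d9
    rw [show (2 : ℝ) = 1 + 1 by norm_num, Real.exp_add]; nlinarith
  have h10e : (10000000000 : ℝ) ≤ Real.exp 40 := by
    have : (2 : ℝ) ^ 40 ≤ Real.exp 40 := by
      rw [show (40 : ℝ) = ((40 : ℕ) : ℝ) * 1 by norm_num, Real.exp_nat_mul]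
      exact pow_le_pow_left₀ (by norm_num) (by linarith [Real.exp_one_gt_d9]) _
    norm_num at this ⊢; linarith
  have hpown : ∀ {a b : ℝ}, 0 ≤ a → a ≤ Real.exp b → a ^ n ≤ Real.exp (b * n) := by
    intro a b ha hab
    calc a ^ n ≤ Real.exp b ^ n := pow_le_pow_left₀ ha hab _
      _ = _ := by rw [← Real.exp_nat_mul]; congr 1; ring
  have hNpow : N ^ n * (10000000000 / N) ^ (n - 2) ≤ N ^ 2 * Real.exp (40 * n) := by
    have e : N ^ n = N ^ 2 * N ^ (n - 2) := by rw [← pow_add]; congr 1; omega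
    rw [e, mul_assoc, ← mul_pow, mul_div_cancel₀ _ hN0.ne']
    refine mul_le_mul_of_nonneg_left ?_ (by positivity)
    refine le_trans ?_ (hpown (by norm_num) h10e)
    exact pow_le_pow_right₀ (by norm_num) (by omega)
  rw [hZc, hWc, hcc]
  set E := Real.exp (n : ℝ) with hE
  calc (T.card : ℝ) * 7 ^ n * ((Finset.Icc (-R) R).card : ℝ) * (n * (Real.exp (50 / 32 * n) * (10000000000 / N) ^ (n - 2)))
      ≤ ((E * N ^ k) * (Real.exp (160 * n) * (4 * N) ^ n * Real.exp (-(400 * n)))) * Real.exp (2 * n) * (3 * n ^ 3 * N) *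
        (n * (Real.exp (2 * n) * (10000000000 / N) ^ (n - 2))) := by
        have t1 : (T.card : ℝ) ≤ (E * N ^ k) * (Real.exp (160 * n) * (4 * N) ^ n * Real.exp (-(400 * n))) :=
          hTc.trans (mul_le_mul_of_nonneg_right hG (by positivity))
        have t2 : (7 : ℝ) ^ n ≤ Real.exp (2 * n) := hpown (by norm_num) h7e
        have t3 : Real.exp (50 / 32 * n) ≤ Real.exp (2 * n) := Real.exp_le_exp.2 (by linarith)
        gcongr
    _ = (N ^ n * (10000000000 / N) ^ (n - 2)) * (N ^ (k + 1) * (3 * n ^ 4)) * 4 ^ n *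
        (E * Real.exp (160 * n) * Real.exp (-(400 * n)) * Real.exp (2 * n) * Real.exp (2 * n)) := by
        rw [mul_pow, pow_succ N k]; ring
    _ ≤ (N ^ 2 * Real.exp (40 * n)) * (N ^ (k + 1) * (3 * E ^ 4)) * Real.exp (2 * n) *
        (E * Real.exp (160 * n) * Real.exp (-(400 * n)) * Real.exp (2 * n) * Real.exp (2 * n)) := by
        have t2 : (4 : ℝ) ^ n ≤ Real.exp (2 * n) := hpown (by norm_num) h4e
        have t3 : (n : ℝ) ≤ E := by linarith
        gcongr
    _ = N ^ (k + 3) * (Real.exp (40 * n) * (3 * E ^ 4) * Real.exp (2 * n) *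
        (E * Real.exp (160 * n) * Real.exp (-(400 * n)) * Real.exp (2 * n) * Real.exp (2 * n))) := by
        rw [show k + 3 = 2 + (k + 1) by ring, pow_add N 2 (k + 1)]; ring
    _ ≤ E * (Real.exp (40 * n) * (E * E ^ 4) * Real.exp (2 * n) *
        (E * Real.exp (160 * n) * Real.exp (-(400 * n)) * Real.exp (2 * n) * Real.exp (2 * n))) := by
        have t3 : (3 : ℝ) ≤ E := by linarith
        gcongr
    _ = Real.exp (n + 40 * n + 5 * n + 2 * n + (n + 160 * n + -(400 * n) + 2 * n + 2 * n)) := by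
        have : E * E ^ 4 = Real.exp (5 * n) := by
          rw [hE, ← pow_succ', ← Real.exp_nat_mul]; norm_num
        rw [this]
        simp only [Real.exp_add]; ring
    _ ≤ Real.exp (-n) := by
        rw [Real.exp_le_exp]; linarith

end SB

set_option linter.all false
namespace SB
open Finset

/-- numeric requirements -/
structure Par (k j0 : ℕ) (N0 p : ℝ) (n : ℕ) : Prop where
  hk : 1 ≤ k
  hj : 1 ≤ j0
  hkH : k * HH ≤ j0
  hN0 : 64000 ≤ N0
  h0 : 0 < p
  hp : p ≤ Real.exp (-800)
  hp1 : p ≤ 1 / 2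
  hd : 1 ≤ p * n
  hn : (n : ℝ) + 1 ≤ Real.exp (p * n / 2)
  hn801 : (801 : ℝ) ≤ n
  c1 : 8 * (k : ℝ) ^ 2 * Real.sqrt (p * n) * (Real.exp (-(p / 2 * (n / (4 * (k * j0) ^ 2)))) + 2 * Real.exp (-(0.9 * (p * n)))) ≤ 1
  c2 : 8 * (k : ℝ) ^ 2 * Real.sqrt (p * n) * Real.exp (-(8 * (p * n) / (k * j0) ^ 2)) ≤ 1
  c3 : 2 * Real.exp (-(2 * (p * n))) ≤ 1
  c4 : Real.sqrt (p * n) * (2 * Real.exp (-(0.9 * (p * n)))) ≤ 1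
  cb : 2 * Real.exp (-(4 * (p * n) / (HH * N0) ^ 2)) ≤ 1 / N0

def Cls {ι : Type} [Fintype ι] (p : ℝ) {n : ℕ} (Q : ι → Fin n → Bool) (u : Fin n → ℝ) (σ lam N : ℝ) (z : Fin n → ℤ) : Prop :=
  (∀ j, |(z j : ℝ) - N / σ * (u j - lam)| ≤ 1) ∧
    ∑ i, (dot (Q i) (fun j => (z j : ℝ) - N / σ * (u j - lam))) ^ 2 ≤ 22 * n * (p * n) ∧
      ∑ j, Real.log (1 + |(z j : ℝ)| / N) ≤ 80 * n

noncomputable def yv {n : ℕ} (σ lam N : ℝ) (z : Fin n → ℤ) : Fin n → ℝ :=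
  fun j => (⌊(n : ℝ) ^ 2 * (N / σ * lam)⌋ : ℝ) / n ^ 2 + z j

section
variable {ι : Type} [Fintype ι] {n k j0 I : ℕ} {p N0 : ℝ} {Q : ι → Fin n → Bool} {u : Fin n → ℝ} {σ lam : ℝ}

lemma near_shift {H N c : ℝ} {y : Fin n → ℝ} (h : NearZero H y N) : NearZero H (fun j => c + y j) N := by
  intro θ hθ
  rw [Sy_shift]; exact h θ hθ

lemma freq_shift {N c : ℝ} {y : Fin n → ℝ} (h : FreqGood k y N) : FreqGood k (fun j => c + y j) N := by
  unfold FreqGood at h ⊢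
  simp only [Sy_shift]; exact h

lemma prof_log (hP : Prof u σ lam) {N : ℝ} (hN : 0 < N) :
    ∑ j, Real.log (1 + |N / σ * (u j - lam)| / N) ≤ 80 * n / 8 := by
  have := hP.pos
  refine le_trans (le_of_eq ?_) (hP.psi.trans (by linarith))
  refine Finset.sum_congr rfl fun j _ => ?_
  rw [abs_mul, abs_of_pos (by positivity : 0 < N / σ)]
  congr 2; field_simp

lemma exists_cls (hι : Fintype.card ι + 1 = n) (hd : 1 ≤ p * n) (hT : ¬ TwoIrr (p * n) Q) (hP : Prof u σ lam) {N : ℝ}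
    (hN : 0 < N) (F : (Fin n → ℤ) → ℝ) (hF0 : ∀ z, 0 ≤ F z)
    (hF : Ex (rdW fun j => N / σ * (u j - lam)) (fun b => F (rz (fun j => N / σ * (u j - lam)) b)) ≤ 1 / 2) :
    ∃ z, Cls p Q u σ lam N z ∧ F z < 1 := by
  have hn : (0 : ℝ) < n := by exact_mod_cast (by omega : 0 < n)
  obtain ⟨z, h1, h2, h3, h4⟩ := rounding hι hd hT (fun j => N / σ * (u j - lam)) hN
    (by positivity : (0 : ℝ) < 80 * n) (prof_log hP hN) F hF0 hF
  exact ⟨z, ⟨h1, h2, h3⟩, h4⟩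

lemma levels (hι : Fintype.card ι + 1 = n) (hpar : Par k j0 N0 p n) (hT : ¬ TwoIrr (p * n) Q) (hP : Prof u σ lam)
    (hker : ∀ i, dot (Q i) u = 0) (hI : N0 * 2 ^ I ≤ Real.exp (2 * (p * n)))
    (hB : ∀ i ≤ I, ¬ BadLevel p k (N0 * 2 ^ i) Q) (i : ℕ) (hi : i ≤ I) (z : Fin n → ℤ)
    (hz : Cls p Q u σ lam (N0 * 2 ^ i) z) : rho p (yv σ lam (N0 * 2 ^ i) z) ≤ 5000000000 / (N0 * 2 ^ i) := by
  have hσ := hP.pos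
  have hN0 := hpar.hN0
  have hp0 := hpar.h0
  have hnr : (0 : ℝ) < n := by linarith [hpar.hn801]
  have hd0 : 0 < p * n := by linarith [hpar.hd]
  have hge : ∀ m : ℕ, 64000 ≤ N0 * 2 ^ m := fun m => by
    have : (1 : ℝ) ≤ 2 ^ m := one_le_pow₀ (by norm_num)
    nlinarith
  induction i generalizing z with
  | zero =>
    rw [pow_zero, mul_one] at hz ⊢
    refine rho_base HH_ge (by linarith) hp0 hpar.hp1 hd0 ?_ hpar.cb hpar.c4
    exact near_shift (near_of_prof hP hN0 _ hz.1)
  | succ i ih =>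
    set N := N0 * 2 ^ i with hN
    have hN2 : N0 * 2 ^ (i + 1) = 2 * N := by rw [pow_succ, hN]; ring
    have hNge : 64000 ≤ N := hge i
    have hBi := hB (i + 1) hi
    have hNle : 2 * N ≤ Real.exp (2 * (p * n)) := by
      rw [← hN2]
      refine le_trans ?_ hI
      have : (2 : ℝ) ^ (i + 1) ≤ 2 ^ I := pow_le_pow_right₀ (by norm_num) hi
      exact mul_le_mul_of_nonneg_left this (by linarith)
    rw [hN2] at hz hBi ⊢
    have hF : FreqGood k (fun j => (z j : ℝ)) (2 * N) := by
      by_contra hF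
      obtain ⟨z', hz', _⟩ := exists_cls hι hpar.hd hT hP (by linarith : 0 < N) (fun _ => 0) (fun _ => le_refl _)
        (by unfold Ex; simp)
      refine hBi ⟨hT, z, z', hz.2.2, hF, ?_, ⌊(n : ℝ) ^ 2 * (N / σ * lam)⌋, ?_, ?_, ?_⟩
      · intro j
        have a1 := hz.1 j
        have a2 := hz'.1 j
        have e : ((z j - 2 * z' j : ℤ) : ℝ) = ((z j : ℝ) - 2 * N / σ * (u j - lam)) - 2 * ((z' j : ℝ) - N / σ * (u j - lam)) := by
          push_cast; ring
        have : ((|z j - 2 * z' j| : ℤ) : ℝ) ≤ 3 := by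
          rw [Int.cast_abs, e]
          refine (abs_sub _ _).trans ?_
          rw [abs_mul, abs_two]; linarith
        exact_mod_cast this
      · have a1 : |N / σ * lam| ≤ 800 * N := by
          rw [abs_mul, abs_of_pos (by positivity)]
          calc N / σ * |lam| ≤ N / σ * (800 * σ) := by gcongr; exact hP.lam_le
            _ = 800 * N := by field_simp
        have a2 : |(n : ℝ) ^ 2 * (N / σ * lam)| ≤ n ^ 2 * (800 * N) := by
          rw [abs_mul, abs_of_nonneg (by positivity : (0 : ℝ) ≤ n ^ 2)]; gcongr
        have a3 : |(⌊(n : ℝ) ^ 2 * (N / σ * lam)⌋ : ℝ)| ≤ n ^ 2 * (800 * N) + 1 := by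
          rw [abs_le] at a2 ⊢
          have := Int.floor_le ((n : ℝ) ^ 2 * (N / σ * lam))
          have := Int.lt_floor_add_one ((n : ℝ) ^ 2 * (N / σ * lam))
          constructor <;> linarith
        have a4 : (1 : ℝ) ≤ n ^ 2 * N := one_le_mul_of_one_le_of_one_le
          (one_le_pow₀ (by linarith [hpar.hn801])) (by linarith)
        have a5 : (n : ℝ) ^ 2 * N * 801 ≤ n ^ 2 * N * n := by gcongr; exact hpar.hn801
        refine a3.trans ?_
        nlinarith
      · have := ih (by omega) z' hz'
        refine this.trans (le_of_eq ?_)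
        field_simp; norm_num
      · exact (shift_bound hι hpar.hd hker (fun j => N / σ * (u j - lam)) (fun j => rfl) z' hz'.2.1).1
    refine rho_bound hpar.hk hpar.hj HH_ge (by linarith) hpar.hkH hp0 hpar.hp hpar.hp1 hd0 ?_ (freq_shift hF) hNle hpar.hn
      hpar.c1 hpar.c2 hpar.c3 hpar.c4
    exact near_shift (near_of_prof hP (by linarith) _ hz.1)

/-- Transfer from rounded vectors to the kernel vector. -/
lemma kernel_small_ball (hι : Fintype.card ι + 1 = n) (hpar : Par k j0 N0 p n) (hT : ¬ TwoIrr (p * n) Q) (hP : Prof u σ lam)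
    {N r : ℝ} (hN : 0 < N) (hr : ∀ z, Cls p Q u σ lam N z → rho p (yv σ lam N z) ≤ r) :
    Pr (rowW p) (fun X : Fin n → Bool => Reg (p * n) X ∧ |dot X u| ≤ Real.sqrt (p * n) * σ / N) ≤ 7 * r := by
  have hσ := hP.pos
  have hp0 := hpar.h0
  have hp1 : p ≤ 1 := by linarith [hpar.hp1]
  have hw := rowW_nonneg (n := n) hp0.le hp1
  have hnr : (801 : ℝ) ≤ n := hpar.hn801
  have hd1 : 1 ≤ p * n := hpar.hd
  set d := p * n with hd
  set S : (Fin n → Bool) → Prop := fun X => Reg d X ∧ |dot X u| ≤ Real.sqrt d * σ / N with hS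
  set P := Pr (rowW p) S with hPdef
  have hP0 : 0 ≤ P := Pr_nonneg hw _
  rcases hP0.eq_or_lt with hz | hPpos
  · obtain ⟨z, hz1, _⟩ := exists_cls hι hpar.hd hT hP hN (fun _ => 0) (fun _ => le_refl _) (by unfold Ex; simp)
    have := (rho_nonneg hp0.le hp1 _).trans (hr z hz1)
    rw [← hz]; linarith
  set v : Fin n → ℝ := fun j => N / σ * (u j - lam) with hv
  set f : (Fin n → ℤ) → ℝ := fun z => Ex (rowW p) (fun X : Fin n → Bool => ind (S X) * Real.exp (-((dot X (yv σ lam N z)) ^ 2 / (32 * d)))) with hf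
  have hfle : ∀ z, f z ≤ P := by
    intro z
    rw [hPdef, Pr_eq_Ex]
    refine Ex_mono hw fun X => ?_
    have : Real.exp (-((dot X (yv σ lam N z)) ^ 2 / (32 * d))) ≤ 1 := by
      rw [Real.exp_le_one_iff]
      have : 0 ≤ (dot X (yv σ lam N z)) ^ 2 / (32 * d) := by positivity
      linarith
    nlinarith [ind_nonneg (S X)]
  set F : (Fin n → ℤ) → ℝ := fun z => (P - f z) / (27 / 32 * P) with hF
  have hF0 : ∀ z, 0 ≤ F z := fun z => div_nonneg (by linarith [hfle z]) (by positivity)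
  set c0 := (⌊(n : ℝ) ^ 2 * (N / σ * lam)⌋ : ℝ) / n ^ 2 - N / σ * lam with hc0
  have hc0le : |c0| ≤ 1 / n ^ 2 := by
    have e : c0 = (⌊(n : ℝ) ^ 2 * (N / σ * lam)⌋ - n ^ 2 * (N / σ * lam)) / n ^ 2 := by rw [hc0]; field_simp
    rw [e, abs_div, abs_of_pos (by positivity : (0 : ℝ) < n ^ 2)]
    gcongr
    have := Int.floor_le ((n : ℝ) ^ 2 * (N / σ * lam))
    have := Int.lt_floor_add_one ((n : ℝ) ^ 2 * (N / σ * lam))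
    rw [abs_le]; constructor <;> linarith
  have hpt : ∀ X, S X → ∀ z : Fin n → ℤ, (dot X (yv σ lam N z)) ^ 2 ≤ 3 * (dot X (fun j => (z j : ℝ) - v j)) ^ 2 + 6 * d := by
    rintro X ⟨hreg, hsm⟩ z
    have e : dot X (yv σ lam N z) = dot X (fun j => (z j : ℝ) - v j) + (cnt X * c0 + N / σ * dot X u) := by
      rw [← dot_const, ← dot_smul, ← dot_add, ← dot_add]
      congr 1
      funext j
      simp only [yv, hv, hc0]; ring
    have a1 : |N / σ * dot X u| ≤ Real.sqrt d := by
      rw [abs_mul, abs_of_pos (by positivity)]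
      calc N / σ * |dot X u| ≤ N / σ * (Real.sqrt d * σ / N) := by gcongr
        _ = _ := by field_simp
    have a2 : |(cnt X : ℝ) * c0| ≤ 1 := by
      rw [abs_mul, abs_of_nonneg (Nat.cast_nonneg _)]
      have hcn : (cnt X : ℝ) ≤ n := by exact_mod_cast cnt_le X
      calc (cnt X : ℝ) * |c0| ≤ n * (1 / n ^ 2) := mul_le_mul hcn hc0le (abs_nonneg _) (by positivity)
        _ = 1 / n := by field_simp
        _ ≤ 1 := by rw [div_le_one (by linarith)]; linarith
    have b1 : (N / σ * dot X u) ^ 2 ≤ d := by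
      rw [← sq_abs]
      calc _ ≤ Real.sqrt d ^ 2 := pow_le_pow_left₀ (abs_nonneg _) a1 2
        _ = d := Real.sq_sqrt (by linarith)
    have b2 : ((cnt X : ℝ) * c0) ^ 2 ≤ 1 := by
      rw [← sq_abs]
      exact pow_le_one₀ (abs_nonneg _) a2
    rw [e]
    generalize dot X (fun j => (z j : ℝ) - v j) = a at *
    generalize (cnt X : ℝ) * c0 = b at *
    generalize N / σ * dot X u = c at *
    nlinarith [sq_nonneg (a - b), sq_nonneg (b - c), sq_nonneg (a - c)]
  have hlow : P - Ex (rdW v) (fun b => f (rz v b)) ≤ 27 / 64 * P := by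
    have h1 : ∀ X, S X → 1 - 27 / 64 ≤ Ex (rdW v) (fun b => Real.exp (-((dot X (yv σ lam N (rz v b))) ^ 2 / (32 * d)))) := by
      intro X hX
      have hvar := round_var v X
      have hcnt : (cnt X : ℝ) ≤ 10 * d := hX.1.2
      have : Ex (rdW v) (fun b => (1 - 6 / 32) + (-(3 / (32 * d))) * (dot X (fun j => (rz v b j : ℝ) - v j)) ^ 2) ≤
          Ex (rdW v) (fun b => Real.exp (-((dot X (yv σ lam N (rz v b))) ^ 2 / (32 * d)))) := by
        refine Ex_mono (rdW_nonneg v) fun b => ?_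
        have h2 := hpt X hX (rz v b)
        have h3 := Real.add_one_le_exp (-((dot X (yv σ lam N (rz v b))) ^ 2 / (32 * d)))
        have h4 : (dot X (yv σ lam N (rz v b))) ^ 2 / (32 * d) ≤
            3 / (32 * d) * (dot X (fun j => (rz v b j : ℝ) - v j)) ^ 2 + 6 / 32 := by
          rw [div_le_iff₀ (by positivity)]
          refine h2.trans (le_of_eq ?_)
          field_simp
        linarith
      refine le_trans ?_ this
      rw [Ex_add, Ex_const (rdW_sum v), Ex_smul]
      have h5 : 3 / (32 * d) * Ex (rdW v) (fun b => (dot X (fun j => (rz v b j : ℝ) - v j)) ^ 2) ≤ 3 / (32 * d) * (10 * d / 4) := by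
        refine mul_le_mul_of_nonneg_left ?_ (by positivity)
        refine hvar.trans ?_
        linarith
      have h6 : 3 / (32 * d) * (10 * d / 4) = 15 / 64 := by field_simp; norm_num
      linarith
    have e : Ex (rdW v) (fun b => f (rz v b)) = Ex (rowW p) (fun X => ind (S X) * Ex (rdW v) (fun b => Real.exp (-((dot X (yv σ lam N (rz v b))) ^ 2 / (32 * d))))) := by
      simp only [hf, Ex, Finset.mul_sum]
      rw [Finset.sum_comm]
      refine Finset.sum_congr rfl fun X _ => Finset.sum_congr rfl fun b _ => ?_
      ring
    have h7 : (1 - 27 / 64) * P ≤ Ex (rdW v) (fun b => f (rz v b)) := by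
      rw [e, hPdef, Pr_eq_Ex, ← Ex_smul]
      refine Ex_mono hw fun X => ?_
      by_cases hX : S X
      · rw [ind_true hX, one_mul, mul_one]; exact h1 X hX
      · rw [ind_false hX]; simp
    linarith
  have hFE : Ex (rdW v) (fun b => F (rz v b)) ≤ 1 / 2 := by
    have e : Ex (rdW v) (fun b => F (rz v b)) = (P - Ex (rdW v) (fun b => f (rz v b))) / (27 / 32 * P) := by
      have : ∀ b, F (rz v b) = P / (27 / 32 * P) + (-(1 / (27 / 32 * P))) * f (rz v b) := by
        intro b; simp only [hF]; ring
      simp only [this]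
      rw [Ex_add, Ex_const (rdW_sum v), Ex_smul]; ring
    rw [e, div_le_iff₀ (by positivity)]
    linarith
  obtain ⟨z, hz1, hz2⟩ := exists_cls hι hpar.hd hT hP hN F hF0 hFE
  simp only [hF] at hz2
  rw [div_lt_one (by positivity)] at hz2
  have h8 : f z ≤ rho p (yv σ lam N z) := by
    refine Ex_mono hw fun X => ?_
    exact mul_le_mul_of_nonneg_right (ind_mono fun h => h.1) (Real.exp_pos _).le
  have := hr z hz1
  linarith

end
end SB

set_option linter.all false
namespace SB
open Finset

lemma decay (b a : ℝ) (ha : 0 < a) (hb : 0 ≤ b) : ∃ d0 : ℝ, ∀ d, d0 ≤ d → b * Real.sqrt d * Real.exp (-(a * d)) ≤ 1 := by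
  refine ⟨max 1 (2 * b / a ^ 2), fun d hd => ?_⟩
  have h1 : 1 ≤ d := (le_max_left _ _).trans hd
  have h2 : 2 * b / a ^ 2 ≤ d := (le_max_right _ _).trans hd
  rw [div_le_iff₀ (by positivity)] at h2
  have h3 : Real.sqrt d ≤ d := by
    rw [Real.sqrt_le_left (by linarith)]; nlinarith
  have h4 := Real.quadratic_le_exp_of_nonneg (x := a * d) (by positivity)
  rw [Real.exp_neg, ← div_eq_mul_inv, div_le_one (Real.exp_pos _)]
  have h5 : 0 ≤ a * d := by positivity
  calc b * Real.sqrt d ≤ b * d := by gcongr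
    _ ≤ (a * d) ^ 2 / 2 := by nlinarith
    _ ≤ _ := by linarith

noncomputable def kk : ℕ := ⌈704 * Real.exp (8 * 400 / bet) / bet ^ 2⌉₊ + 1
noncomputable def jj : ℕ := ⌈(kk : ℝ) * HH⌉₊ + 1

lemma kk_spec : 704 * Real.exp (8 * 400 / bet) ≤ kk * bet ^ 2 := by
  have hb := bet_pos
  rw [← div_le_iff₀ (by positivity)]
  have := Nat.le_ceil (704 * Real.exp (8 * 400 / bet) / bet ^ 2)
  unfold kk; push_cast; linarith

lemma kk_ge : 1 ≤ kk := by unfold kk; omega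
lemma jj_ge : 1 ≤ jj := by unfold jj; omega
lemma jj_spec : (kk : ℝ) * HH ≤ jj := by
  have := Nat.le_ceil ((kk : ℝ) * HH)
  unfold jj; push_cast; linarith

noncomputable def CC : ℝ := 1000000 + Real.exp 800 + 2 * (kk + 3)

lemma exists_par : ∃ n1 : ℕ, ∀ n : ℕ, n1 ≤ n → ∀ p : ℝ, CC * Real.log n ≤ p * n → p ≤ CC⁻¹ →
    Par kk jj 64000 p n ∧ 801 ≤ Real.log n ∧ cG ^ kk ≤ Real.exp n := by
  have hk1 : (1 : ℝ) ≤ kk := by exact_mod_cast kk_ge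
  have hj1 : (1 : ℝ) ≤ jj := by exact_mod_cast jj_ge
  have hH := HH_ge
  obtain ⟨a1, h1⟩ := decay (16 * (kk : ℝ) ^ 2) (1 / (8 * (kk * jj) ^ 2)) (by positivity) (by positivity)
  obtain ⟨a2, h2⟩ := decay (32 * (kk : ℝ) ^ 2) 0.9 (by norm_num) (by positivity)
  obtain ⟨a3, h3⟩ := decay (8 * (kk : ℝ) ^ 2) (8 / (kk * jj) ^ 2) (by positivity) (by positivity)
  obtain ⟨a4, h4⟩ := decay 2 0.9 (by norm_num) (by positivity)
  obtain ⟨a5, h5⟩ := decay (2 * 64000) (4 / (HH * 64000) ^ 2) (by positivity) (by positivity)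
  have htend : Filter.Tendsto (fun n : ℕ => Real.log (n : ℝ)) Filter.atTop Filter.atTop :=
    Real.tendsto_log_atTop.comp tendsto_natCast_atTop_atTop
  obtain ⟨n1, hn1⟩ := Filter.eventually_atTop.1 (htend.eventually_ge_atTop
    (801 + |a1| + |a2| + |a3| + |a4| + |a5| + |Real.log (cG ^ kk)|))
  refine ⟨max n1 1, fun n hn p hp1 hp2 => ?_⟩
  have hlog := hn1 n ((le_max_left _ _).trans hn)
  have hn1' : 1 ≤ n := (le_max_right _ _).trans hn
  have hn0 : (0 : ℝ) < n := by exact_mod_cast hn1'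
  have b1 := abs_nonneg a1
  have b2 := abs_nonneg a2
  have b3 := abs_nonneg a3
  have b4 := abs_nonneg a4
  have b5 := abs_nonneg a5
  have b6 := abs_nonneg (Real.log (cG ^ kk))
  have hlog801 : 801 ≤ Real.log n := by linarith
  have hC1 : 1000000 ≤ CC := by unfold CC; have := Real.exp_pos 800; linarith
  have hC2 : Real.exp 800 ≤ CC := by unfold CC; linarith
  have hd1 : 1000000 * Real.log n ≤ p * n := le_trans (by nlinarith) hp1
  set d := p * n with hd
  have hdl : Real.log n ≤ d := by linarith
  have hp0 : 0 < p := by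
    by_contra hc
    push Not at hc
    have : p * n ≤ 0 := mul_nonpos_of_nonpos_of_nonneg hc hn0.le
    linarith
  have hnlog : Real.log n ≤ n - 1 := Real.log_le_sub_one_of_pos hn0
  have hsq1 : 1 ≤ Real.sqrt d := by rw [Real.one_le_sqrt]; linarith
  have g1 := h1 d (by linarith [le_abs_self a1])
  have g2 := h2 d (by linarith [le_abs_self a2])
  have g3 := h3 d (by linarith [le_abs_self a3])
  have g4 := h4 d (by linarith [le_abs_self a4])
  have g5 := h5 d (by linarith [le_abs_self a5])
  refine ⟨⟨kk_ge, jj_ge, jj_spec, le_refl _, hp0, ?_, ?_, by linarith, ?_, by linarith, ?_, ?_, ?_, ?_, ?_⟩, hlog801, ?_⟩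
  · rw [Real.exp_neg]
    exact hp2.trans (inv_anti₀ (Real.exp_pos _) hC2)
  · refine hp2.trans ?_
    rw [inv_le_comm₀ (by linarith) (by norm_num)]
    norm_num; linarith
  · have : Real.exp (2 * Real.log n) ≤ Real.exp (p * n / 2) := Real.exp_le_exp.2 (by linarith)
    refine le_trans ?_ this
    rw [two_mul, Real.exp_add, Real.exp_log hn0]
    nlinarith
  · have e : p / 2 * (n / (4 * ((kk : ℝ) * jj) ^ 2)) = 1 / (8 * (kk * jj) ^ 2) * d := by rw [hd]; field_simp; norm_num
    rw [e]
    linarith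
  · have e : 8 * (p * n) / ((kk : ℝ) * jj) ^ 2 = 8 / (kk * jj) ^ 2 * d := by rw [hd]; ring
    rw [e]; exact g3
  · have : Real.exp (-(2 * (p * n))) ≤ Real.exp (-1) := Real.exp_le_exp.2 (by linarith)
    have h2 : Real.exp (-1) ≤ 1 / 2 := by
      rw [Real.exp_neg, inv_le_comm₀ (Real.exp_pos _) (by norm_num)]
      have := Real.exp_one_gt_d9
      norm_num; linarith
    linarith
  · refine le_trans (le_of_eq ?_) g4
    ring
  · have e : 4 * (p * n) / (HH * 64000) ^ 2 = 4 / (HH * 64000) ^ 2 * d := by rw [hd]; ring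
    rw [e, le_div_iff₀ (by norm_num)]
    have := Real.exp_pos (-(4 / (HH * 64000) ^ 2 * d))
    nlinarith
  · have hc : 0 < cG ^ kk := by have := cG_ge; positivity
    rw [← Real.log_le_iff_le_exp hc]
    have := le_abs_self (Real.log (cG ^ kk))
    linarith

lemma exists_kernel {ι : Type} [Fintype ι] {n : ℕ} (hι : Fintype.card ι + 1 = n) (Q : ι → Fin n → Bool) :
    ∃ u : Fin n → ℝ, u ≠ 0 ∧ ∀ i, dot (Q i) u = 0 := by
  let M : Matrix ι (Fin n) ℝ := fun i j => if Q i j then 1 else 0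
  have h := LinearMap.ker_ne_bot_of_finrank_lt (f := M.mulVecLin) (by simp; omega)
  obtain ⟨u, hu, hu0⟩ := Submodule.exists_mem_ne_zero_of_ne_bot h
  refine ⟨u, hu0, fun i => ?_⟩
  have h2 : M.mulVec u i = 0 := congrFun (LinearMap.mem_ker.1 hu) i
  have h3 : M.mulVec u i = dot (Q i) u := by
    unfold dot
    simp [Matrix.mulVec, dotProduct, M]
  rw [← h3]; exact h2

set_option maxHeartbeats 2000000 in
lemma key_conc {n : ℕ} {p : ℝ} (hC1 : CC * Real.log n ≤ p * n) (hC2 : p ≤ CC⁻¹) (hpar : Par kk jj 64000 p n)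
    (hlog : 801 ≤ Real.log n) (hcn : cG ^ kk ≤ Real.exp n) : KeyConc CC 100000000000 n p := by
  classical
  intro ι _ _ hι
  have hp0 := hpar.h0
  have hp1 : p ≤ 1 := by linarith [hpar.hp1]
  have hw := matW_nonneg (ι := ι) (n := n) hp0.le hp1
  have hn801 := hpar.hn801
  have hn2 : 2 ≤ n := by
    have : (2 : ℝ) ≤ n := by linarith
    exact_mod_cast this
  have hCC : 1000000 + 2 * (kk + 3) ≤ CC := by unfold CC; have := Real.exp_pos 800; linarith
  have hk0 : (0 : ℝ) ≤ kk := Nat.cast_nonneg _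
  have hC0 : 0 < CC := by linarith
  have hpC : p * CC ≤ 1 := by rw [← le_div_iff₀ hC0, one_div]; exact hC2
  have hp6 : p * 1000000 ≤ 1 := le_trans (by gcongr; linarith) hpC
  have hpk : 2 * p * (kk + 3) ≤ 1 := by
    refine le_trans ?_ hpC
    nlinarith
  have hd6 : 1000000 * Real.log n ≤ p * n := le_trans (by nlinarith) hC1
  have hdn : p * n ≤ n / 1000000 := by
    have := mul_le_mul_of_nonneg_right hp6 (by linarith : (0 : ℝ) ≤ n)
    linarith
  have hd1 := hpar.hd
  -- levels
  have h64 : (64000 : ℝ) ≤ Real.exp (2 * (p * n)) := by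
    have := Real.add_one_le_exp (2 * (p * n)); linarith
  obtain ⟨I, hI1, hI2⟩ := exists_nat_pow_near (x := Real.exp (2 * (p * n)) / 64000) (y := 2)
    (by rw [le_div_iff₀ (by norm_num)]; linarith) (by norm_num)
  rw [le_div_iff₀ (by norm_num)] at hI1
  rw [div_lt_iff₀ (by norm_num)] at hI2
  have hIle : (64000 : ℝ) * 2 ^ I ≤ Real.exp (2 * (p * n)) := by linarith
  have hIn : I ≤ n := by
    have h2 : (2 : ℝ) ^ I ≤ 2 ^ n := by
      have h3 : (2 : ℝ) ^ I ≤ Real.exp (2 * (p * n)) := by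
        have : (0 : ℝ) ≤ 2 ^ I := by positivity
        linarith
      refine h3.trans ?_
      have h4 : Real.exp (2 * (p * n)) ≤ Real.exp (n * Real.log 2) := by
        rw [Real.exp_le_exp]
        have := Real.log_two_gt_d9
        nlinarith
      refine h4.trans (le_of_eq ?_)
      rw [Real.exp_nat_mul, Real.exp_log (by norm_num)]
    exact (pow_le_pow_iff_right₀ (by norm_num : (1 : ℝ) < 2)).1 h2
  have hNm : ∀ i ≤ I, (64000 : ℝ) * 2 ^ i ≤ Real.exp (2 * (p * n)) := by
    intro i hi
    refine le_trans ?_ hIle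
    have : (2 : ℝ) ^ i ≤ 2 ^ I := pow_le_pow_right₀ (by norm_num) hi
    linarith
  have h2pos : ∀ i : ℕ, (1 : ℝ) ≤ 2 ^ i := fun i => one_le_pow₀ (by norm_num)
  refine ⟨fun Q => Expand p Q ∧ ¬ TwoIrr (p * n) Q ∧ ¬ NetBad p Q ∧ ∀ i ≤ I, ¬ BadLevel p kk (64000 * 2 ^ i) Q, ?_, ?_⟩
  · -- probability
    set E := Real.exp (-(1.3 * (p * n))) with hE
    have hE0 : 0 < E := Real.exp_pos _
    have hnr : (1 : ℝ) ≤ n := by linarith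
    have q1 := expand_prob (ι := ι) hι hn2 hp0.le (by linarith) (by linarith) hd1
    have q2 := twoIrr_le (ι := ι) (n := n) hp0.le hp1
    have q3 := net_prob (ι := ι) hι hp0 hpar.hp1
    have q4 := Pr_exists_le_card hw (Finset.range (I + 1)) (fun i (Q : ι → Fin n → Bool) => BadLevel p kk (64000 * 2 ^ i) Q)
      (Real.exp (-n)) (fun i hi => bad_level_prob hι hn2 hp0 hp1 kk_ge (by linarith [h2pos i])
        (hNm i (by rw [Finset.mem_range] at hi; omega)) hpk hcn kk_spec)
    have hmono : Pr (matW p) (fun Q : ι → Fin n → Bool => (∀ j, ∃ i, Q i j = true) ∧ ¬ (Expand p Q ∧ ¬ TwoIrr (p * n) Q ∧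
        ¬ NetBad p Q ∧ ∀ i ≤ I, ¬ BadLevel p kk (64000 * 2 ^ i) Q)) ≤
        Pr (matW p) (fun Q : ι → Fin n → Bool => ¬ Expand p Q ∨ (TwoIrr (p * n) Q ∨ (NetBad p Q ∨
          ∃ i ∈ Finset.range (I + 1), BadLevel p kk (64000 * 2 ^ i) Q))) := by
      refine Pr_mono hw fun Q hQ => ?_
      obtain ⟨_, hQ⟩ := hQ
      by_contra hc
      push Not at hc
      refine hQ ⟨hc.1, hc.2.1, hc.2.2.1, fun i hi => hc.2.2.2 i (by rw [Finset.mem_range]; omega)⟩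
    have o1 := Pr_or_le hw (fun Q : ι → Fin n → Bool => ¬ Expand p Q) (fun Q : ι → Fin n → Bool => (TwoIrr (p * n) Q ∨ (NetBad p Q ∨
          ∃ i ∈ Finset.range (I + 1), BadLevel p kk (64000 * 2 ^ i) Q)))
    have o2 := Pr_or_le hw (fun Q : ι → Fin n → Bool => TwoIrr (p * n) Q) (fun Q : ι → Fin n → Bool => (NetBad p Q ∨
          ∃ i ∈ Finset.range (I + 1), BadLevel p kk (64000 * 2 ^ i) Q))
    have o3 := Pr_or_le hw (fun Q : ι → Fin n → Bool => NetBad p Q) (fun Q : ι → Fin n → Bool =>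
          ∃ i ∈ Finset.range (I + 1), BadLevel p kk (64000 * 2 ^ i) Q)
    have e1 : Real.exp (-(1.5 * (p * n))) ≤ E := Real.exp_le_exp.2 (by linarith)
    have e2 : Real.exp (-(1.8 * (p * n))) ≤ E := Real.exp_le_exp.2 (by linarith)
    have e3 : Real.exp (-((n : ℝ) / 50)) ≤ E := Real.exp_le_exp.2 (by linarith)
    have e4 : Real.exp (-(n : ℝ)) ≤ E := Real.exp_le_exp.2 (by linarith)
    have n5 : (n : ℝ) ≤ n ^ 5 := le_self_pow₀ hnr (by norm_num)
    have n52 : (n : ℝ) ^ 2 ≤ n ^ 5 := pow_le_pow_right₀ hnr (by norm_num)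
    have n54 : (n : ℝ) ^ 4 ≤ n ^ 5 := pow_le_pow_right₀ hnr (by norm_num)
    have hcardι : (Fintype.card ι : ℝ) ≤ n := by exact_mod_cast (by omega : Fintype.card ι ≤ n)
    have f1 : n * Real.exp (-(1.5 * (p * n))) ≤ n ^ 5 * E := by gcongr
    have f2 : (Fintype.card ι : ℝ) ^ 2 * (4 * Real.exp (-(1.8 * (p * n)))) ≤ n ^ 5 * (4 * E) := by
      have : (Fintype.card ι : ℝ) ^ 2 ≤ n ^ 5 := (pow_le_pow_left₀ (Nat.cast_nonneg _) hcardι 2).trans n52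
      gcongr
    have f3 : 4 * (n : ℝ) ^ 4 * Real.exp (-((n : ℝ) / 50)) ≤ 4 * n ^ 5 * E := by gcongr
    have f4 : ((Finset.range (I + 1)).card : ℝ) * Real.exp (-(n : ℝ)) ≤ 2 * n ^ 5 * E := by
      rw [card_range]
      have : ((I + 1 : ℕ) : ℝ) ≤ 2 * n ^ 5 := by
        have : (I : ℝ) ≤ n := by exact_mod_cast hIn
        push_cast; linarith
      gcongr
    have hpos : 0 < (n : ℝ) ^ 5 * E := by positivity
    have : 100000000000 * (n : ℝ) ^ 5 * E = 100000000000 * (n ^ 5 * E) := by ring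
    rw [this]
    have hK : (11 : ℝ) * (n ^ 5 * E) ≤ 100000000000 * (n ^ 5 * E) :=
      mul_le_mul_of_nonneg_right (by norm_num) hpos.le
    refine hmono.trans (le_trans ?_ hK)
    linarith
  · rintro Q ⟨hExp, hT, hNet, hB⟩ hcol
    obtain ⟨u, hu0, hker⟩ := exists_kernel hι Q
    refine ⟨u, hu0, hker, fun s hs => ?_⟩
    obtain ⟨σ, lam, hP⟩ := exists_prof hι hp0 hp1 hd6 (by linarith) hExp hT hNet hcol hu0 hker
    have hσ := hP.pos
    set d := p * n with hd
    have hsq1 : 1 ≤ Real.sqrt d := by rw [Real.one_le_sqrt]; linarith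
    have hrw := rowW_nonneg (n := n) hp0.le hp1
    set L := Real.log (2 * n) with hL
    have hLge : 801 ≤ L := by
      refine hlog.trans (Real.log_le_log (by linarith) (by linarith))
    set D := Real.exp (1.5 * L ^ 2) with hD
    have hD0 : 0 < D := Real.exp_pos _
    set x := s * D with hx
    have hx0 : 0 < x := by positivity
    have hExs : Real.exp (2 * L ^ 2) * s = Real.exp (0.5 * L ^ 2) * x := by
      rw [hx, hD, mul_comm s, ← mul_assoc, ← Real.exp_add]; congr 2; ring
    have hbig : 100000000000 ≤ Real.exp (0.5 * L ^ 2) := by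
      have h1 : Real.exp 40 ≤ Real.exp (0.5 * L ^ 2) := Real.exp_le_exp.2 (by nlinarith)
      refine le_trans ?_ h1
      have : (2 : ℝ) ^ 40 ≤ Real.exp 40 := by
        rw [show (40 : ℝ) = ((40 : ℕ) : ℝ) * 1 by norm_num, Real.exp_nat_mul]
        exact pow_le_pow_left₀ (by norm_num) (by linarith [Real.exp_one_gt_d9]) _
      norm_num at this ⊢; linarith
    have hlev : ∀ i ≤ I, x ≤ Real.sqrt d / (64000 * 2 ^ i) →
        Pr (rowW p) (fun X : Fin n → Bool => Reg d X ∧ |dot X u| ≤ s * eNorm u) ≤ 35000000000 / (64000 * 2 ^ i) := by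
      intro i hi hxi
      have hN0 : (0 : ℝ) < 64000 * 2 ^ i := by linarith [h2pos i]
      have h1 := kernel_small_ball hι hpar hT hP hN0 (fun z hz => levels hι hpar hT hP hker hIle hB i hi z hz)
      refine (Pr_mono hrw fun X hX => ⟨hX.1, ?_⟩).trans (h1.trans (le_of_eq (by ring)))
      refine hX.2.trans ?_
      calc s * eNorm u ≤ s * (D * σ) := by gcongr; exact hP.norm_le
        _ = x * σ := by rw [hx]; ring
        _ ≤ Real.sqrt d / (64000 * 2 ^ i) * σ := by gcongr
        _ = _ := by ring
    have hEpos : 0 < Real.exp (-(1.3 * d)) := Real.exp_pos _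
    rw [hExs]
    have hK0 : 0 < (100000000000 : ℝ) * Real.exp (-(1.3 * d)) := by positivity
    have hX0 : 0 < Real.exp (0.5 * L ^ 2) * x := by positivity
    by_cases hr : 1 ≤ Real.sqrt d / (64000 * x)
    · obtain ⟨i, hi1, hi2⟩ := exists_nat_pow_near hr (by norm_num : (1 : ℝ) < 2)
      rw [le_div_iff₀ (by positivity)] at hi1
      rw [div_lt_iff₀ (by positivity)] at hi2
      by_cases hiI : i ≤ I
      · have h1 := hlev i hiI (by rw [le_div_iff₀ (by linarith [h2pos i])]; linarith)
        refine h1.trans ?_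
        have h2 : (35000000000 : ℝ) / (64000 * 2 ^ i) ≤ 70000000000 * x := by
          rw [div_le_iff₀ (by linarith [h2pos i])]
          rw [pow_succ] at hi2
          nlinarith
        have h3 : 70000000000 * x ≤ Real.exp (0.5 * L ^ 2) * x := by
          refine mul_le_mul_of_nonneg_right ?_ hx0.le
          norm_num at hbig ⊢; linarith
        linarith
      · have h2i : (2 : ℝ) ^ I ≤ 2 ^ i := pow_le_pow_right₀ (by norm_num) (by omega)
        have h1 := hlev I le_rfl (by
          rw [le_div_iff₀ (by linarith [h2pos I])]
          nlinarith)
        refine h1.trans ?_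
        have h2 : (35000000000 : ℝ) / (64000 * 2 ^ I) ≤ 100000000000 * Real.exp (-(1.3 * d)) := by
          rw [div_le_iff₀ (by linarith [h2pos I])]
          rw [pow_succ] at hI2
          have h3 : Real.exp (2 * d) * Real.exp (-(1.3 * d)) ≥ 1 := by
            rw [← Real.exp_add]; exact Real.one_le_exp (by linarith)
          have h4 : Real.exp (2 * d) * Real.exp (-(1.3 * d)) ≤ 2 ^ I * 2 * 64000 * Real.exp (-(1.3 * d)) :=
            mul_le_mul_of_nonneg_right hI2.le hEpos.le
          have h5 : (100000000000 : ℝ) * Real.exp (-(1.3 * d)) * (64000 * 2 ^ I) = 50000000000 * (2 ^ I * 2 * 64000 * Real.exp (-(1.3 * d))) := by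
            ring
          rw [h5]
          have h6 : 1 ≤ 2 ^ I * 2 * 64000 * Real.exp (-(1.3 * d)) := h3.trans h4
          have h7 := mul_le_mul_of_nonneg_left h6 (by norm_num : (0 : ℝ) ≤ 50000000000)
          refine le_trans ?_ h7
          norm_num
        linarith
    · have hr' : Real.sqrt d < 64000 * x := by
        by_contra hc
        push Not at hc
        exact hr (by rw [le_div_iff₀ (by positivity)]; linarith)
      have h1 := Pr_le_one hrw rowW_sum (fun X : Fin n → Bool => Reg d X ∧ |dot X u| ≤ s * eNorm u)
      have h2 : 100000000000 * x ≤ Real.exp (0.5 * L ^ 2) * x := mul_le_mul_of_nonneg_right hbig hx0.le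
      have h3 : (64000 : ℝ) * x ≤ 100000000000 * x := mul_le_mul_of_nonneg_right (by norm_num) hx0.le
      refine h1.trans ?_
      have h4 : 1 ≤ Real.exp (0.5 * L ^ 2) * x := by
        refine hsq1.trans (hr'.le.trans (h3.trans h2))
      linarith

lemma key_all : ∃ C K : ℝ, 1 ≤ C ∧ 0 ≤ K ∧ ∃ n1 : ℕ, ∀ n, n1 ≤ n → ∀ p : ℝ, C * Real.log n ≤ p * n → p ≤ C⁻¹ → KeyConc C K n p := by
  obtain ⟨n1, h⟩ := exists_par
  refine ⟨CC, 100000000000, ?_, by norm_num, n1, fun n hn p h1 h2 => ?_⟩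
  · unfold CC
    have := Real.exp_pos 800
    have : (0 : ℝ) ≤ kk := Nat.cast_nonneg _
    linarith
  · obtain ⟨a, b, c⟩ := h n hn p h1 h2
    exact key_conc h1 h2 a b c

end SB

/-- Main theorem: for `C log n / n ≤ p ≤ C⁻¹`, the singularity probability of a Bernoulli(p)
matrix is `(2 + o_n(1)) n (1-p)^n`, together with a small ball estimate for the smallest
singular value. -/
theorem singularity_sparse_bernoulli :
    ∃ C : ℝ, 1 ≤ C ∧
      ∀ ε : ℝ, 0 < ε → ∃ n₀ : ℕ, ∀ n : ℕ, n₀ ≤ n →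
        ∀ p : ℝ, C * Real.log n ≤ p * n → p ≤ C⁻¹ →
          ∀ (Ω : Type) [MeasurableSpace Ω] (μ : Measure Ω), IsProbabilityMeasure μ →
            ∀ M : Ω → Matrix (Fin n) (Fin n) ℝ, IsBernoulliMatrix μ M p →
              |(μ {ω | (M ω).det = 0}).toReal - 2 * n * (1 - p) ^ n| ≤ ε * (n * (1 - p) ^ n) ∧
              ∀ t : ℝ, 0 < t →
                (μ {ω | sMin (M ω) ≤ t * Real.exp (-3 * (Real.log (2 * n)) ^ 2)}).toReal
                  ≤ t + (2 + ε) * (n * (1 - p) ^ n) := by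
  exact SB.final_of_key SB.key_all
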